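/- Let Q₀,Q₁,Q₂,Q₃ be real symmetric 4×4 matrices whose associated determinantal quartic X ⊂ ℂP³ is transversal and whose spectrahedral region R ⊂ ℝP³ is nonempty. Let m be the number of real nodes of X that lie (as points of ℝP³) in the closure of R, and let n be the number of real nodes of X that do not lie in the closure of R. Then m and n are both even and m + n ≥ 2. -/

import Mathlib

open Matrix
open scoped LinearAlgebra.Projectivization

noncomputable section

/-- The topology on real projective 3-space, as a quotient of `(Fin 4 → ℝ) ∖ {0}`. -/
instance : TopologicalSpace (ℙ ℝ (Fin 4 → ℝ)) :=
  inferInstanceAs (TopologicalSpace (Quotient (projectivizationSetoid ℝ (Fin 4 → ℝ))))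

namespace DetQuartic

/-- The complex matrix `Q(x) = x₀Q₀ + x₁Q₁ + x₂Q₂ + x₃Q₃` of the pencil, for `x ∈ ℂ⁴`. -/
def Qc (Q : Fin 4 → Matrix (Fin 4) (Fin 4) ℝ) (x : Fin 4 → ℂ) : Matrix (Fin 4) (Fin 4) ℂ :=
  ∑ i, x i • (Q i).map (fun a => (a : ℂ))

/-- The real matrix `Q(x)` for `x ∈ ℝ⁴`. -/
def Qr (Q : Fin 4 → Matrix (Fin 4) (Fin 4) ℝ) (x : Fin 4 → ℝ) : Matrix (Fin 4) (Fin 4) ℝ :=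
  ∑ i, x i • Q i

/-- `f(x) = det Q(x)`, a homogeneous quartic polynomial function on `ℂ⁴`. -/
def detQ (Q : Fin 4 → Matrix (Fin 4) (Fin 4) ℝ) (x : Fin 4 → ℂ) : ℂ := (Qc Q x).det

/-- All four partial derivatives of `f` vanish at `x`. -/
def gradVanishes (Q : Fin 4 → Matrix (Fin 4) (Fin 4) ℝ) (x : Fin 4 → ℂ) : Prop :=
  ∀ i, fderiv ℂ (detQ Q) x (Pi.single i 1) = 0

/-- The Hessian matrix of `f` at `x`. -/
def hessian (Q : Fin 4 → Matrix (Fin 4) (Fin 4) ℝ) (x : Fin 4 → ℂ) :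
    Matrix (Fin 4) (Fin 4) ℂ :=
  Matrix.of fun i j =>
    fderiv ℂ (fun y => fderiv ℂ (detQ Q) y (Pi.single j 1)) x (Pi.single i 1)

/-- `x` is a representative of a node: a singular point where the Hessian has rank `3`. -/
def IsNodeRep (Q : Fin 4 → Matrix (Fin 4) (Fin 4) ℝ) (x : Fin 4 → ℂ) : Prop :=
  gradVanishes Q x ∧ (hessian Q x).rank = 3

/-- The set of singular points of the determinantal quartic `X ⊆ ℂP³`. -/
def singPoints (Q : Fin 4 → Matrix (Fin 4) (Fin 4) ℝ) : Set (ℙ ℂ (Fin 4 → ℂ)) :=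
  {p | ∃ x, ∃ hx : x ≠ 0, p = Projectivization.mk ℂ x hx ∧ gradVanishes Q x}

/-- `X` is transversal: exactly ten singular points, all of which are nodes. -/
def Transversal (Q : Fin 4 → Matrix (Fin 4) (Fin 4) ℝ) : Prop :=
  (singPoints Q).Finite ∧ (singPoints Q).ncard = 10 ∧
    ∀ x : Fin 4 → ℂ, x ≠ 0 → gradVanishes Q x → (hessian Q x).rank = 3

/-- The complexification of a real vector. -/
def toC (x : Fin 4 → ℝ) : Fin 4 → ℂ := fun i => (x i : ℂ)

/-- The spectrahedral region `R ⊆ ℝP³`: classes of points where `Q(x)` is positive or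
negative definite. -/
def spectra (Q : Fin 4 → Matrix (Fin 4) (Fin 4) ℝ) : Set (ℙ ℝ (Fin 4 → ℝ)) :=
  {p | ∃ x, ∃ hx : x ≠ 0, p = Projectivization.mk ℝ x hx ∧
    ((Qr Q x).PosDef ∨ (-(Qr Q x)).PosDef)}

/-- The real nodes of `X`, regarded as points of `ℝP³`. -/
def realNodes (Q : Fin 4 → Matrix (Fin 4) (Fin 4) ℝ) : Set (ℙ ℝ (Fin 4 → ℝ)) :=
  {p | ∃ x, ∃ hx : x ≠ 0, p = Projectivization.mk ℝ x hx ∧ IsNodeRep Q (toC x)}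

abbrev M4 := Matrix (Fin 4) (Fin 4) ℝ
abbrev V4 := Fin 4 → ℝ

lemma spec (H : M4) (hH : H.IsSymm) : ∃ U : M4, ∃ μ : V4,
    Uᵀ * U = 1 ∧ U * Uᵀ = 1 ∧ H = U * diagonal μ * Uᵀ := by
  have h : H.IsHermitian := by
    rw [Matrix.IsHermitian, conjTranspose_eq_transpose_of_trivial]; exact hH
  refine ⟨h.eigenvectorUnitary, h.eigenvalues, ?_, ?_, ?_⟩
  · have := (Matrix.mem_unitaryGroup_iff').1 h.eigenvectorUnitary.2
    simpa [star_eq_conjTranspose, conjTranspose_eq_transpose_of_trivial] using this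
  · have := (Matrix.mem_unitaryGroup_iff).1 h.eigenvectorUnitary.2
    simpa [star_eq_conjTranspose, conjTranspose_eq_transpose_of_trivial] using this
  · have := h.spectral_theorem
    rw [Unitary.conjStarAlgAut_apply] at this
    simpa [star_eq_conjTranspose, conjTranspose_eq_transpose_of_trivial, Function.comp_def] using this

/-- `l` is the least eigenvalue of `H`. -/
def Low (H : M4) (l : ℝ) : Prop :=
  (∀ v : V4, l * (v ⬝ᵥ v) ≤ v ⬝ᵥ (H *ᵥ v)) ∧ ∃ v : V4, v ≠ 0 ∧ H *ᵥ v = l • v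

lemma dot_pos {v : V4} (h : v ≠ 0) : 0 < v ⬝ᵥ v := by
  simpa using (Matrix.dotProduct_star_self_pos_iff (v := v)).2 h

lemma dot_nn (v : V4) : 0 ≤ v ⬝ᵥ v := by
  exact Finset.sum_nonneg fun i _ => mul_self_nonneg _

lemma symm_swap {H : M4} (hH : H.IsSymm) (u v : V4) : u ⬝ᵥ (H *ᵥ v) = v ⬝ᵥ (H *ᵥ u) := by
  rw [dotProduct_mulVec, ← mulVec_transpose, hH.eq, dotProduct_comm]

lemma exists_low (H : M4) (hH : H.IsSymm) : ∃ l, Low H l := by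
  obtain ⟨U, μ, h1, h2, h3⟩ := spec H hH
  obtain ⟨i, hi⟩ := Finite.exists_min μ
  refine ⟨μ i, ?_, U *ᵥ Pi.single i 1, ?_, ?_⟩
  · intro v
    have e1 : v ⬝ᵥ v = (Uᵀ *ᵥ v) ⬝ᵥ (Uᵀ *ᵥ v) := by
      rw [dotProduct_mulVec, ← mulVec_transpose, transpose_transpose, mulVec_mulVec, h2, one_mulVec]
    have e2 : v ⬝ᵥ (H *ᵥ v) = (Uᵀ *ᵥ v) ⬝ᵥ (diagonal μ *ᵥ (Uᵀ *ᵥ v)) := by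
      rw [h3, ← mulVec_mulVec, ← mulVec_mulVec, dotProduct_mulVec, ← mulVec_transpose]
    rw [e1, e2]
    simp only [dotProduct, mulVec_diagonal, Finset.mul_sum]
    apply Finset.sum_le_sum
    intro j _
    nlinarith [hi j, mul_self_nonneg ((Uᵀ *ᵥ v) j), mul_nonneg (sub_nonneg.2 (hi j)) (mul_self_nonneg ((Uᵀ *ᵥ v) j))]
  · intro h
    have : Uᵀ *ᵥ (U *ᵥ Pi.single i 1) = (Pi.single i 1 : V4) := by
      rw [mulVec_mulVec, h1, one_mulVec]
    rw [h, mulVec_zero] at this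
    have := congrFun this i
    simp at this
  · rw [h3, mulVec_mulVec, mul_assoc, h1, mul_one, ← mulVec_mulVec]
    rw [diagonal_mulVec_single]
    rw [mul_one, ← mulVec_smul]
    congr 1
    ext j; simp [Pi.single_apply]

open Classical in
def lam (H : M4) : ℝ := if h : ∃ l, Low H l then h.choose else 0

lemma lam_low {H : M4} (hH : H.IsSymm) : Low H (lam H) := by
  have := exists_low H hH
  rw [lam, dif_pos this]; exact this.choose_spec

lemma lam_le {H : M4} (hH : H.IsSymm) (v : V4) : lam H * (v ⬝ᵥ v) ≤ v ⬝ᵥ (H *ᵥ v) :=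
  (lam_low hH).1 v

lemma lam_eq {H : M4} (hH : H.IsSymm) {l : ℝ} (h : Low H l) : lam H = l := by
  obtain ⟨v, hv, hv'⟩ := (lam_low hH).2
  obtain ⟨w, hw, hw'⟩ := h.2
  have a := h.1 v
  have b := lam_le hH w
  rw [hv', dotProduct_smul, smul_eq_mul] at a
  rw [hw', dotProduct_smul, smul_eq_mul] at b
  exact le_antisymm (le_of_mul_le_mul_right b (dot_pos hw)) (le_of_mul_le_mul_right a (dot_pos hv))

lemma quad_bound (E : M4) (v : V4) : v ⬝ᵥ (E *ᵥ v) ≤ (∑ i, ∑ j, |E i j|) * (v ⬝ᵥ v) := by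
  have key : ∀ i j, v i * (E i j * v j) ≤ |E i j| * (v ⬝ᵥ v) := by
    intro i j
    have hi : v i * v i ≤ v ⬝ᵥ v :=
      Finset.single_le_sum (f := fun k => v k * v k) (fun k _ => mul_self_nonneg _) (Finset.mem_univ i)
    have hj : v j * v j ≤ v ⬝ᵥ v :=
      Finset.single_le_sum (f := fun k => v k * v k) (fun k _ => mul_self_nonneg _) (Finset.mem_univ j)
    have h1 : |v i * v j| ≤ v ⬝ᵥ v := by
      rw [abs_le]; constructor <;> nlinarith [sq_nonneg (v i - v j), sq_nonneg (v i + v j)]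
    calc v i * (E i j * v j) = E i j * (v i * v j) := by ring
      _ ≤ |E i j * (v i * v j)| := le_abs_self _
      _ = |E i j| * |v i * v j| := abs_mul _ _
      _ ≤ _ := mul_le_mul_of_nonneg_left h1 (abs_nonneg _)
  rw [Finset.sum_mul]
  apply Finset.sum_le_sum
  intro i _
  rw [Finset.sum_mul, mulVec, dotProduct, Finset.mul_sum]
  exact Finset.sum_le_sum fun j _ => key i j

lemma lam_lip {A B : M4} (hA : A.IsSymm) (hB : B.IsSymm) :
    lam A ≤ lam B + ∑ i, ∑ j, |A i j - B i j| := by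
  obtain ⟨v, hv, hv'⟩ := (lam_low hB).2
  have a := lam_le hA v
  have b := quad_bound (A - B) v
  rw [sub_mulVec, dotProduct_sub, hv', dotProduct_smul, smul_eq_mul] at b
  simp only [Matrix.sub_apply] at b
  refine le_of_mul_le_mul_right ?_ (dot_pos hv)
  rw [add_mul]; linarith

lemma lam_cont {X : Type*} [TopologicalSpace X] {K : Set X} {H : X → M4}
    (hs : ∀ x, (H x).IsSymm) (hc : ContinuousOn H K) : ContinuousOn (fun x => lam (H x)) K := by
  intro x hx
  have hx' : ContinuousWithinAt H K x := hc x hx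
  have h0 : Filter.Tendsto (fun y => ∑ i, ∑ j, |H y i j - H x i j|) (nhdsWithin x K) (nhds 0) := by
    have : ContinuousWithinAt (fun y => ∑ i, ∑ j, |H y i j - H x i j|) K x := by
      apply tendsto_finsetSum; intro i _
      apply tendsto_finsetSum; intro j _
      apply Filter.Tendsto.abs
      apply Filter.Tendsto.sub_const
      exact ((continuous_apply_apply i j).continuousAt.comp_continuousWithinAt hx').tendsto
    have h := this.tendsto
    simpa using h
  have h1 := h0.const_add (lam (H x))
  have h2 := h0.const_sub (lam (H x))
  simp only [add_zero, sub_zero] at h1 h2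
  refine tendsto_of_tendsto_of_tendsto_of_le_of_le h2 h1 ?_ ?_
  · intro y
    have := lam_lip (hs x) (hs y)
    simp only [abs_sub_comm (H x _ _)] at this
    simp only; linarith
  · intro y; exact lam_lip (hs y) (hs x)

/-- two orthonormal kernel vectors -/
def Ker2 (C : M4) : Prop := ∃ k l : V4, k ⬝ᵥ k = 1 ∧ l ⬝ᵥ l = 1 ∧ k ⬝ᵥ l = 0 ∧ C *ᵥ k = 0 ∧ C *ᵥ l = 0

lemma ker2_of_diag {U : M4} {μ : V4} (h1 : Uᵀ * U = 1) {i j : Fin 4} (hij : i ≠ j)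
    (hi : μ i = 0) (hj : μ j = 0) : Ker2 (U * diagonal μ * Uᵀ) := by
  have hd : ∀ a b : Fin 4, (U *ᵥ Pi.single a 1) ⬝ᵥ (U *ᵥ Pi.single b 1) = (1 : M4) a b := by
    intro a b
    rw [dotProduct_mulVec, ← mulVec_transpose, mulVec_mulVec, h1, one_mulVec, one_apply]
    simp [Pi.single_apply, eq_comm]
  have hk : ∀ a, μ a = 0 → (U * diagonal μ * Uᵀ) *ᵥ (U *ᵥ Pi.single a 1) = 0 := by
    intro a ha
    rw [mulVec_mulVec, mul_assoc, h1, mul_one, ← mulVec_mulVec, diagonal_mulVec_single, ha]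
    simp
  exact ⟨U *ᵥ Pi.single i 1, U *ᵥ Pi.single j 1, by rw [hd]; simp, by rw [hd]; simp, by rw [hd]; simp [hij],
    hk i hi, hk j hj⟩

/-- adjugate of the shifted matrix -/
def GG (H : M4) : M4 := (H - lam H • (1 : M4)).adjugate

lemma sub_symm {H : M4} (hH : H.IsSymm) (l : ℝ) : (H - l • (1 : M4)).IsSymm := by
  rw [Matrix.IsSymm, transpose_sub, hH.eq, transpose_smul, transpose_one]

lemma GG_rank_one {H : M4} (hH : H.IsSymm) :
    ∃ w : V4, GG H = vecMulVec w w ∧ H *ᵥ w = lam H • w ∧ (w = 0 → Ker2 (H - lam H • (1 : M4))) := by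
  obtain ⟨U, μ, h1, h2, h3⟩ := spec _ (sub_symm hH (lam H))
  have hpos : ∀ v : V4, 0 ≤ v ⬝ᵥ ((H - lam H • (1 : M4)) *ᵥ v) := by
    intro v
    have := lam_le hH v
    rw [sub_mulVec, smul_mulVec, one_mulVec, dotProduct_sub, dotProduct_smul, smul_eq_mul]; linarith
  have hUi : ∀ a, (H - lam H • (1 : M4)) *ᵥ (U *ᵥ Pi.single a 1) = μ a • (U *ᵥ Pi.single a 1) := by
    intro a
    rw [h3, mulVec_mulVec, mul_assoc, h1, mul_one, ← mulVec_mulVec, diagonal_mulVec_single, mul_one,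
      ← mulVec_smul]
    congr 1
    ext j; simp [Pi.single_apply]
  have hd : ∀ a : Fin 4, (U *ᵥ Pi.single a 1) ⬝ᵥ (U *ᵥ Pi.single a 1) = 1 := by
    intro a
    rw [dotProduct_mulVec, ← mulVec_transpose, mulVec_mulVec, h1, one_mulVec]
    simp
  have hμ : ∀ a, 0 ≤ μ a := by
    intro a
    have := hpos (U *ᵥ Pi.single a 1)
    rwa [hUi, dotProduct_smul, hd, smul_eq_mul, mul_one] at this
  obtain ⟨i, hi⟩ : ∃ i, μ i = 0 := by
    obtain ⟨v, hv, hv'⟩ := (lam_low hH).2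
    have h0 : (H - lam H • (1 : M4)) *ᵥ v = 0 := by
      rw [sub_mulVec, smul_mulVec, one_mulVec, hv', sub_self]
    by_contra hcon
    push Not at hcon
    apply hv
    rw [h3, ← mulVec_mulVec, ← mulVec_mulVec] at h0
    have h4 : diagonal μ *ᵥ (Uᵀ *ᵥ v) = 0 := by
      have := congrArg (fun x => Uᵀ *ᵥ x) h0
      simpa [mulVec_mulVec, h1, ← mul_assoc] using this
    have h5 : Uᵀ *ᵥ v = 0 := by
      ext j
      have := congrFun h4 j
      rw [mulVec_diagonal] at this
      simpa [hcon j] using this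
    have := congrArg (fun x => U *ᵥ x) h5
    simpa [mulVec_mulVec, h2] using this
  set κ := ∏ j ∈ Finset.univ.erase i, μ j with hκ
  have hκ0 : 0 ≤ κ := Finset.prod_nonneg fun j _ => hμ j
  have hadjU : ∀ D : M4, (U * D * Uᵀ).adjugate = U * D.adjugate * Uᵀ := by
    intro D
    have hdet : U.det * U.det = 1 := by
      have := congrArg det h1
      simpa [det_mul, det_transpose] using this
    have hU : U.adjugate = U.det • Uᵀ := by
      have h6 : U.adjugate * U = U.det • (1 : M4) := adjugate_mul U
      calc U.adjugate = U.adjugate * (U * Uᵀ) := by rw [h2, mul_one]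
        _ = U.det • Uᵀ := by rw [← mul_assoc, h6, smul_mul_assoc, one_mul]
    rw [adjugate_mul_distrib, adjugate_mul_distrib, ← adjugate_transpose, hU, transpose_smul,
      transpose_transpose]
    simp only [smul_mul_assoc, mul_smul_comm, smul_smul, hdet, one_smul, mul_assoc]
  have hadj : (diagonal μ).adjugate = κ • vecMulVec (Pi.single i 1) (Pi.single i 1) := by
    rw [adjugate_diagonal]
    ext a b
    simp only [diagonal_apply, Matrix.smul_apply, vecMulVec_apply, smul_eq_mul, Pi.single_apply]
    by_cases hab : a = b
    · subst hab
      by_cases hai : a = i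
      · subst hai; simp [hκ]
      · simp only [if_true, hai, if_false]
        have : ∏ j ∈ Finset.univ.erase a, μ j = 0 :=
          Finset.prod_eq_zero (Finset.mem_erase.2 ⟨Ne.symm hai, Finset.mem_univ i⟩) hi
        simpa using this
    · rw [if_neg hab]
      by_cases hai : a = i
      · have : b ≠ i := fun h => hab (hai.trans h.symm)
        simp [this]
      · simp [hai]
  refine ⟨Real.sqrt κ • (U *ᵥ Pi.single i 1), ?_, ?_, ?_⟩
  · rw [GG, h3, hadjU, hadj]
    rw [vecMulVec_smul, smul_vecMulVec, smul_smul, Real.mul_self_sqrt hκ0, mul_smul_comm, smul_mul_assoc]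
    congr 1
    rw [mul_vecMulVec, vecMulVec_mul, vecMul_transpose]
  · have := hUi i
    rw [hi, zero_smul, sub_mulVec, smul_mulVec, one_mulVec, sub_eq_zero] at this
    rw [mulVec_smul, this, smul_comm]
  · intro h
    have hk : κ = 0 := by
      have h5 := congrArg (fun x => x ⬝ᵥ x) h
      simp only [smul_dotProduct, dotProduct_smul, hd, smul_eq_mul, mul_one, zero_dotProduct] at h5
      rwa [Real.mul_self_sqrt hκ0] at h5
    obtain ⟨j, hj, hj'⟩ := Finset.prod_eq_zero_iff.1 hk
    rw [h3]
    exact ker2_of_diag h1 (Finset.ne_of_mem_erase hj).symm hi hj'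

lemma GG_cont {X : Type*} [TopologicalSpace X] {K : Set X} {H : X → M4}
    (hs : ∀ x, (H x).IsSymm) (hc : ContinuousOn H K) : ContinuousOn (fun x => GG (H x)) K := by
  have h1 : ContinuousOn (fun x => H x - lam (H x) • (1 : M4)) K :=
    hc.sub ((lam_cont hs hc).smul continuousOn_const)
  exact (Continuous.matrix_adjugate continuous_id).comp_continuousOn h1

lemma exists_section {X E : Type*} [NormedAddCommGroup X] [NormedSpace ℝ X]
    [NormedAddCommGroup E] [NormedSpace ℝ E] {K : Set X} (hK : IsCompact K) (hconv : Convex ℝ K)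
    (P : X → E →L[ℝ] E) (hP : ContinuousOn P K) (hid : ∀ x ∈ K, ∀ v, P x (P x v) = P x v)
    {x0 : X} (hx0 : x0 ∈ K) {v0 : E} (hv0 : v0 ≠ 0) (hPv : P x0 v0 = v0) :
    ∃ v : X → E, ContinuousOn v K ∧ ∀ x ∈ K, v x ≠ 0 ∧ P x (v x) = v x := by
  have huc := hK.uniformContinuousOn_of_continuous hP
  rw [Metric.uniformContinuousOn_iff] at huc
  obtain ⟨δ, hδ, hδ'⟩ := huc 1 one_pos
  obtain ⟨R, hR⟩ := hK.isBounded.exists_norm_le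
  obtain ⟨N, hN⟩ := exists_nat_gt ((R + R) / δ)
  have hRR : 0 ≤ R := (norm_nonneg _).trans (hR x0 hx0)
  have hNpos : (0 : ℝ) < N := lt_of_le_of_lt (by positivity) hN
  have hN0 : (N : ℝ) ≠ 0 := hNpos.ne'
  let y : ℕ → X → X := fun k x => x0 + ((k : ℝ) / N) • (x - x0)
  have hyc : ∀ k, Continuous (y k) := fun k => by fun_prop
  have hyK : ∀ k ≤ N, ∀ x ∈ K, y k x ∈ K := by
    intro k hk x hx
    apply hconv.add_smul_sub_mem hx0 hx
    constructor
    · positivity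
    · rw [div_le_one hNpos]; exact_mod_cast hk
  have hyd : ∀ k, ∀ x ∈ K, dist (y (k + 1) x) (y k x) < δ := by
    intro k x hx
    have : y (k+1) x - y k x = ((1 : ℝ) / N) • (x - x0) := by
      simp only [y]
      rw [add_sub_add_left_eq_sub, ← sub_smul]
      congr 1
      push_cast; field_simp; ring
    rw [dist_eq_norm, this, norm_smul, Real.norm_of_nonneg (by positivity)]
    have h1 : ‖x - x0‖ ≤ R + R := (norm_sub_le _ _).trans (add_le_add (hR x hx) (hR x0 hx0))
    rw [div_lt_iff₀ hδ] at hN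
    rw [one_div, inv_mul_lt_iff₀ hNpos]
    linarith
  have main : ∀ k ≤ N, ∃ v : X → E, ContinuousOn v K ∧ ∀ x ∈ K, v x ≠ 0 ∧ P (y k x) (v x) = v x := by
    intro k
    induction k with
    | zero =>
      intro _
      refine ⟨fun _ => v0, continuousOn_const, fun x _ => ⟨hv0, ?_⟩⟩
      simpa [y] using hPv
    | succ k ih =>
      intro hk
      obtain ⟨v, hvc, hv⟩ := ih (by omega)
      refine ⟨fun x => P (y (k+1) x) (v x), ?_, ?_⟩
      · exact (hP.comp (hyc (k+1)).continuousOn (hyK (k+1) hk)).clm_apply hvc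
      · intro x hx
        refine ⟨?_, hid _ (hyK _ hk x hx) _⟩
        intro h0
        replace h0 : P (y (k+1) x) (v x) = 0 := h0
        obtain ⟨h1, h2⟩ := hv x hx
        have h3 := hδ' _ (hyK _ hk x hx) _ (hyK k (by omega) x hx) (hyd k x hx)
        rw [dist_eq_norm] at h3
        have h4 := (P (y (k+1) x) - P (y k x)).le_opNorm (v x)
        simp only [FunLike.coe_sub, Pi.sub_apply] at h4
        rw [h0, h2, zero_sub, norm_neg] at h4
        have h5 : 0 < ‖v x‖ := norm_pos_iff.2 h1
        nlinarith
  obtain ⟨v, hvc, hv⟩ := main N le_rfl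
  refine ⟨v, hvc, fun x hx => ?_⟩
  have := hv x hx
  simpa [y, hN0] using this

lemma cont_dot {X : Type*} [TopologicalSpace X] {K : Set X} {v w : X → V4}
    (hv : ContinuousOn v K) (hw : ContinuousOn w K) : ContinuousOn (fun x => v x ⬝ᵥ w x) K := by
  simp only [dotProduct]
  apply continuousOn_finsetSum
  intro i _
  exact ((continuous_apply i).comp_continuousOn hv).mul ((continuous_apply i).comp_continuousOn hw)

lemma vmv_trace (w : V4) : (vecMulVec w w).trace = w ⬝ᵥ w := by
  simp [trace, vecMulVec_apply, dotProduct]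

/-- lift of a rank one family over a compact convex set -/
lemma exists_lift {X : Type*} [NormedAddCommGroup X] [NormedSpace ℝ X] {K : Set X}
    (hK : IsCompact K) (hconv : Convex ℝ K) (G : X → M4) (hG : ContinuousOn G K)
    (h1 : ∀ x ∈ K, ∃ w : V4, w ≠ 0 ∧ G x = vecMulVec w w) :
    ∃ v : X → V4, ContinuousOn v K ∧ ∀ x ∈ K, vecMulVec (v x) (v x) = G x := by
  rcases K.eq_empty_or_nonempty with rfl | ⟨x0, hx0⟩
  · exact ⟨fun _ => 0, continuousOn_empty _, by simp⟩
  let Lf : M4 →ₗ[ℝ] (V4 →L[ℝ] V4) :=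
    (LinearMap.toContinuousLinearMap (𝕜 := ℝ) (E := V4) (F' := V4)).toLinearMap ∘ₗ
      (Matrix.toLin' (R := ℝ) (m := Fin 4) (n := Fin 4)).toLinearMap
  have hLf : ∀ (M : M4) (v : V4), Lf M v = M *ᵥ v := by intro M v; simp [Lf]
  have hLc : Continuous Lf := LinearMap.continuous_of_finiteDimensional Lf
  have htr : ContinuousOn (fun x => (G x).trace) K :=
    (Continuous.matrix_trace continuous_id).comp_continuousOn hG
  have htr0 : ∀ x ∈ K, 0 < (G x).trace := by
    intro x hx
    obtain ⟨w, hw, hw'⟩ := h1 x hx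
    rw [hw', vmv_trace]; exact dot_pos hw
  let P : X → V4 →L[ℝ] V4 := fun x => Lf ((G x).trace⁻¹ • G x)
  have hPw : ∀ x ∈ K, ∀ w, G x = vecMulVec w w → ∀ v, P x v = ((w ⬝ᵥ v) / (w ⬝ᵥ w)) • w := by
    intro x hx w hw v
    simp only [P, hLf]
    rw [hw, vmv_trace, smul_mulVec, vecMulVec_mulVec]
    ext i
    simp
    ring
  have hP : ContinuousOn P K :=
    hLc.comp_continuousOn ((htr.inv₀ fun x hx => (htr0 x hx).ne').smul hG)
  obtain ⟨w0, hw0, hw0'⟩ := h1 x0 hx0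
  obtain ⟨v, hvc, hv⟩ := exists_section hK hconv P hP (by
    intro x hx v
    obtain ⟨w, hw, hw'⟩ := h1 x hx
    have := (dot_pos hw).ne'
    rw [hPw x hx w hw', hPw x hx w hw', dotProduct_smul, smul_eq_mul, div_mul_cancel₀ _ this]) hx0 hw0 (by
      rw [hPw x0 hx0 w0 hw0', div_self (dot_pos hw0).ne', one_smul])
  refine ⟨fun x => Real.sqrt ((G x).trace / (v x ⬝ᵥ v x)) • v x, ?_, ?_⟩
  · have hdc : ContinuousOn (fun x => v x ⬝ᵥ v x) K := cont_dot hvc hvc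
    exact ((htr.div hdc fun x hx => (dot_pos (hv x hx).1).ne').sqrt).smul hvc
  · intro x hx
    obtain ⟨w, hw, hw'⟩ := h1 x hx
    obtain ⟨h2, h3⟩ := hv x hx
    rw [hPw x hx w hw'] at h3
    set c := (w ⬝ᵥ v x) / (w ⬝ᵥ w)
    have hc : c ≠ 0 := by rintro h; rw [h, zero_smul] at h3; exact h2 h3.symm
    rw [smul_vecMulVec, vecMulVec_smul, smul_smul, Real.mul_self_sqrt
      (div_nonneg (htr0 x hx).le (dot_nn _)), ← h3, hw', vmv_trace, smul_vecMulVec, vecMulVec_smul,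
      smul_smul, smul_smul]
    have : w ⬝ᵥ w / (c • w ⬝ᵥ c • w) * (c * c) = 1 := by
      rw [smul_dotProduct, dotProduct_smul, smul_eq_mul, smul_eq_mul]
      have := (dot_pos hw).ne'
      field_simp
    rw [mul_assoc, this, one_smul]

lemma vmv_eq {v w : V4} (h : vecMulVec v v = vecMulVec w w) : v = w ∨ v = -w := by
  have he : ∀ i j, v i * v j = w i * w j := fun i j => by
    have := congrFun (congrFun h i) j
    simpa [vecMulVec_apply] using this
  by_cases hw : w = 0
  · left; ext i
    have := he i i
    simp [hw] at this ⊢; exact this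
  · obtain ⟨i, hi⟩ : ∃ i, w i ≠ 0 := by
      by_contra hcon; push Not at hcon; exact hw (funext hcon)
    rcases mul_self_eq_mul_self_iff.1 (he i i) with h1 | h1
    · left; ext j
      have := he i j
      rw [h1] at this
      exact mul_left_cancel₀ hi this
    · right; ext j
      have := he i j
      rw [h1] at this
      have h2 : w i * (-v j) = w i * w j := by linarith
      have := mul_left_cancel₀ hi h2
      simp; linarith

/-- A nonvanishing continuous real function on a preconnected set has constant sign. -/
lemma const_sign {X : Type*} [TopologicalSpace X] {K : Set X} (hK : IsPreconnected K) {f : X → ℝ}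
    (hf : ContinuousOn f K) (h0 : ∀ x ∈ K, f x ≠ 0) {x y : X} (hx : x ∈ K) (hy : y ∈ K) :
    0 < f x * f y := by
  by_contra hcon
  push Not at hcon
  have hcon' : f x * f y < 0 := lt_of_le_of_ne hcon (mul_ne_zero (h0 x hx) (h0 y hy))
  have him := hK.image f hf
  have hoc := him.ordConnected
  have : (0 : ℝ) ∈ f '' K := by
    rcases mul_neg_iff.1 hcon' with ⟨h1, h2⟩ | ⟨h1, h2⟩
    · exact hoc.out ⟨y, hy, rfl⟩ ⟨x, hx, rfl⟩ ⟨h2.le, h1.le⟩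
    · exact hoc.out ⟨x, hx, rfl⟩ ⟨y, hy, rfl⟩ ⟨h1.le, h2.le⟩
  obtain ⟨z, hz, hz'⟩ := this
  exact h0 z hz hz'

lemma lift_unique {X : Type*} [TopologicalSpace X] {K : Set X} (hK : IsPreconnected K)
    {v w : X → V4} (hv : ContinuousOn v K) (hw : ContinuousOn w K) (h0 : ∀ x ∈ K, v x ≠ 0)
    (h : ∀ x ∈ K, v x = w x ∨ v x = - w x) {x : X} (hx : x ∈ K) (hxe : v x = w x) :
    ∀ y ∈ K, v y = w y := by
  intro y hy
  rcases h y hy with h1 | h1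
  · exact h1
  exfalso
  have hw0 : ∀ z ∈ K, w z ≠ 0 := by
    intro z hz hz0
    apply h0 z hz
    rcases h z hz with h2 | h2 <;> simp [h2, hz0]
  have := const_sign hK (f := fun x => v x ⬝ᵥ w x) (cont_dot hv hw) (by
    intro z hz
    have := (dot_pos (hw0 z hz)).ne'
    rcases h z hz with h2 | h2
    · simp only [h2]; exact this
    · simp only [h2, neg_dotProduct, neg_ne_zero]; exact this) hx hy
  simp only [hxe, h1, neg_dotProduct] at this
  nlinarith [dot_pos (hw0 x hx), dot_pos (hw0 y hy), mul_pos (dot_pos (hw0 x hx)) (dot_pos (hw0 y hy))]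

lemma parity_flip (T : ℝ → Prop) (a : ℝ) (F : Finset ℝ) : ∀ b, a < b → (∀ f ∈ F, a < f ∧ f < b) →
    (∀ x y, a ≤ x → x ≤ y → y ≤ b → (∀ f ∈ F, f < x ∨ y < f) → (T x ↔ T y)) →
    (∀ f ∈ F, ∀ η > 0, ∃ δ, 0 < δ ∧ δ < η ∧ ¬ (T (f - δ) ↔ T (f + δ))) →
    ((T a ↔ T b) ↔ Even F.card) := by
  induction F using Finset.induction_on_max with
  | empty =>
    intro b hab _ h _
    simpa using h a b le_rfl hab.le le_rfl (by simp)
  | insert f F hmax ih =>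
    intro b hab hF hconst hflip
    have hfF : f ∉ F := fun h => lt_irrefl _ (hmax f h)
    have hf := hF f (Finset.mem_insert_self _ _)
    obtain ⟨g, hg1, hg2, hg3⟩ : ∃ g, a ≤ g ∧ g < f ∧ ∀ x ∈ F, x ≤ g := by
      rcases F.eq_empty_or_nonempty with rfl | hne
      · exact ⟨a, le_rfl, hf.1, by simp⟩
      · refine ⟨F.max' hne, ?_, hmax _ (F.max'_mem hne), fun x hx => F.le_max' x hx⟩
        exact (hF _ (Finset.mem_insert_of_mem (F.max'_mem hne))).1.le
    obtain ⟨δ, hδ0, hδ1, hδ2⟩ := hflip f (Finset.mem_insert_self _ _) (min (f - g) (b - f))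
      (lt_min (by linarith) (by linarith [hf.2]))
    have h1 : δ < f - g := hδ1.trans_le (min_le_left _ _)
    have h2 : δ < b - f := hδ1.trans_le (min_le_right _ _)
    have hA := ih (f - δ) (by linarith)
      (fun x hx => ⟨(hF x (Finset.mem_insert_of_mem hx)).1, by linarith [hg3 x hx]⟩)
      (fun x y hx hxy hy hxF => hconst x y hx hxy (by linarith) (by
        intro z hz
        rcases Finset.mem_insert.1 hz with rfl | hz
        · right; linarith
        · exact hxF z hz))
      (fun x hx => hflip x (Finset.mem_insert_of_mem hx))
    have hB := hconst (f + δ) b (by linarith [hf.1]) (by linarith) le_rfl (by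
        intro z hz
        left
        rcases Finset.mem_insert.1 hz with rfl | hz
        · linarith
        · linarith [hg3 z hz])
    rw [Finset.card_insert_of_notMem hfF, Nat.even_add_one, ← hA, ← hB]
    tauto

section setreal
open Set Real

def Plus (G : ℝ → ℝ → M4) (g0 g1 : V4) (θ : ℝ) : Prop :=
  ∃ w : ℝ → V4, ContinuousOn w (Icc 0 π) ∧ (∀ t ∈ Icc 0 π, vecMulVec (w t) (w t) = G θ t) ∧
    w 0 = g0 ∧ w π = g1

lemma vmv_self_eq_zero {v : V4} : vecMulVec v v = 0 ↔ v = 0 := by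
  constructor
  · intro h
    rcases vmv_eq (w := 0) (h.trans (by simp)) with h | h <;> simpa using h
  · rintro rfl; simp

lemma plus_iff {G : ℝ → ℝ → M4} {g0 g1 : V4} (hg1 : g1 ≠ 0) {θ : ℝ} (hreg : ∀ t ∈ Icc 0 π, G θ t ≠ 0)
    {w : ℝ → V4} (hw : ContinuousOn w (Icc 0 π)) (hl : ∀ t ∈ Icc 0 π, vecMulVec (w t) (w t) = G θ t)
    (h0 : w 0 = g0) : Plus G g0 g1 θ ↔ w π = g1 := by
  constructor
  · rintro ⟨v, hv, hvl, hv0, hv1⟩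
    rw [← hv1]
    refine lift_unique isPreconnected_Icc hw hv ?_ ?_ (left_mem_Icc.2 pi_pos.le) (h0.trans hv0.symm) π
      (right_mem_Icc.2 pi_pos.le)
    · intro t ht h
      apply hreg t ht
      rw [← hl t ht, h]; simp
    · intro t ht
      exact vmv_eq ((hl t ht).trans (hvl t ht).symm)
  · intro h; exact ⟨w, hw, hl, h0, h⟩

lemma rect_lift {G : ℝ → ℝ → M4} (hG : Continuous (fun p : ℝ × ℝ => G p.1 p.2))
    (hr : ∀ θ t, ∃ w : V4, G θ t = vecMulVec w w) (a b c d : ℝ)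
    (hne : ∀ θ ∈ Icc a b, ∀ t ∈ Icc c d, G θ t ≠ 0) :
    ∃ v : ℝ × ℝ → V4, ContinuousOn v (Icc a b ×ˢ Icc c d) ∧
      ∀ p ∈ Icc a b ×ˢ Icc c d, vecMulVec (v p) (v p) = G p.1 p.2 := by
  apply exists_lift (isCompact_Icc.prod isCompact_Icc) ((convex_Icc a b).prod (convex_Icc c d))
    (fun p : ℝ × ℝ => G p.1 p.2) hG.continuousOn
  rintro ⟨θ, t⟩ ⟨h1, h2⟩
  obtain ⟨w, hw⟩ := hr θ t
  refine ⟨w, ?_, hw⟩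
  rintro rfl
  exact hne θ h1 t h2 (by rw [hw]; simp)

/-- A rectangle lift normalised on one horizontal edge where `G` is constant. -/
lemma rect_lift_norm {G : ℝ → ℝ → M4} (hG : Continuous (fun p : ℝ × ℝ => G p.1 p.2))
    (hr : ∀ θ t, ∃ w : V4, G θ t = vecMulVec w w) (a b c d e : ℝ) (hab : a ≤ b) (he : e ∈ Icc c d)
    (hne : ∀ θ ∈ Icc a b, ∀ t ∈ Icc c d, G θ t ≠ 0) (g : V4) (hg : ∀ θ, G θ e = vecMulVec g g) :
    ∃ v : ℝ × ℝ → V4, ContinuousOn v (Icc a b ×ˢ Icc c d) ∧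
      (∀ p ∈ Icc a b ×ˢ Icc c d, vecMulVec (v p) (v p) = G p.1 p.2) ∧
      ∀ θ ∈ Icc a b, v (θ, e) = g := by
  obtain ⟨v, hv, hl⟩ := rect_lift hG hr a b c d hne
  have hg0 : g ≠ 0 := by
    rintro rfl
    exact hne a (left_mem_Icc.2 hab) e he (by rw [hg]; simp)
  have hpm : ∀ θ ∈ Icc a b, v (θ, e) = g ∨ v (θ, e) = -g := fun θ hθ =>
    vmv_eq ((hl (θ, e) ⟨hθ, he⟩).trans (hg θ))
  have hcv : ContinuousOn (fun θ => v (θ, e)) (Icc a b) := by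
    apply hv.comp (by fun_prop)
    intro θ hθ; exact ⟨hθ, he⟩
  have hvne : ∀ θ ∈ Icc a b, v (θ, e) ≠ 0 := by
    intro θ hθ h0
    rcases hpm θ hθ with h | h <;> rw [h0] at h
    · exact hg0 h.symm
    · exact hg0 (neg_eq_zero.1 h.symm)
  rcases hpm a (left_mem_Icc.2 hab) with h | h
  · exact ⟨v, hv, hl, lift_unique isPreconnected_Icc hcv continuousOn_const hvne hpm
      (left_mem_Icc.2 hab) h⟩
  · refine ⟨fun p => - v p, hv.neg, ?_, ?_⟩
    · intro p hp
      rw [neg_vecMulVec, vecMulVec_neg, neg_neg, hl p hp]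
    · intro θ hθ
      have := lift_unique (w := fun _ => -g) isPreconnected_Icc hcv continuousOn_const hvne (by
        intro x hx; rw [neg_neg]; exact (hpm x hx).symm) (left_mem_Icc.2 hab) h θ hθ
      simp [this]

lemma plus_const {G : ℝ → ℝ → M4} (hG : Continuous (fun p : ℝ × ℝ => G p.1 p.2))
    (hr : ∀ θ t, ∃ w : V4, G θ t = vecMulVec w w) {g0 g1 : V4} (hg1 : g1 ≠ 0)
    (hG0 : ∀ θ, G θ 0 = vecMulVec g0 g0) (hG1 : ∀ θ, G θ π = vecMulVec g1 g1)
    {a b : ℝ} (hab : a ≤ b) (hne : ∀ θ ∈ Icc a b, ∀ t ∈ Icc 0 π, G θ t ≠ 0) :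
    Plus G g0 g1 a ↔ Plus G g0 g1 b := by
  obtain ⟨v, hv, hl, hv0⟩ := rect_lift_norm hG hr a b 0 π 0 hab (left_mem_Icc.2 pi_pos.le) hne g0 hG0
  have hp : π ∈ Icc 0 π := right_mem_Icc.2 pi_pos.le
  have key : ∀ θ ∈ Icc a b, (Plus G g0 g1 θ ↔ v (θ, π) = g1) := by
    intro θ hθ
    refine plus_iff (w := fun t => v (θ, t)) hg1 (hne θ hθ) ?_ ?_ (hv0 θ hθ)
    · apply hv.comp (by fun_prop)
      intro t ht; exact ⟨hθ, ht⟩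
    · intro t ht; exact hl (θ, t) ⟨hθ, ht⟩
  have hpm : ∀ θ ∈ Icc a b, v (θ, π) = g1 ∨ v (θ, π) = -g1 := fun θ hθ =>
    vmv_eq ((hl (θ, π) ⟨hθ, hp⟩).trans (hG1 θ))
  have hcv : ContinuousOn (fun θ => v (θ, π)) (Icc a b) := by
    apply hv.comp (by fun_prop)
    intro θ hθ; exact ⟨hθ, hp⟩
  have hvne : ∀ θ ∈ Icc a b, v (θ, π) ≠ 0 := by
    intro θ hθ h0
    rcases hpm θ hθ with h | h <;> rw [h0] at h
    · exact hg1 h.symm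
    · exact hg1 (neg_eq_zero.1 h.symm)
  have ha := left_mem_Icc.2 hab
  have hb := right_mem_Icc.2 hab
  rw [key a ha, key b hb]
  constructor
  · intro h
    exact lift_unique isPreconnected_Icc hcv continuousOn_const hvne hpm ha h b hb
  · intro h
    exact lift_unique isPreconnected_Icc hcv continuousOn_const hvne hpm hb h a ha

/-- Flip data at a node. -/
def FlipAt (G : ℝ → ℝ → M4) (θ0 t0 : ℝ) : Prop :=
  ∃ k l : V4, ∃ σ : ℝ, ∀ η > 0, ∃ δ ε : ℝ, 0 < δ ∧ δ < η ∧ 0 < ε ∧ ε < η ∧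
    (∀ θ, |θ - θ0| ≤ δ → 0 < l ⬝ᵥ (G θ (t0 - ε) *ᵥ l) ∧ 0 < k ⬝ᵥ (G θ (t0 + ε) *ᵥ k)) ∧
    (∀ t, |t - t0| ≤ ε → 0 < σ * (k ⬝ᵥ (G (θ0 + δ) t *ᵥ l)) ∧ σ * (k ⬝ᵥ (G (θ0 - δ) t *ᵥ l)) < 0)

lemma vmv_quad (w k l : V4) : k ⬝ᵥ (vecMulVec w w *ᵥ l) = (k ⬝ᵥ w) * (l ⬝ᵥ w) := by
  rw [vecMulVec_mulVec]
  simp [dotProduct_smul, dotProduct_comm w l, mul_comm]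

lemma plus_flip {G : ℝ → ℝ → M4} (hG : Continuous (fun p : ℝ × ℝ => G p.1 p.2))
    (hr : ∀ θ t, ∃ w : V4, G θ t = vecMulVec w w) {g0 g1 : V4} (hg1 : g1 ≠ 0)
    (hG0 : ∀ θ, G θ 0 = vecMulVec g0 g0) (hG1 : ∀ θ, G θ π = vecMulVec g1 g1)
    {θ0 t0 ρ : ℝ} (ht0 : 0 < t0) (ht1 : t0 < π) (hρ : 0 < ρ)
    (hne : ∀ θ, |θ - θ0| ≤ ρ → ∀ t ∈ Icc 0 π, G θ t = 0 → θ = θ0 ∧ t = t0)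
    (hfl : FlipAt G θ0 t0) :
    ∀ η > 0, ∃ δ, 0 < δ ∧ δ < η ∧ ¬ (Plus G g0 g1 (θ0 - δ) ↔ Plus G g0 g1 (θ0 + δ)) := by
  intro η hη
  obtain ⟨k, l, σ, hfl⟩ := hfl
  obtain ⟨δ, ε, hδ, hδη, hε, hεη, hh, hv⟩ := hfl (min (min η ρ) (min t0 (π - t0)))
    (lt_min (lt_min hη hρ) (lt_min ht0 (by linarith)))
  obtain ⟨⟨d1, d2⟩, d3, d4⟩ : (δ < η ∧ δ < ρ) ∧ δ < t0 ∧ δ < π - t0 := by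
    simpa [lt_min_iff] using hδη
  obtain ⟨⟨e1, e2⟩, e3, e4⟩ : (ε < η ∧ ε < ρ) ∧ ε < t0 ∧ ε < π - t0 := by
    simpa [lt_min_iff] using hεη
  refine ⟨δ, hδ, d1, ?_⟩
  have hIcc : ∀ θ ∈ Icc (θ0 - δ) (θ0 + δ), |θ - θ0| ≤ δ := by
    intro θ hθ
    rw [abs_le]; constructor <;> linarith [hθ.1, hθ.2]
  have hlr : θ0 - δ ≤ θ0 + δ := by linarith
  have hnb : ∀ θ ∈ Icc (θ0 - δ) (θ0 + δ), ∀ t ∈ Icc 0 (t0 - ε), G θ t ≠ 0 := by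
    intro θ hθ t ht h0
    have := (hne θ ((hIcc θ hθ).trans d2.le) t ⟨ht.1, by linarith [ht.2]⟩ h0).2
    linarith [ht.2]
  have hnt : ∀ θ ∈ Icc (θ0 - δ) (θ0 + δ), ∀ t ∈ Icc (t0 + ε) π, G θ t ≠ 0 := by
    intro θ hθ t ht h0
    have := (hne θ ((hIcc θ hθ).trans d2.le) t ⟨by linarith [ht.1], ht.2⟩ h0).2
    linarith [ht.1]
  obtain ⟨b, hb, hbl, hb0⟩ := rect_lift_norm hG hr _ _ 0 (t0 - ε) 0 hlr (left_mem_Icc.2 (by linarith)) hnb g0 hG0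
  obtain ⟨c, hc, hcl, hc1⟩ := rect_lift_norm hG hr _ _ (t0 + ε) π π hlr (right_mem_Icc.2 (by linarith)) hnt g1 hG1
  -- sign of the bottom edge
  have hbs : 0 < (l ⬝ᵥ b (θ0 - δ, t0 - ε)) * (l ⬝ᵥ b (θ0 + δ, t0 - ε)) := by
    refine const_sign (K := Icc (θ0 - δ) (θ0 + δ)) isPreconnected_Icc
      (f := fun θ => l ⬝ᵥ b (θ, t0 - ε)) ?_ ?_ (left_mem_Icc.2 hlr) (right_mem_Icc.2 hlr)
    · apply cont_dot continuousOn_const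
      apply hb.comp (by fun_prop)
      intro θ hθ; exact ⟨hθ, by constructor <;> simp <;> linarith⟩
    · intro θ hθ h0
      have h1 := (hh θ (hIcc θ hθ)).1
      rw [← hbl (θ, t0 - ε) ⟨hθ, by constructor <;> simp <;> linarith⟩, vmv_quad, h0] at h1
      simp at h1
  have hcs : 0 < (k ⬝ᵥ c (θ0 - δ, t0 + ε)) * (k ⬝ᵥ c (θ0 + δ, t0 + ε)) := by
    refine const_sign (K := Icc (θ0 - δ) (θ0 + δ)) isPreconnected_Icc
      (f := fun θ => k ⬝ᵥ c (θ, t0 + ε)) ?_ ?_ (left_mem_Icc.2 hlr) (right_mem_Icc.2 hlr)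
    · apply cont_dot continuousOn_const
      apply hc.comp (by fun_prop)
      intro θ hθ; exact ⟨hθ, by constructor <;> simp <;> linarith⟩
    · intro θ hθ h0
      have h1 := (hh θ (hIcc θ hθ)).2
      rw [← hcl (θ, t0 + ε) ⟨hθ, by constructor <;> simp <;> linarith⟩, vmv_quad, h0] at h1
      simp at h1
  -- the analysis along a vertical line
  have vert : ∀ s : ℝ, (s = θ0 - δ ∨ s = θ0 + δ) → ∃ τ : ℝ, (τ = 1 ∨ τ = -1) ∧ (Plus G g0 g1 s ↔ τ = 1) ∧
      0 < τ * (k ⬝ᵥ (G s t0 *ᵥ l)) * (l ⬝ᵥ b (s, t0 - ε)) * (k ⬝ᵥ c (s, t0 + ε)) := by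
    intro s hs
    have hsI : s ∈ Icc (θ0 - δ) (θ0 + δ) := by
      rcases hs with rfl | rfl <;> constructor <;> linarith
    have hsne : s ≠ θ0 := by rcases hs with rfl | rfl <;> intro h <;> linarith
    have hreg : ∀ t ∈ Icc 0 π, G s t ≠ 0 := by
      intro t ht h0
      exact hsne (hne s ((hIcc s hsI).trans d2.le) t ht h0).1
    have hreg' : ∀ θ ∈ Icc s s, ∀ t ∈ Icc 0 π, G θ t ≠ 0 := by
      intro θ hθ
      have : θ = s := le_antisymm hθ.2 hθ.1
      rw [this]; exact hreg
    obtain ⟨w', hw', hwl', hw0'⟩ := rect_lift_norm hG hr s s 0 π 0 le_rfl (left_mem_Icc.2 pi_pos.le) hreg' g0 hG0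
    have hss : s ∈ Icc s s := ⟨le_rfl, le_rfl⟩
    obtain ⟨w, hwdef⟩ : ∃ w : ℝ → V4, w = fun t => w' (s, t) := ⟨_, rfl⟩
    have hw : ContinuousOn w (Icc 0 π) := by
      rw [hwdef]
      apply hw'.comp (by fun_prop)
      intro t ht; exact ⟨hss, ht⟩
    have hwl : ∀ t ∈ Icc 0 π, vecMulVec (w t) (w t) = G s t := by
      intro t ht; rw [hwdef]; exact hwl' (s, t) ⟨hss, ht⟩
    have hw0 : w 0 = g0 := by rw [hwdef]; exact hw0' s hss
    have hwne : ∀ t ∈ Icc 0 π, w t ≠ 0 := by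
      intro t ht h0
      exact hreg t ht (by rw [← hwl t ht, h0]; simp)
    -- agreement with b
    have hwb : w (t0 - ε) = b (s, t0 - ε) := by
      refine lift_unique (K := Icc 0 (t0 - ε)) isPreconnected_Icc (v := w) (w := fun t => b (s, t))
        (hw.mono (Icc_subset_Icc_right (by linarith))) ?_ ?_ ?_ (x := 0)
        (left_mem_Icc.2 (by linarith)) ?_ _ (right_mem_Icc.2 (by linarith))
      · apply hb.comp (by fun_prop)
        intro t ht; exact ⟨hsI, ht⟩
      · intro t ht; exact hwne t ⟨ht.1, by linarith [ht.2]⟩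
      · intro t ht
        exact vmv_eq ((hwl t ⟨ht.1, by linarith [ht.2]⟩).trans (hbl (s, t) ⟨hsI, ht⟩).symm)
      · rw [hw0]; exact (hb0 s hsI).symm
    -- agreement with c up to sign τ
    have hp : π ∈ Icc 0 π := right_mem_Icc.2 pi_pos.le
    have hwpm : w π = g1 ∨ w π = -g1 := vmv_eq ((hwl π hp).trans (hG1 s))
    obtain ⟨τ, hτ, hwτ⟩ : ∃ τ : ℝ, (τ = 1 ∨ τ = -1) ∧ w π = τ • g1 := by
      rcases hwpm with h | h
      · exact ⟨1, Or.inl rfl, by simpa using h⟩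
      · exact ⟨-1, Or.inr rfl, by simpa using h⟩
    have hwc : w (t0 + ε) = τ • c (s, t0 + ε) := by
      refine lift_unique (K := Icc (t0 + ε) π) isPreconnected_Icc (v := w) (w := fun t => τ • c (s, t))
        (hw.mono (Icc_subset_Icc_left (by linarith))) ?_ ?_ ?_ (x := π)
        (right_mem_Icc.2 (by linarith)) ?_ _ (left_mem_Icc.2 (by linarith))
      · refine ContinuousOn.smul (f := fun _ => τ) (g := fun t => c (s, t)) continuousOn_const ?_
        apply hc.comp (by fun_prop)
        intro t ht; exact ⟨hsI, ht⟩
      · intro t ht; exact hwne t ⟨by linarith [ht.1], ht.2⟩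
      · intro t ht
        apply vmv_eq
        rw [smul_vecMulVec, vecMulVec_smul, smul_smul]
        have : τ * τ = 1 := by rcases hτ with rfl | rfl <;> norm_num
        rw [this, one_smul]
        exact ((hwl t ⟨by linarith [ht.1], ht.2⟩).trans (hcl (s, t) ⟨hsI, ht⟩).symm)
      · rw [hwτ]
        simp only [hc1 s hsI]
    refine ⟨τ, hτ, ?_, ?_⟩
    · rw [plus_iff hg1 hreg hw hwl hw0, hwτ]
      rcases hτ with rfl | rfl
      · simp
      · constructor
        · intro h
          exfalso; apply hg1
          have : (2 : ℝ) • g1 = 0 := by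
            rw [two_smul]; nth_rewrite 1 [← h]; simp
          simpa using this
        · intro h; norm_num at h
    · -- signs on the middle segment
      have hmid : ∀ t ∈ Icc (t0 - ε) (t0 + ε), k ⬝ᵥ w t ≠ 0 ∧ l ⬝ᵥ w t ≠ 0 := by
        intro t ht
        have h1 : |t - t0| ≤ ε := by rw [abs_le]; constructor <;> linarith [ht.1, ht.2]
        have h2 := hv t h1
        have h3 : k ⬝ᵥ (G s t *ᵥ l) ≠ 0 := by
          rcases hs with rfl | rfl
          · intro h; rw [h] at h2; simp at h2
          · intro h; rw [h] at h2; simp at h2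
        rw [← hwl t ⟨by linarith [ht.1], by linarith [ht.2]⟩, vmv_quad] at h3
        exact ⟨left_ne_zero_of_mul h3, right_ne_zero_of_mul h3⟩
      have hwm : ContinuousOn w (Icc (t0 - ε) (t0 + ε)) :=
        hw.mono (Icc_subset_Icc (by linarith) (by linarith))
      have hk := const_sign isPreconnected_Icc (f := fun t => k ⬝ᵥ w t) (cont_dot continuousOn_const hwm)
        (fun t ht => (hmid t ht).1) (x := t0) (y := t0 + ε) ⟨by linarith, by linarith⟩ ⟨by linarith, by linarith⟩
      have hl' := const_sign isPreconnected_Icc (f := fun t => l ⬝ᵥ w t) (cont_dot continuousOn_const hwm)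
        (fun t ht => (hmid t ht).2) (x := t0) (y := t0 - ε) ⟨by linarith, by linarith⟩ ⟨by linarith, by linarith⟩
      rw [hwb] at hl'
      rw [hwc, dotProduct_smul, smul_eq_mul] at hk
      rw [← hwl t0 ⟨by linarith, by linarith⟩, vmv_quad]
      have := mul_pos hk hl'
      calc 0 < _ := this
        _ = _ := by ring
  obtain ⟨τ1, hτ1, hP1, hs1⟩ := vert _ (Or.inl rfl)
  obtain ⟨τ2, hτ2, hP2, hs2⟩ := vert _ (Or.inr rfl)
  rw [hP1, hP2]
  have hsg := hv t0 (by simpa using hε.le)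
  have hneg : (k ⬝ᵥ (G (θ0 + δ) t0 *ᵥ l)) * (k ⬝ᵥ (G (θ0 - δ) t0 *ᵥ l)) < 0 := by
    have h1 := mul_neg_of_pos_of_neg hsg.1 hsg.2
    have h2 : 0 ≤ σ * σ := mul_self_nonneg σ
    by_contra h3
    push Not at h3
    have := mul_nonneg h2 h3
    nlinarith
  have hττ : τ1 * τ2 < 0 := by
    have h1 := mul_pos hs1 hs2
    have h2 := mul_pos hbs hcs
    have h3 := mul_neg_of_pos_of_neg h2 hneg
    have h4 : 0 < (τ1 * τ2) * ((l ⬝ᵥ b (θ0 - δ, t0 - ε)) * (l ⬝ᵥ b (θ0 + δ, t0 - ε)) * ((k ⬝ᵥ c (θ0 - δ, t0 + ε)) * (k ⬝ᵥ c (θ0 + δ, t0 + ε))) * ((k ⬝ᵥ (G (θ0 + δ) t0 *ᵥ l)) * (k ⬝ᵥ (G (θ0 - δ) t0 *ᵥ l)))) := by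
      calc 0 < _ := h1
        _ = _ := by ring
    exact neg_of_mul_pos_left h4 h3.le
  rcases hτ1 with rfl | rfl <;> rcases hτ2 with rfl | rfl <;>
    first | (exfalso; norm_num at hττ; done) | norm_num

/-- Topological parity theorem. -/
lemma top_parity {G : ℝ → ℝ → M4} (hG : Continuous (fun p : ℝ × ℝ => G p.1 p.2))
    (hr : ∀ θ t, ∃ w : V4, G θ t = vecMulVec w w) {g0 g1 : V4} (hg1 : g1 ≠ 0)
    (hG0 : ∀ θ, G θ 0 = vecMulVec g0 g0) (hG1 : ∀ θ, G θ π = vecMulVec g1 g1)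
    (hper : ∀ t, G (-π) t = G π t) (F : Finset ℝ) (hF : ∀ f ∈ F, -π < f ∧ f < π)
    (hz : ∀ θ ∈ Icc (-π) π, ∀ t ∈ Icc 0 π, G θ t = 0 → θ ∈ F)
    (hn : ∀ f ∈ F, ∃ t0, 0 < t0 ∧ t0 < π ∧ (∀ t ∈ Icc 0 π, G f t = 0 → t = t0) ∧ FlipAt G f t0) :
    Even F.card := by
  have hpp := pi_pos
  rw [← parity_flip (Plus G g0 g1) (-π) F π (by linarith) hF]
  · simp only [Plus, hper]
  · intro x y hx hxy hy hxF
    apply plus_const hG hr hg1 hG0 hG1 hxy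
    intro θ hθ t ht h0
    have := hz θ ⟨hx.trans hθ.1, hθ.2.trans hy⟩ t ht h0
    rcases hxF θ this with h | h
    · linarith [hθ.1]
    · linarith [hθ.2]
  · intro f hf
    obtain ⟨t0, h1, h2, h3, h4⟩ := hn f hf
    obtain ⟨ρ, hρ, hρ'⟩ : ∃ ρ > 0, ∀ g ∈ F, |g - f| ≤ ρ → g = f := by
      have hfin : IsClosed ((F.erase f : Finset ℝ) : Set ℝ) := (F.erase f).finite_toSet.isClosed
      have : f ∈ ((F.erase f : Finset ℝ) : Set ℝ)ᶜ := by simp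
      obtain ⟨r, hr0, hr1⟩ := Metric.isOpen_iff.1 hfin.isOpen_compl f this
      refine ⟨r / 2, by positivity, fun g hg hgf => ?_⟩
      by_contra hne
      have := hr1 (show g ∈ Metric.ball f r by rw [Metric.mem_ball, dist_eq]; linarith)
      simp [hg, hne] at this
    have hfp := hF f hf
    refine plus_flip hG hr hg1 hG0 hG1 (ρ := min ρ (min (f + π) (π - f))) h1 h2
      (lt_min hρ (lt_min (by linarith) (by linarith))) ?_ h4
    intro θ hθ t ht h0
    have a1 : |θ - f| ≤ ρ := hθ.trans (min_le_left _ _)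
    have a2 : |θ - f| ≤ f + π := hθ.trans ((min_le_right _ _).trans (min_le_left _ _))
    have a3 : |θ - f| ≤ π - f := hθ.trans ((min_le_right _ _).trans (min_le_right _ _))
    have := hz θ ⟨by linarith [(abs_le.1 a2).1], by linarith [(abs_le.1 a3).2]⟩ t ht h0
    have hθf := hρ' θ this a1
    subst hθf
    exact ⟨rfl, h3 t ht h0⟩

end setreal

abbrev C4 := Fin 4 → ℂ

lemma hess_prod {u v : C4 →L[ℂ] ℂ} {n : C4 → ℂ} (hn : ContDiff ℂ 2 n) {x : C4}
    (hu : u x = 0) (hv : v x = 0) :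
    (fderiv ℂ (fun y => u y * v y * n y) x = 0) ∧
    ∀ g, HasFDerivAt (fun y => fderiv ℂ (fun y => u y * v y * n y) y g)
      ((u g * n x) • v + (v g * n x) • u) x := by
  have hd : Differentiable ℂ n := hn.differentiable (by norm_num)
  have key : ∀ y, HasFDerivAt (fun y => u y * v y * n y)
      ((u y * v y) • fderiv ℂ n y + n y • (u y • v + v y • u)) y := by
    intro y
    exact (u.hasFDerivAt.mul v.hasFDerivAt).mul (hd y).hasFDerivAt
  constructor
  · rw [(key x).fderiv]; ext z; simp [hu, hv]
  · intro g
    have h1 : (fun y => fderiv ℂ (fun y => u y * v y * n y) y g) =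
        fun y => u y * v y * fderiv ℂ n y g + n y * (u y * v g + v y * u g) := by
      funext y; rw [(key y).fderiv]; simp; ring
    rw [h1]
    have hdn : Differentiable ℂ (fun y => fderiv ℂ n y g) :=
      ((hn.fderiv_right (m := 1) (by norm_num)).clm_apply contDiff_const).differentiable (by norm_num)
    have h2 := ((u.hasFDerivAt (x := x)).mul v.hasFDerivAt).mul (hdn x).hasFDerivAt
    have h3 := (hd x).hasFDerivAt.mul (((u.hasFDerivAt (x := x)).mul_const (v g)).add ((v.hasFDerivAt (x := x)).mul_const (u g)))
    refine (h2.add h3).congr_fderiv ?_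
    ext z
    simp [hu, hv]; ring

lemma hess_sum {ι : Type*} [Fintype ι] {f : C4 → ℂ} {u v : ι → C4 →L[ℂ] ℂ} {n : ι → C4 → ℂ}
    (hn : ∀ p, ContDiff ℂ 2 (n p)) {x : C4}
    (hu : ∀ p, u p x = 0) (hv : ∀ p, v p x = 0) (hf : ∀ y, f y = ∑ p, u p y * v p y * n p y) :
    fderiv ℂ f x = 0 ∧ ∀ g h, fderiv ℂ (fun y => fderiv ℂ f y g) x h =
      ∑ p, (u p g * v p h + u p h * v p g) * n p x := by
  have hf' : f = fun y => ∑ p, u p y * v p y * n p y := funext hf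
  have hd : ∀ p y, DifferentiableAt ℂ (fun y => u p y * v p y * n p y) y := by
    intro p y
    have : Differentiable ℂ (n p) := (hn p).differentiable (by norm_num)
    fun_prop
  have e1 : ∀ y, fderiv ℂ f y = ∑ p, fderiv ℂ (fun y => u p y * v p y * n p y) y := by
    intro y; rw [hf', fderiv_fun_sum (fun p _ => hd p y)]
  constructor
  · rw [e1]; exact Finset.sum_eq_zero fun p _ => (hess_prod (hn p) (hu p) (hv p)).1
  · intro g h
    have e2 : (fun y => fderiv ℂ f y g) = fun y => ∑ p, fderiv ℂ (fun y => u p y * v p y * n p y) y g := by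
      funext y; rw [e1]; simp
    rw [e2, (HasFDerivAt.fun_sum fun p _ => (hess_prod (hn p) (hu p) (hv p)).2 g).fderiv]
    simp only [ContinuousLinearMap.sum_apply, ContinuousLinearMap.add_apply, ContinuousLinearMap.smul_apply, smul_eq_mul]
    exact Finset.sum_congr rfl fun p _ => by ring

/-- Complex determinant expansion data. -/
lemma det_expand (A : Matrix (Fin 4) (Fin 4) ℂ) : A.det = ∑ p : Fin 4 × Fin 3,
    A 0 p.1 * A 1 (p.1.succAbove p.2) * ((-1) ^ (p.1 : ℕ) * (-1) ^ (p.2 : ℕ) *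
      (A 2 (p.1.succAbove (p.2.succAbove 0)) * A 3 (p.1.succAbove (p.2.succAbove 1)) -
       A 2 (p.1.succAbove (p.2.succAbove 1)) * A 3 (p.1.succAbove (p.2.succAbove 0)))) := by
  rw [det_succ_row_zero, Fintype.sum_prod_type]
  refine Finset.sum_congr rfl fun j _ => ?_
  rw [det_succ_row_zero, Finset.mul_sum]
  refine Finset.sum_congr rfl fun k _ => ?_
  rw [det_fin_two]
  simp only [submatrix_apply]
  have a1 : Fin.succ (0 : Fin 3) = 1 := rfl
  have a2 : Fin.succ (Fin.succ (0 : Fin 2)) = 2 := rfl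
  have a3 : Fin.succ (Fin.succ (1 : Fin 2)) = 3 := rfl
  rw [a1, a2, a3]
  ring

def QL (Q : Fin 4 → M4) : C4 →ₗ[ℂ] Matrix (Fin 4) (Fin 4) ℂ where
  toFun := Qc Q
  map_add' x y := by simp [Qc, add_smul, Finset.sum_add_distrib]
  map_smul' c x := by simp [Qc, Finset.smul_sum, smul_smul]

def cm (T : M4) : Matrix (Fin 4) (Fin 4) ℂ := T.map (fun a => (a : ℂ))

def bb (Q : Fin 4 → M4) (T : M4) (i j : Fin 4) : C4 →L[ℂ] ℂ :=
  LinearMap.toContinuousLinearMap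
    { toFun := fun y => ((cm T)ᵀ * Qc Q y * cm T) i j
      map_add' := fun x y => by
        have : Qc Q (x + y) = Qc Q x + Qc Q y := (QL Q).map_add x y
        simp [this, mul_add, add_mul]
      map_smul' := fun c x => by
        have : Qc Q (c • x) = c • Qc Q x := (QL Q).map_smul c x
        simp [this] }

lemma bb_apply (Q : Fin 4 → M4) (T : M4) (i j : Fin 4) (y : C4) :
    bb Q T i j y = ((cm T)ᵀ * Qc Q y * cm T) i j := rfl

lemma cm_det (T : M4) : (cm T).det = (T.det : ℂ) := by
  have := RingHom.map_det Complex.ofRealHom T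
  exact this.symm

lemma Qc_toC (Q : Fin 4 → M4) (x : V4) : Qc Q (toC x) = cm (Qr Q x) := by
  ext i j
  simp [Qc, Qr, cm, toC, Matrix.sum_apply]

lemma bb_toC (Q : Fin 4 → M4) (T : M4) (i j : Fin 4) (x : V4) :
    bb Q T i j (toC x) = ((Tᵀ * Qr Q x * T) i j : ℝ) := by
  rw [bb_apply, Qc_toC]
  simp [Matrix.mul_apply, cm]

lemma detQ_eq (Q : Fin 4 → M4) {T : M4} (hT : T.det ≠ 0) (y : C4) :
    detQ Q y = ((T.det : ℂ) ^ 2)⁻¹ * ((cm T)ᵀ * Qc Q y * cm T).det := by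
  have : (T.det : ℂ) ≠ 0 := by exact_mod_cast hT
  rw [det_mul, det_mul, det_transpose, cm_det, detQ]
  field_simp

lemma node_hess (Q : Fin 4 → M4) (hs : ∀ i, (Q i).IsSymm) {T : M4} (hT : T.det ≠ 0) {x : V4}
    (h0 : ∀ j, (Tᵀ * Qr Q x * T) 0 j = 0) (h1 : ∀ j, (Tᵀ * Qr Q x * T) 1 j = 0) :
    gradVanishes Q (toC x) ∧ ∃ K : ℂ, K ≠ 0 ∧ ∀ i j, hessian Q (toC x) i j =
      K * (((Tᵀ * Qr Q x * T) 2 2 * (Tᵀ * Qr Q x * T) 3 3 - (Tᵀ * Qr Q x * T) 2 3 * (Tᵀ * Qr Q x * T) 3 2 : ℝ) : ℂ) *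
        (bb Q T 0 0 (Pi.single i 1) * bb Q T 1 1 (Pi.single j 1) + bb Q T 0 0 (Pi.single j 1) * bb Q T 1 1 (Pi.single i 1)
        - bb Q T 0 1 (Pi.single i 1) * bb Q T 1 0 (Pi.single j 1) - bb Q T 0 1 (Pi.single j 1) * bb Q T 1 0 (Pi.single i 1)) := by
  have hsymm : (Tᵀ * Qr Q x * T).IsSymm := by
    have : (Qr Q x).IsSymm := by
      simp only [Qr, Matrix.IsSymm, transpose_sum, transpose_smul]
      exact Finset.sum_congr rfl fun i _ => by rw [(hs i).eq]
    rw [Matrix.IsSymm, transpose_mul, transpose_mul, this.eq, transpose_transpose, Matrix.mul_assoc]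
  have c0 : ∀ j, (Tᵀ * Qr Q x * T) j 0 = 0 := fun j => by rw [hsymm.apply]; exact h0 j
  have c1 : ∀ j, (Tᵀ * Qr Q x * T) j 1 = 0 := fun j => by rw [hsymm.apply]; exact h1 j
  set K : ℂ := ((T.det : ℂ) ^ 2)⁻¹ with hK
  have hK0 : K ≠ 0 := by
    have : (T.det : ℂ) ≠ 0 := by exact_mod_cast hT
    rw [hK]; positivity
  have key := hess_sum (ι := Fin 4 × Fin 3) (f := detQ Q) (x := toC x)
    (u := fun p => bb Q T 0 p.1) (v := fun p => bb Q T 1 (p.1.succAbove p.2))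
    (n := fun p y => K * ((-1) ^ (p.1 : ℕ) * (-1) ^ (p.2 : ℕ) *
      (bb Q T 2 (p.1.succAbove (p.2.succAbove 0)) y * bb Q T 3 (p.1.succAbove (p.2.succAbove 1)) y -
       bb Q T 2 (p.1.succAbove (p.2.succAbove 1)) y * bb Q T 3 (p.1.succAbove (p.2.succAbove 0)) y)))
    (fun p => by fun_prop) (fun p => by rw [bb_toC, h0]; rfl) (fun p => by rw [bb_toC, h1]; rfl)
    (fun y => by
      rw [detQ_eq Q hT, det_expand, Finset.mul_sum]
      refine Finset.sum_congr rfl fun p _ => ?_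
      simp only [bb_apply]
      ring)
  refine ⟨fun i => by rw [key.1]; rfl, K, hK0, fun i j => ?_⟩
  rw [hessian, of_apply, key.2]
  simp only [bb_toC]
  rw [Fintype.sum_prod_type]
  simp [Fin.sum_univ_succ, Fin.succAbove, c0, c1, Fin.ext_iff]
  ring

lemma clm_sum (L : C4 →L[ℂ] ℂ) (h : C4) : ∑ j, L (Pi.single j 1) * h j = L h := by
  have h1 : h = ∑ j, h j • (Pi.single j (1 : ℂ) : C4) := by
    ext i; simp [Finset.sum_apply, Pi.single_apply]
  conv_rhs => rw [h1, map_sum]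
  exact Finset.sum_congr rfl fun j _ => by rw [map_smul, smul_eq_mul, mul_comm]

lemma Qr_symm {Q : Fin 4 → M4} (hs : ∀ i, (Q i).IsSymm) (x : V4) : (Qr Q x).IsSymm := by
  simp only [Qr, Matrix.IsSymm, transpose_sum, transpose_smul]
  exact Finset.sum_congr rfl fun i _ => by rw [(hs i).eq]

lemma conj_symm {A : M4} (hA : A.IsSymm) (T : M4) : (Tᵀ * A * T).IsSymm := by
  rw [Matrix.IsSymm, transpose_mul, transpose_mul, hA.eq, transpose_transpose, Matrix.mul_assoc]

lemma node_trans (Q : Fin 4 → M4) (hs : ∀ i, (Q i).IsSymm) {T : M4} (hT : T.det ≠ 0) {x : V4} (hx : x ≠ 0)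
    (h0 : ∀ j, (Tᵀ * Qr Q x * T) 0 j = 0) (h1 : ∀ j, (Tᵀ * Qr Q x * T) 1 j = 0)
    (hr : (hessian Q (toC x)).rank = 3) :
    (Tᵀ * Qr Q x * T) 2 2 * (Tᵀ * Qr Q x * T) 3 3 - (Tᵀ * Qr Q x * T) 2 3 * (Tᵀ * Qr Q x * T) 3 2 ≠ 0 ∧
    ∀ h : V4, (Tᵀ * Qr Q h * T) 0 0 = 0 → (Tᵀ * Qr Q h * T) 0 1 = 0 → (Tᵀ * Qr Q h * T) 1 1 = 0 →
      ∃ c : ℝ, h = c • x := by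
  obtain ⟨-, K, hK, hH⟩ := node_hess Q hs hT h0 h1
  constructor
  · intro hc
    rw [hc] at hH
    have : hessian Q (toC x) = 0 := by ext i j; rw [hH]; simp
    rw [this, rank_zero] at hr
    omega
  · have hker : ∀ h : V4, (Tᵀ * Qr Q h * T) 0 0 = 0 → (Tᵀ * Qr Q h * T) 0 1 = 0 → (Tᵀ * Qr Q h * T) 1 1 = 0 →
        (hessian Q (toC x)).mulVecLin (toC h) = 0 := by
      intro h a b c
      have b' : (Tᵀ * Qr Q h * T) 1 0 = 0 := by rw [← (conj_symm (Qr_symm hs h) T).apply]; exact b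
      rw [mulVecLin_apply]
      ext i
      simp only [mulVec, dotProduct, hH, Pi.zero_apply]
      have e : ∀ L : C4 →L[ℂ] ℂ, L (toC h) = 0 → ∑ j, L (Pi.single j 1) * toC h j = 0 := by
        intro L hL; rw [clm_sum, hL]
      have e00 := e (bb Q T 0 0) (by rw [bb_toC, a]; rfl)
      have e01 := e (bb Q T 0 1) (by rw [bb_toC, b]; rfl)
      have e10 := e (bb Q T 1 0) (by rw [bb_toC, b']; rfl)
      have e11 := e (bb Q T 1 1) (by rw [bb_toC, c]; rfl)
      simp only [Fin.sum_univ_four] at *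
      linear_combination (exp := 1) (K * (((Tᵀ * Qr Q x * T) 2 2 * (Tᵀ * Qr Q x * T) 3 3 - (Tᵀ * Qr Q x * T) 2 3 * (Tᵀ * Qr Q x * T) 3 2 : ℝ) : ℂ)) *
        (bb Q T 0 0 (Pi.single i 1) * e11 + bb Q T 1 1 (Pi.single i 1) * e00 - bb Q T 0 1 (Pi.single i 1) * e10 - bb Q T 1 0 (Pi.single i 1) * e01)
    intro h a b c
    have hx' := hker x (h0 0) (h0 1) (h1 1)
    have hh' := hker h a b c
    have hdim := LinearMap.finrank_range_add_finrank_ker (hessian Q (toC x)).mulVecLin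
    rw [← Matrix.rank, hr] at hdim
    have h4 : Module.finrank ℂ (Fin 4 → ℂ) = 4 := by simp
    have h5 : Module.finrank ℂ (LinearMap.ker (hessian Q (toC x)).mulVecLin) = 1 := by omega
    obtain ⟨i, hi⟩ : ∃ i, x i ≠ 0 := by by_contra hcon; push Not at hcon; exact hx (funext hcon)
    have hne : (⟨toC x, hx'⟩ : LinearMap.ker (hessian Q (toC x)).mulVecLin) ≠ 0 := by
      intro h0
      have := congrFun (congrArg Subtype.val h0) i
      exact hi (by simpa [toC] using this)
    obtain ⟨cc, hcc⟩ := (finrank_eq_one_iff_of_nonzero' _ hne).1 h5 ⟨toC h, hh'⟩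
    have hcc' : ∀ j, cc * (x j : ℂ) = (h j : ℂ) := fun j => congrFun (congrArg Subtype.val hcc) j
    refine ⟨cc.re, ?_⟩
    ext j
    have := congrArg Complex.re (hcc' j)
    simpa using this.symm

lemma ortho_ext {k l : V4} (hk : k ⬝ᵥ k = 1) (hl : l ⬝ᵥ l = 1) (hkl : k ⬝ᵥ l = 0) :
    ∃ U : M4, Uᵀ * U = 1 ∧ U *ᵥ Pi.single 0 1 = k ∧ U *ᵥ Pi.single 1 1 = l := by
  let v : Fin 4 → EuclideanSpace ℝ (Fin 4) := ![WithLp.toLp 2 k, WithLp.toLp 2 l, 0, 0]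
  have hv : Orthonormal ℝ (Set.domRestrict ({0, 1} : Set (Fin 4)) v) := by
    rw [orthonormal_iff_ite]
    rintro ⟨i, hi⟩ ⟨j, hj⟩
    have hlk : l ⬝ᵥ k = 0 := by rw [dotProduct_comm]; exact hkl
    simp only [Set.mem_insert_iff, Set.mem_singleton_iff] at hi hj
    rcases hi with rfl | rfl <;> rcases hj with rfl | rfl <;>
      simp [v, Set.domRestrict, EuclideanSpace.inner_eq_star_dotProduct, hk, hl, hkl, hlk, -inner_self_eq_norm_sq_to_K, -real_inner_self_eq_norm_sq]
  obtain ⟨b, hb⟩ := hv.exists_orthonormalBasis_extension_of_card_eq (by simp)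
  have hU : (Matrix.of fun i j => (b j) i : M4)ᵀ * (Matrix.of fun i j => (b j) i : M4) = 1 := by
    ext i j
    have := orthonormal_iff_ite.1 b.orthonormal i j
    rw [EuclideanSpace.inner_eq_star_dotProduct] at this
    simp [Matrix.mul_apply, dotProduct, Matrix.one_apply] at this ⊢
    rw [← this]
    exact Finset.sum_congr rfl fun _ _ => mul_comm _ _
  refine ⟨_, hU, ?_, ?_⟩
  · have h0 := hb 0 (by simp)
    ext i; simp [h0, v]
  · have h0 := hb 1 (by simp)
    ext i; simp [h0, v]

lemma orth_det {U : M4} (h : Uᵀ * U = 1) : U.det ≠ 0 := by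
  intro h0
  have := congrArg det h
  rw [det_mul, h0, mul_zero, det_one] at this
  exact one_ne_zero this.symm

lemma conj_entry (A U : M4) (i j : Fin 4) :
    (Uᵀ * A * U) i j = (U *ᵥ Pi.single i 1) ⬝ᵥ (A *ᵥ (U *ᵥ Pi.single j 1)) := by
  simp only [mulVec_single_one]
  rw [Matrix.mul_assoc]
  simp [Matrix.mul_apply, dotProduct, mulVec]

/-- Ker2 gives the matrix with zero rows. -/
lemma ker2_rows {A : M4} (hA : A.IsSymm) (h : Ker2 A) : ∃ U : M4, Uᵀ * U = 1 ∧
    (∀ j, (Uᵀ * A * U) 0 j = 0) ∧ (∀ j, (Uᵀ * A * U) 1 j = 0) := by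
  obtain ⟨k, l, hk, hl, hkl, h1, h2⟩ := h
  obtain ⟨U, hU, rfl, rfl⟩ := ortho_ext hk hl hkl
  refine ⟨U, hU, fun j => ?_, fun j => ?_⟩
  · rw [conj_entry, symm_swap hA, h1, dotProduct_zero]
  · rw [conj_entry, symm_swap hA, h2, dotProduct_zero]

lemma detQ_diff (Q : Fin 4 → M4) : Differentiable ℂ (detQ Q) := by
  have : detQ Q = fun y => ∑ σ : Equiv.Perm (Fin 4), Equiv.Perm.sign σ • ∏ i, bb Q 1 (σ i) i y := by
    funext y
    have h := detQ_eq Q (T := 1) (by simp) y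
    rw [det_one, Complex.ofReal_one, one_pow, inv_one, one_mul, det_apply] at h
    exact h
  rw [this]
  apply Differentiable.fun_sum
  intro σ _
  apply Differentiable.const_smul
  simp only [Fin.prod_univ_four]
  fun_prop

/-- a vanishing gradient at a real point gives two kernel vectors -/
lemma ker2_of_grad (Q : Fin 4 → M4) (hs : ∀ i, (Q i).IsSymm) {S : M4} (hS : S.det ≠ 0) {x e : V4}
    (he : Sᵀ * Qr Q e * S = 1) (hg : gradVanishes Q (toC x)) : Ker2 (Sᵀ * Qr Q x * S) := by
  have hf : fderiv ℂ (detQ Q) (toC x) = 0 := by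
    ext z; rw [← clm_sum]; simp [show ∀ i, fderiv ℂ (detQ Q) (toC x) (Pi.single i 1) = 0 from hg]
  have hline : ∀ h : V4, HasDerivAt (fun s : ℝ => (Qr Q (x + s • h)).det) 0 0 := by
    intro h
    have h1 : HasFDerivAt (detQ Q) (0 : C4 →L[ℂ] ℂ) (toC x + (0 : ℂ) • toC h) := by
      rw [zero_smul, add_zero, ← hf]; exact (detQ_diff Q _).hasFDerivAt
    have h2 : HasDerivAt (fun s : ℂ => toC x + s • toC h) ((1 : ℂ) • toC h) 0 :=
      ((hasDerivAt_id (0 : ℂ)).smul_const (toC h)).const_add _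
    have h3 := h1.comp_hasDerivAt (0 : ℂ) h2
    have h4 := HasDerivAt.real_of_complex (z := 0) (e := (detQ Q ∘ fun s : ℂ => toC x + s • toC h)) (by simpa using h3)
    simp only [Complex.zero_re] at h4
    refine h4.congr_of_eventuallyEq (Filter.Eventually.of_forall fun s => ?_)
    have : toC x + (s : ℂ) • toC h = toC (x + s • h) := by ext i; simp [toC]
    simp only [Function.comp, this, detQ, Qc_toC, cm_det, Complex.ofReal_re]
  have hadd : ∀ (h : V4) (s : ℝ), Qr Q (x + s • h) = Qr Q x + s • Qr Q h := by
    intro h s; simp [Qr, add_smul, Finset.sum_add_distrib, Finset.smul_sum, smul_smul]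
  obtain ⟨U, μ, hU1, hU2, hU3⟩ := spec _ (conj_symm (Qr_symm hs x) S)
  have hd : ∀ s : ℝ, S.det ^ 2 * (Qr Q (x + s • e)).det = ∏ i, (μ i + s) := by
    intro s
    have h1 : Sᵀ * Qr Q (x + s • e) * S = U * diagonal (fun i => μ i + s) * Uᵀ := by
      rw [hadd, mul_add, add_mul, mul_smul_comm, smul_mul_assoc, he, hU3, ← hU2]
      have : diagonal (fun i => μ i + s) = diagonal μ + s • (1 : M4) := by
        rw [← diagonal_one, ← diagonal_smul, diagonal_add]
        congr 1; ext i; simp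
      rw [this, mul_add, add_mul, mul_smul_comm, mul_one, smul_mul_assoc]
    have h2 := congrArg det h1
    have h3 : U.det * U.det = 1 := by
      have := congrArg det hU1
      rwa [det_mul, det_transpose, det_one] at this
    rw [det_mul, det_mul, det_mul, det_mul, det_transpose, det_transpose, det_diagonal] at h2
    linear_combination h2 + (∏ i, (μ i + s)) * h3
  -- product of the eigenvalues is zero
  have hx0 : (Qr Q x).det = 0 := by
    have h1 := hline x
    have h2 : HasDerivAt (fun s : ℝ => (Qr Q (x + s • x)).det) (4 * (Qr Q x).det) 0 := by
      have : (fun s : ℝ => (Qr Q (x + s • x)).det) = fun s => (1 + s) ^ 4 * (Qr Q x).det := by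
        funext s
        rw [hadd]
        have : Qr Q x + s • Qr Q x = (1 + s) • Qr Q x := by rw [add_smul, one_smul]
        rw [this, det_smul]; simp
      rw [this]
      have h := (((hasDerivAt_id (0 : ℝ)).const_add 1).pow 4).mul_const (Qr Q x).det
      simpa using h
    have := h1.unique h2
    linarith
  have hp : ∏ i, μ i = 0 := by
    have := hd 0
    simp [hx0] at this
    exact this.symm
  obtain ⟨i, -, hi⟩ := Finset.prod_eq_zero_iff.1 hp
  have hder : HasDerivAt (fun s : ℝ => ∏ i, (μ i + s)) (∑ i, ∏ j ∈ Finset.univ.erase i, μ j) 0 := by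
    have := HasDerivAt.fun_finsetProd (u := (Finset.univ : Finset (Fin 4))) (f := fun i s => μ i + s) (f' := fun _ => (1 : ℝ)) (x := (0 : ℝ))
      (fun i _ => (hasDerivAt_id (0 : ℝ)).const_add _)
    simpa using this
  have hder2 : HasDerivAt (fun s : ℝ => ∏ i, (μ i + s)) 0 0 := by
    have := (hline e).const_mul (S.det ^ 2)
    simpa [hd] using this
  have hsum := hder.unique hder2
  rw [Finset.sum_eq_single i] at hsum
  · obtain ⟨j, hj, hj0⟩ := Finset.prod_eq_zero_iff.1 hsum
    rw [hU3]
    exact ker2_of_diag hU1 (Finset.ne_of_mem_erase hj).symm hi hj0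
  · intro j _ hj
    exact Finset.prod_eq_zero (Finset.mem_erase.2 ⟨hj.symm, Finset.mem_univ i⟩) hi
  · intro h; exact absurd (Finset.mem_univ i) h

def cjL : C4 →ₛₗ[starRingEnd ℂ] C4 where
  toFun x := fun i => starRingEnd ℂ (x i)
  map_add' x y := by ext i; simp
  map_smul' c x := by ext i; simp

lemma cjL_inj : Function.Injective cjL := by
  intro x y h
  ext i
  have := congrFun h i
  exact (starRingEnd ℂ).injective this

def cj : ℙ ℂ C4 → ℙ ℂ C4 := Projectivization.map cjL cjL_inj

def toCL : V4 →ₛₗ[Complex.ofRealHom] C4 where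
  toFun := toC
  map_add' x y := by ext i; simp [toC]
  map_smul' c x := by ext i; simp [toC]

lemma toCL_inj : Function.Injective toCL := by
  intro x y h
  ext i
  have := congrFun h i
  exact Complex.ofReal_injective this

def emb : ℙ ℝ V4 → ℙ ℂ C4 := Projectivization.map toCL toCL_inj

lemma emb_inj : Function.Injective emb := by
  intro p q
  induction p with | h x hx => ?_
  induction q with | h y hy => ?_
  intro h
  simp only [emb, Projectivization.map_mk] at h
  rw [Projectivization.mk_eq_mk_iff'] at h ⊢
  obtain ⟨a, ha⟩ := h
  refine ⟨a.re, ?_⟩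
  ext i
  have := congrArg Complex.re (congrFun ha i)
  simpa [toCL, toC] using this

lemma detQ_conj (Q : Fin 4 → M4) (x : C4) : detQ Q (cjL x) = starRingEnd ℂ (detQ Q x) := by
  rw [detQ, detQ, RingHom.map_det]
  congr 1
  ext i j
  simp [Qc, Matrix.sum_apply, cjL]

lemma grad_conj {Q : Fin 4 → M4} {x : C4} (h : gradVanishes Q x) : gradVanishes Q (cjL x) := by
  intro i
  have h1 := (detQ_diff Q x).hasFDerivAt.hasLineDerivAt (Pi.single i 1)
  rw [h i] at h1
  have h2 := (detQ_diff Q (cjL x)).hasFDerivAt.hasLineDerivAt (Pi.single i 1)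
  unfold HasLineDerivAt at h1 h2
  have h3 := h1.conj_conj
  have h4 : (⇑(starRingEnd ℂ) ∘ (fun t : ℂ => detQ Q (x + t • Pi.single i 1)) ∘ ⇑(starRingEnd ℂ))
      = fun t : ℂ => detQ Q (cjL x + t • Pi.single i 1) := by
    funext t
    simp only [Function.comp]
    rw [← detQ_conj]
    congr 1
    rw [map_add, map_smulₛₗ]
    congr 2
    · simp
    · ext j; simp [cjL, Pi.single_apply]
  rw [h4] at h3
  simp only [map_zero] at h3
  exact h2.unique h3

lemma cj_sing {Q : Fin 4 → M4} {p : ℙ ℂ C4} (hp : p ∈ singPoints Q) : cj p ∈ singPoints Q := by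
  obtain ⟨x, hx, rfl, h⟩ := hp
  exact ⟨cjL x, fun h0 => hx (cjL_inj (by simpa using h0)), by simp [cj, Projectivization.map_mk], grad_conj h⟩

lemma cj_cj (p : ℙ ℂ C4) : cj (cj p) = p := by
  induction p with | h x hx => ?_
  simp only [cj, Projectivization.map_mk]
  congr 1
  ext i; simp [cjL]

lemma grad_smul {Q : Fin 4 → M4} {x : C4} {c : ℂ} (hc : c ≠ 0) (h : gradVanishes Q x) : gradVanishes Q (c • x) := by
  intro i
  have h1 := (detQ_diff Q x).hasFDerivAt.hasLineDerivAt (c⁻¹ • Pi.single i 1)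
  rw [map_smul, h i, smul_zero] at h1
  have h2 := (detQ_diff Q (c • x)).hasFDerivAt.hasLineDerivAt (Pi.single i 1)
  unfold HasLineDerivAt at h1 h2
  have h3 := h1.const_mul (c ^ 4)
  refine h2.unique ?_
  rw [mul_zero] at h3
  refine h3.congr_of_eventuallyEq (Filter.Eventually.of_forall fun t => ?_)
  have : ∀ y, detQ Q (c • y) = c ^ 4 * detQ Q y := by
    intro y
    have h5 : Qc Q (c • y) = c • Qc Q y := (QL Q).map_smul c y
    rw [detQ, h5, det_smul]; rfl
  simp only
  rw [← this, smul_add]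
  congr 2
  rw [smul_comm, smul_smul, smul_smul, mul_assoc, mul_inv_cancel₀ hc, mul_one]

lemma emb_image {Q : Fin 4 → M4} (htr : Transversal Q) :
    emb '' realNodes Q = {p ∈ singPoints Q | cj p = p} := by
  ext p
  constructor
  · rintro ⟨_, ⟨x, hx, rfl, hn⟩, rfl⟩
    refine ⟨⟨toC x, fun h0 => hx (toCL_inj (h0.trans (map_zero toCL).symm)), by simp [emb, Projectivization.map_mk]; rfl, hn.1⟩, ?_⟩
    simp only [emb, cj, Projectivization.map_mk]
    congr 1
    ext i; simp [cjL, toCL, toC]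
  · rintro ⟨⟨x, hx, rfl, hg⟩, hf⟩
    simp only [cj, Projectivization.map_mk] at hf
    rw [Projectivization.mk_eq_mk_iff'] at hf
    obtain ⟨a, ha⟩ := hf
    -- find c with c x real
    obtain ⟨c, y, hc, hy⟩ : ∃ c : ℂ, ∃ y : V4, c ≠ 0 ∧ c • x = toC y := by
      have hax : ∀ i, a * x i = starRingEnd ℂ (x i) := fun i => congrFun ha i
      by_cases h1 : 1 + a = 0
      · refine ⟨Complex.I, fun i => - (x i).im, Complex.I_ne_zero, ?_⟩
        have ha' : a = -1 := by linear_combination h1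
        ext i
        have := hax i
        rw [ha'] at this
        have h2 := congrArg Complex.re this
        simp at h2
        apply Complex.ext <;> simp [toC]
        linarith
      · refine ⟨1 + a, fun i => 2 * (x i).re, h1, ?_⟩
        ext i
        have := hax i
        simp only [Pi.smul_apply, smul_eq_mul, add_mul, one_mul, this, toC]
        apply Complex.ext <;> simp
        ring
    have hy0 : y ≠ 0 := by
      rintro rfl
      have : toC 0 = 0 := by ext i; simp [toC]
      rw [this, smul_eq_zero] at hy
      exact hy.elim hc hx
    have hg' : gradVanishes Q (toC y) := hy ▸ grad_smul hc hg
    refine ⟨Projectivization.mk ℝ y hy0, ⟨y, hy0, rfl, hg', ?_⟩, ?_⟩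
    · exact htr.2.2 _ (fun h0 => hy0 (toCL_inj (h0.trans (map_zero toCL).symm))) hg'
    · simp only [emb, Projectivization.map_mk]
      rw [Projectivization.mk_eq_mk_iff']
      exact ⟨c, hy⟩

lemma realNodes_finite {Q : Fin 4 → M4} (htr : Transversal Q) : (realNodes Q).Finite := by
  apply Set.Finite.of_finite_image _ emb_inj.injOn
  rw [emb_image htr]
  exact htr.1.subset fun p hp => hp.1

lemma realNodes_even {Q : Fin 4 → M4} (htr : Transversal Q) : Even (realNodes Q).ncard := by
  classical
  rw [← Set.ncard_image_of_injective _ emb_inj, emb_image htr]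
  haveI := htr.1.fintype
  let g : Function.End (singPoints Q) := fun p => ⟨cj p.1, cj_sing p.2⟩
  have hg : g ^ 2 ^ 1 = 1 := by
    funext p
    rw [pow_one, pow_two]
    exact Subtype.ext (cj_cj p.1)
  have h := Equiv.Perm.card_fixedPoints_modEq (p := 2) (n := 1) hg
  have h1 : Fintype.card (singPoints Q) = 10 := by
    rw [← htr.2.1, ← Nat.card_eq_fintype_card]; rfl
  have h2 : Fintype.card (Function.fixedPoints g) = {p ∈ singPoints Q | cj p = p}.ncard := by
    rw [← Nat.card_eq_fintype_card]
    have : (Subtype.val '' (Function.fixedPoints g)) = {p ∈ singPoints Q | cj p = p} := by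
      ext p
      constructor
      · rintro ⟨q, hq, rfl⟩
        exact ⟨q.2, congrArg Subtype.val hq⟩
      · rintro ⟨hp, hq⟩
        exact ⟨⟨p, hp⟩, Subtype.ext hq, rfl⟩
    rw [← this, Set.ncard_image_of_injective _ Subtype.val_injective]
    rfl
  rw [h1, h2] at h
  rw [Nat.even_iff]
  exact h.symm

structure Net (M : V4 →ₗ[ℝ] M4) (e : V4) : Prop where
  one : M e = 1
  symm : ∀ x, (M x).IsSymm
  trans : ∀ x, x ≠ 0 → ∀ U : M4, Uᵀ * U = 1 → (∀ j, (Uᵀ * M x * U) 0 j = 0) →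
    (∀ j, (Uᵀ * M x * U) 1 j = 0) →
    (Uᵀ * M x * U) 2 2 * (Uᵀ * M x * U) 3 3 - (Uᵀ * M x * U) 2 3 * (Uᵀ * M x * U) 3 2 ≠ 0 ∧
    ∀ h : V4, (Uᵀ * M h * U) 0 0 = 0 → (Uᵀ * M h * U) 0 1 = 0 → (Uᵀ * M h * U) 1 1 = 0 →
      ∃ c : ℝ, h = c • x

def MM (Q : Fin 4 → M4) (S : M4) : V4 →ₗ[ℝ] M4 where
  toFun x := Sᵀ * Qr Q x * S
  map_add' x y := by
    have : Qr Q (x + y) = Qr Q x + Qr Q y := by simp [Qr, add_smul, Finset.sum_add_distrib]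
    rw [this, mul_add, add_mul]
  map_smul' c x := by
    have : Qr Q (c • x) = c • Qr Q x := by simp [Qr, Finset.smul_sum, smul_smul]
    rw [this]; simp

lemma exists_norm {E : M4} (hs : E.IsSymm) (hE : ∀ v : V4, v ≠ 0 → 0 < v ⬝ᵥ (E *ᵥ v)) :
    ∃ S : M4, S.det ≠ 0 ∧ Sᵀ * E * S = 1 := by
  obtain ⟨U, μ, h1, h2, h3⟩ := spec E hs
  have hμ : ∀ i, 0 < μ i := by
    intro i
    have hne : U *ᵥ Pi.single i 1 ≠ 0 := by
      intro h0
      have : Uᵀ *ᵥ (U *ᵥ Pi.single i 1) = 0 := by rw [h0, mulVec_zero]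
      rw [mulVec_mulVec, h1, one_mulVec] at this
      simpa using congrFun this i
    have := hE _ hne
    rw [← conj_entry, h3] at this
    have h4 : Uᵀ * (U * diagonal μ * Uᵀ) * U = diagonal μ := by
      calc Uᵀ * (U * diagonal μ * Uᵀ) * U = (Uᵀ * U) * diagonal μ * (Uᵀ * U) := by simp only [Matrix.mul_assoc]
        _ = _ := by rw [h1]; simp
    rw [h4] at this
    simpa using this
  have hS : (U * diagonal (fun i => (√(μ i))⁻¹))ᵀ * E * (U * diagonal (fun i => (√(μ i))⁻¹)) = 1 := by
    rw [h3, transpose_mul, diagonal_transpose]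
    calc _ = diagonal (fun i => (√(μ i))⁻¹) * ((Uᵀ * U) * diagonal μ * (Uᵀ * U)) * diagonal (fun i => (√(μ i))⁻¹) := by
          simp only [Matrix.mul_assoc]
      _ = 1 := by
        rw [h1, one_mul, mul_one, diagonal_mul_diagonal, diagonal_mul_diagonal, ← diagonal_one]
        congr 1
        funext i
        have h5 := Real.mul_self_sqrt (hμ i).le
        have h6 : √(μ i) ≠ 0 := (Real.sqrt_pos.2 (hμ i)).ne'
        field_simp
        rw [pow_two, h5]
  refine ⟨_, ?_, hS⟩
  intro h0
  have := congrArg det hS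
  rw [det_mul, h0, mul_zero, det_one] at this
  exact zero_ne_one this

lemma MM_quad (Q : Fin 4 → M4) (S : M4) (x v : V4) :
    v ⬝ᵥ (MM Q S x *ᵥ v) = (S *ᵥ v) ⬝ᵥ (Qr Q x *ᵥ (S *ᵥ v)) := by
  show v ⬝ᵥ ((Sᵀ * Qr Q x * S) *ᵥ v) = _
  rw [← mulVec_mulVec, ← mulVec_mulVec, dotProduct_mulVec, vecMul_transpose]

lemma Qr_neg (Q : Fin 4 → M4) (x : V4) : Qr Q (-x) = - Qr Q x := by simp [Qr]

lemma posDef_iff' {A : M4} (hA : A.IsSymm) : A.PosDef ↔ ∀ v : V4, v ≠ 0 → 0 < v ⬝ᵥ (A *ᵥ v) := by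
  rw [posDef_iff_dotProduct_mulVec]
  constructor
  · rintro ⟨-, h⟩ v hv; simpa using h hv
  · intro h
    refine ⟨?_, fun v hv => by simpa using h v hv⟩
    rw [Matrix.IsHermitian, conjTranspose_eq_transpose_of_trivial]; exact hA

lemma neg_symm {A : M4} (hA : A.IsSymm) : (-A).IsSymm := by
  rw [Matrix.IsSymm, transpose_neg, hA.eq]

lemma sgn_mul (a r : ℝ) :
    (a < 0 → ((0 ≤ a * r ↔ r ≤ 0) ∧ (a * r ≤ 0 ↔ 0 ≤ r))) ∧
    (0 < a → ((0 ≤ a * r ↔ 0 ≤ r) ∧ (a * r ≤ 0 ↔ r ≤ 0))) := by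
  refine ⟨fun h => ⟨⟨fun h1 => ?_, fun h1 => ?_⟩, ⟨fun h1 => ?_, fun h1 => ?_⟩⟩,
    fun h => ⟨⟨fun h1 => ?_, fun h1 => ?_⟩, ⟨fun h1 => ?_, fun h1 => ?_⟩⟩⟩ <;>
    first | nlinarith | (by_contra h2; push Not at h2; nlinarith)

lemma setup {Q : Fin 4 → M4} (hs : ∀ i, (Q i).IsSymm) (htr : Transversal Q) (hR : (spectra Q).Nonempty) :
    ∃ (M : V4 →ₗ[ℝ] M4) (e : V4), Net M e ∧
      (realNodes Q = {p | ∃ x, ∃ hx : x ≠ 0, p = Projectivization.mk ℝ x hx ∧ Ker2 (M x)}) ∧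
      ∀ x, ∀ hx : x ≠ 0, (Projectivization.mk ℝ x hx ∈ closure (spectra Q) ↔
        (∀ v, 0 ≤ v ⬝ᵥ (M x *ᵥ v)) ∨ (∀ v, v ⬝ᵥ (M x *ᵥ v) ≤ 0)) := by
  obtain ⟨e, he⟩ : ∃ e, (Qr Q e).PosDef := by
    obtain ⟨_, x, hx, rfl, h | h⟩ := hR
    · exact ⟨x, h⟩
    · exact ⟨-x, by rw [Qr_neg]; exact h⟩
  obtain ⟨S, hS, hSe⟩ := exists_norm (Qr_symm hs e) ((posDef_iff' (Qr_symm hs e)).1 he)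
  have hsy : ∀ x, (MM Q S x).IsSymm := fun x => conj_symm (Qr_symm hs x) S
  have hSi : S⁻¹ * S = 1 ∧ S * S⁻¹ = 1 := ⟨nonsing_inv_mul _ (Ne.isUnit hS), mul_nonsing_inv _ (Ne.isUnit hS)⟩
  have hSv : ∀ v, S *ᵥ v = 0 → v = 0 := by
    intro v hv
    have : S⁻¹ *ᵥ (S *ᵥ v) = 0 := by rw [hv, mulVec_zero]
    rwa [mulVec_mulVec, hSi.1, one_mulVec] at this
  have hconj : ∀ U x, Uᵀ * MM Q S x * U = (S * U)ᵀ * Qr Q x * (S * U) := by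
    intro U x
    show Uᵀ * (Sᵀ * Qr Q x * S) * U = _
    rw [transpose_mul]; simp only [Matrix.mul_assoc]
  have hdet : ∀ U : M4, Uᵀ * U = 1 → (S * U).det ≠ 0 := fun U hU => by
    rw [det_mul]; exact mul_ne_zero hS (orth_det hU)
  have hgrad : ∀ x, gradVanishes Q (toC x) ↔ Ker2 (MM Q S x) := by
    intro x
    constructor
    · intro h; exact ker2_of_grad Q hs hS hSe h
    · intro h
      obtain ⟨U, hU, h0, h1⟩ := ker2_rows (hsy x) h
      rw [hconj] at h0 h1
      exact (node_hess Q hs (hdet U hU) h0 h1).1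
  have hrank : ∀ x : V4, x ≠ 0 → Ker2 (MM Q S x) → (hessian Q (toC x)).rank = 3 := by
    intro x hx h
    exact htr.2.2 _ (fun h0 => hx (toCL_inj (h0.trans (map_zero toCL).symm))) ((hgrad x).2 h)
  refine ⟨MM Q S, e, ⟨hSe, hsy, ?_⟩, ?_, ?_⟩
  · intro x hx U hU h0 h1
    simp only [hconj] at h0 h1 ⊢
    refine node_trans Q hs (hdet U hU) hx h0 h1 ?_
    exact htr.2.2 _ (fun h0 => hx (toCL_inj (h0.trans (map_zero toCL).symm))) (node_hess Q hs (hdet U hU) h0 h1).1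
  · ext p
    constructor
    · rintro ⟨x, hx, rfl, hn⟩; exact ⟨x, hx, rfl, (hgrad x).1 hn.1⟩
    · rintro ⟨x, hx, rfl, hn⟩; exact ⟨x, hx, rfl, (hgrad x).2 hn, hrank x hx hn⟩
  · -- closure
    let Semi : V4 → Prop := fun x => (∀ v, 0 ≤ v ⬝ᵥ (MM Q S x *ᵥ v)) ∨ (∀ v, v ⬝ᵥ (MM Q S x *ᵥ v) ≤ 0)
    have hpd : ∀ x, (∀ v, v ≠ 0 → 0 < v ⬝ᵥ (MM Q S x *ᵥ v)) ↔ (Qr Q x).PosDef := by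
      intro x
      rw [posDef_iff' (Qr_symm hs x)]
      constructor
      · intro h v hv
        have h2 := h (S⁻¹ *ᵥ v) (fun h0 => hv (by
          have : S *ᵥ (S⁻¹ *ᵥ v) = 0 := by rw [h0, mulVec_zero]
          rwa [mulVec_mulVec, hSi.2, one_mulVec] at this))
        rwa [MM_quad, mulVec_mulVec, hSi.2, one_mulVec] at h2
      · intro h v hv
        rw [MM_quad]
        exact h _ (fun h0 => hv (hSv v h0))
    have hcm : Continuous (fun x : V4 => MM Q S x) := LinearMap.continuous_of_finiteDimensional _
    have hcq : ∀ v : V4, Continuous (fun x : V4 => v ⬝ᵥ (MM Q S x *ᵥ v)) := by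
      intro v; fun_prop
    intro x hx
    have hmk : Continuous (fun v : {v : V4 // v ≠ 0} => (Projectivization.mk ℝ v.1 v.2)) :=
      continuous_quotient_mk'
    constructor
    · intro h
      have hcl : IsClosed {p : ℙ ℝ V4 | Semi p.rep} := by
        have hq : Topology.IsQuotientMap (fun v : {v : V4 // v ≠ 0} => (Projectivization.mk ℝ v.1 v.2)) :=
          isQuotientMap_quotient_mk'
        rw [← hq.isClosed_preimage]
        have : (fun v : {v : V4 // v ≠ 0} => (Projectivization.mk ℝ v.1 v.2)) ⁻¹' {p : ℙ ℝ V4 | Semi p.rep} =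
            Subtype.val ⁻¹' ({x : V4 | ∀ v, 0 ≤ v ⬝ᵥ (MM Q S x *ᵥ v)} ∪ {x : V4 | ∀ v, v ⬝ᵥ (MM Q S x *ᵥ v) ≤ 0}) := by
          ext ⟨y, hy⟩
          obtain ⟨a, ha⟩ := Projectivization.exists_smul_eq_mk_rep ℝ y hy
          simp only [Set.mem_preimage, Set.mem_setOf_eq, Set.mem_union, ← ha, Semi, Units.smul_def, map_smul,
            smul_mulVec, dotProduct_smul, smul_eq_mul]
          rcases lt_or_gt_of_ne a.ne_zero with ha | ha
          · simp only [((sgn_mul _ _).1 ha).1, ((sgn_mul _ _).1 ha).2]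
            exact or_comm
          · simp only [((sgn_mul _ _).2 ha).1, ((sgn_mul _ _).2 ha).2]
        rw [this]
        apply IsClosed.preimage continuous_subtype_val
        apply IsClosed.union
        · simp only [Set.setOf_forall]
          exact isClosed_iInter fun v => isClosed_le continuous_const (hcq v)
        · simp only [Set.setOf_forall]
          exact isClosed_iInter fun v => isClosed_le (hcq v) continuous_const
      have hscale : ∀ (y : V4) (hy : y ≠ 0), Semi (Projectivization.mk ℝ y hy).rep ↔ Semi y := by
        intro y hy
        obtain ⟨a, ha⟩ := Projectivization.exists_smul_eq_mk_rep ℝ y hy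
        simp only [← ha, Semi, Units.smul_def, map_smul, smul_mulVec, dotProduct_smul, smul_eq_mul]
        rcases lt_or_gt_of_ne a.ne_zero with ha | ha
        · simp only [((sgn_mul _ _).1 ha).1, ((sgn_mul _ _).1 ha).2]
          exact or_comm
        · simp only [((sgn_mul _ _).2 ha).1, ((sgn_mul _ _).2 ha).2]
      have hsub : spectra Q ⊆ {p : ℙ ℝ V4 | Semi p.rep} := by
        rintro _ ⟨y, hy, rfl, h | h⟩
        · refine (hscale y hy).2 (Or.inl fun v => ?_)
          by_cases hv : v = 0
          · simp [hv]
          · exact ((hpd y).2 h v hv).le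
        · refine (hscale y hy).2 (Or.inr fun v => ?_)
          rw [← Qr_neg] at h
          by_cases hv : v = 0
          · simp [hv]
          · have := ((hpd (-y)).2 h v hv).le
            rw [map_neg, neg_mulVec, dotProduct_neg] at this
            linarith
      exact (hscale x hx).1 (closure_minimal hsub hcl h)
    · -- limits
      have hlim : ∀ (y : V4) (hy : y ≠ 0), (∀ v, 0 ≤ v ⬝ᵥ (MM Q S y *ᵥ v)) →
          Projectivization.mk ℝ y hy ∈ closure (spectra Q) := by
        intro y hy hpsd
        have hp : ∀ s : ℝ, 0 < s → (Qr Q (y + s • e)).PosDef := by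
          intro s hs0
          rw [← hpd]
          intro v hv
          have h1 : MM Q S e = 1 := hSe
          rw [map_add, map_smul, add_mulVec, dotProduct_add, smul_mulVec, h1, one_mulVec, dotProduct_smul, smul_eq_mul]
          have := hpsd v
          have := mul_pos hs0 (dot_pos hv)
          linarith
        have hne : ∀ s : ℝ, 0 ≤ s → y + s • e ≠ 0 := by
          intro s hs0 h0
          rcases hs0.eq_or_lt with rfl | hs0
          · simp at h0; exact hy h0
          · have := (posDef_iff' (Qr_symm hs _)).1 (hp s hs0) (Pi.single 0 1) (by
              intro h; simpa using congrFun h 0)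
            rw [h0] at this
            simp [Qr] at this
        let f : Set.Ici (0 : ℝ) → {v : V4 // v ≠ 0} := fun s => ⟨y + s.1 • e, hne s.1 s.2⟩
        have hf : Continuous f := by
          apply Continuous.subtype_mk
          fun_prop
        have hc := hmk.comp hf
        have hzero : (⟨0, Set.self_mem_Ici⟩ : Set.Ici (0 : ℝ)) ∈ closure {s : Set.Ici (0 : ℝ) | 0 < s.1} := by
          rw [closure_subtype]
          have : (Subtype.val '' {s : Set.Ici (0 : ℝ) | 0 < s.1}) = Set.Ioi (0 : ℝ) := by
            ext s; constructor
            · rintro ⟨s, h, rfl⟩; exact h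
            · intro h; exact ⟨⟨s, Set.mem_Ici.2 (le_of_lt (Set.mem_Ioi.1 h))⟩, h, rfl⟩
          rw [this, closure_Ioi]
          exact Set.self_mem_Ici
        have := map_mem_closure hc hzero (t := spectra Q) (by
          intro s h
          exact ⟨_, (f s).2, rfl, Or.inl (hp s.1 h)⟩)
        have h2 : (f ⟨0, Set.self_mem_Ici⟩) = ⟨y, hy⟩ := by
          apply Subtype.ext; simp [f]
        simp only [Function.comp, h2] at this
        exact this
      rintro (h | h)
      · exact hlim x hx h
      · have h1 := hlim (-x) (neg_ne_zero.2 hx) (fun v => by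
          rw [map_neg, neg_mulVec, dotProduct_neg]; linarith [h v])
        have : Projectivization.mk ℝ (-x) (neg_ne_zero.2 hx) = Projectivization.mk ℝ x hx := by
          rw [Projectivization.mk_eq_mk_iff']
          exact ⟨-1, by simp⟩
        rwa [this] at h1

lemma approx_box {f : ℝ × ℝ → ℝ} {f' : ℝ × ℝ →L[ℝ] ℝ} {a b : ℝ} (hf : HasFDerivAt f f' (a, b))
    (h0 : f (a, b) = 0) {c : ℝ} (hc : 0 < c) : ∃ r > 0, ∀ ε, 0 < ε → ε < r → ∀ s t, |s - a| ≤ ε → |t - b| ≤ ε →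
      |f (s, t) - ((s - a) * f' (1, 0) + (t - b) * f' (0, 1))| ≤ c * ε := by
  have h := hf.isLittleO.def hc
  rw [Metric.eventually_nhds_iff] at h
  obtain ⟨r, hr, h⟩ := h
  refine ⟨r, hr, fun ε hε hεr s t hs ht => ?_⟩
  have hn : ‖((s, t) : ℝ × ℝ) - (a, b)‖ ≤ ε := by
    rw [Prod.norm_def]; exact max_le hs ht
  have := h (y := (s, t)) (by rw [dist_eq_norm]; linarith)
  rw [h0, sub_zero] at this
  have e : f' ((s, t) - (a, b)) = (s - a) * f' (1, 0) + (t - b) * f' (0, 1) := by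
    have : ((s, t) : ℝ × ℝ) - (a, b) = (s - a) • (1, 0) + (t - b) • (0, 1) := by ext <;> simp
    rw [this, map_add, map_smul, map_smul]; simp
  rw [e, Real.norm_eq_abs] at this
  exact this.trans (mul_le_mul_of_nonneg_left hn hc.le)

lemma flip_of_deriv_pos {G : ℝ → ℝ → M4} {θ0 t0 : ℝ} (hr : ∀ θ t, ∃ w : V4, G θ t = vecMulVec w w) (k l : V4)
    {D' b' : ℝ × ℝ →L[ℝ] ℝ}
    (hD : HasFDerivAt (fun p : ℝ × ℝ => k ⬝ᵥ (G p.1 p.2 *ᵥ k) - l ⬝ᵥ (G p.1 p.2 *ᵥ l)) D' (θ0, t0))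
    (hb : HasFDerivAt (fun p : ℝ × ℝ => k ⬝ᵥ (G p.1 p.2 *ᵥ l)) b' (θ0, t0))
    (hD0 : k ⬝ᵥ (G θ0 t0 *ᵥ k) - l ⬝ᵥ (G θ0 t0 *ᵥ l) = 0) (hb0 : k ⬝ᵥ (G θ0 t0 *ᵥ l) = 0)
    (hα : 0 < D' (0, 1)) (hβ0 : b' (0, 1) = 0) (hβ : b' (1, 0) ≠ 0) : FlipAt G θ0 t0 := by
  set α := D' (0, 1) with hαd
  set γ := D' (1, 0) with hγd
  set β := b' (1, 0) with hβd
  refine ⟨k, l, β, fun η hη => ?_⟩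
  set κ := min 1 (α / (4 * (|γ| + 1))) with hκd
  have hγ0 := abs_nonneg γ
  have hκ : 0 < κ := lt_min one_pos (by positivity)
  have hκ1 : κ ≤ 1 := min_le_left _ _
  have hκγ : κ * |γ| ≤ α / 4 := by
    have h1 : κ ≤ α / (4 * (|γ| + 1)) := min_le_right _ _
    rw [le_div_iff₀ (by positivity)] at h1
    nlinarith
  have hβp : 0 < |β| := abs_pos.2 hβ
  obtain ⟨r1, hr1, H1⟩ := approx_box hD hD0 (c := α / 4) (by positivity)
  obtain ⟨r2, hr2, H2⟩ := approx_box hb hb0 (c := |β| * κ / 2) (by positivity)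
  obtain ⟨ε, hε0, hε⟩ : ∃ ε, 0 < ε ∧ ε < min η (min r1 r2) := exists_between (lt_min hη (lt_min hr1 hr2))
  have e1 : ε < η := hε.trans_le (min_le_left _ _)
  have e2 : ε < r1 := hε.trans_le ((min_le_right _ _).trans (min_le_left _ _))
  have e3 : ε < r2 := hε.trans_le ((min_le_right _ _).trans (min_le_right _ _))
  have hδε : κ * ε ≤ ε := by nlinarith
  have hnn : ∀ θ t v, 0 ≤ v ⬝ᵥ (G θ t *ᵥ v) := by
    intro θ t v
    obtain ⟨w, hw⟩ := hr θ t
    rw [hw, vmv_quad]; exact mul_self_nonneg _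
  refine ⟨κ * ε, ε, by positivity, by linarith, hε0, e1, ?_, ?_⟩
  · intro θ hθ
    have hg : |(θ - θ0) * γ| ≤ α / 4 * ε := by
      rw [abs_mul]
      calc |θ - θ0| * |γ| ≤ (κ * ε) * |γ| := mul_le_mul_of_nonneg_right hθ hγ0
        _ = (κ * |γ|) * ε := by ring
        _ ≤ _ := mul_le_mul_of_nonneg_right hκγ hε0.le
    have hg' := abs_le.1 hg
    have hαε := mul_pos hα hε0
    constructor
    · have h := abs_le.1 (H1 ε hε0 e2 θ (t0 - ε) (hθ.trans hδε) (by rw [show t0 - ε - t0 = -ε by ring, abs_neg, abs_of_pos hε0]))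
      have := hnn θ (t0 - ε) k
      simp only at h
      nlinarith [h.2]
    · have h := abs_le.1 (H1 ε hε0 e2 θ (t0 + ε) (hθ.trans hδε) (by rw [show t0 + ε - t0 = ε by ring, abs_of_pos hε0]))
      have := hnn θ (t0 + ε) l
      simp only at h
      nlinarith [h.1]
  · intro t ht
    have hκε : 0 < κ * ε := by positivity
    have hββ : |β| * |β| = β * β := abs_mul_abs_self β
    have key : ∀ r : ℝ, |r| ≤ |β| * κ / 2 * ε → |β * r| ≤ (β * β) * (κ * ε) / 2 := by
      intro r hr
      rw [abs_mul]
      calc |β| * |r| ≤ |β| * (|β| * κ / 2 * ε) := mul_le_mul_of_nonneg_left hr hβp.le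
        _ = (|β| * |β|) * (κ * ε) / 2 := by ring
        _ = _ := by rw [hββ]
    have hp : 0 < (β * β) * (κ * ε) := by rw [← hββ]; positivity
    constructor
    · have h := H2 ε hε0 e3 (θ0 + κ * ε) t (by rw [show θ0 + κ * ε - θ0 = κ * ε by ring, abs_of_pos hκε]; exact hδε) ht
      have h2 := abs_le.1 (key _ h)
      rw [hβ0] at h2
      simp only at h2
      nlinarith [h2.1]
    · have h := H2 ε hε0 e3 (θ0 - κ * ε) t (by rw [show θ0 - κ * ε - θ0 = -(κ * ε) by ring, abs_neg, abs_of_pos hκε]; exact hδε) ht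
      have h2 := abs_le.1 (key _ h)
      rw [hβ0] at h2
      simp only at h2
      nlinarith [h2.2]

lemma flip_of_deriv {G : ℝ → ℝ → M4} {θ0 t0 : ℝ} (hr : ∀ θ t, ∃ w : V4, G θ t = vecMulVec w w) (k l : V4)
    {D' b' : ℝ × ℝ →L[ℝ] ℝ}
    (hD : HasFDerivAt (fun p : ℝ × ℝ => k ⬝ᵥ (G p.1 p.2 *ᵥ k) - l ⬝ᵥ (G p.1 p.2 *ᵥ l)) D' (θ0, t0))
    (hb : HasFDerivAt (fun p : ℝ × ℝ => k ⬝ᵥ (G p.1 p.2 *ᵥ l)) b' (θ0, t0))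
    (hD0 : k ⬝ᵥ (G θ0 t0 *ᵥ k) - l ⬝ᵥ (G θ0 t0 *ᵥ l) = 0) (hb0 : k ⬝ᵥ (G θ0 t0 *ᵥ l) = 0)
    (hα : D' (0, 1) ≠ 0) (hβ0 : b' (0, 1) = 0) (hβ : b' (1, 0) ≠ 0) : FlipAt G θ0 t0 := by
  have hsw : ∀ θ t, k ⬝ᵥ (G θ t *ᵥ l) = l ⬝ᵥ (G θ t *ᵥ k) := by
    intro θ t
    obtain ⟨w, hw⟩ := hr θ t
    rw [hw, vmv_quad, vmv_quad, mul_comm]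
  rcases lt_or_gt_of_ne hα with h | h
  · refine flip_of_deriv_pos hr l k (D' := -D') (b' := b') ?_ ?_ (by linarith) (by rw [← hsw]; exact hb0) (by simpa using h) hβ0 hβ
    · refine hD.neg.congr_of_eventuallyEq (Filter.Eventually.of_forall fun p => ?_)
      simp
    · simp only [hsw] at hb; exact hb
  · exact flip_of_deriv_pos hr k l hD hb hD0 hb0 h hβ0 hβ

/-- product of a differentiable function vanishing at the point and a continuous one -/
lemma deriv_vanish_mul {f g : ℝ × ℝ → ℝ} {f' : ℝ × ℝ →L[ℝ] ℝ} {p : ℝ × ℝ} (hf : HasFDerivAt f f' p) (h0 : f p = 0)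
    (hg : ContinuousAt g p) : HasFDerivAt (fun q => f q * g q) (g p • f') p := by
  have h1 : HasFDerivAt (fun q => f q * g p) (g p • f') p := hf.mul_const (g p)
  have hO : (fun q => f q) =O[nhds p] fun q => q - p := by
    have := hf.isBigO_sub
    simpa [h0] using this
  have ho : (fun q => g q - g p) =o[nhds p] fun _ => (1 : ℝ) := by
    rw [Asymptotics.isLittleO_one_iff]
    have := hg.tendsto.sub_const (g p)
    simpa using this
  have h2 : HasFDerivAt (fun q => f q * (g q - g p)) (0 : ℝ × ℝ →L[ℝ] ℝ) p := by
    rw [hasFDerivAt_iff_isLittleO]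
    simp only [h0, zero_mul, sub_zero]
    refine Asymptotics.IsLittleO.congr_left (f₁ := fun q => f q * (g q - g p)) ?_ (by intro q; simp)
    have hO' : (fun q => f q) =O[nhds p] fun q => ‖q - p‖ := hO.norm_right
    have h4 := hO'.mul_isLittleO ho
    simp only [mul_one] at h4
    exact h4.of_norm_right
  have := h1.add h2
  simp only [add_zero] at this
  refine this.congr_of_eventuallyEq (Filter.Eventually.of_forall fun q => ?_)
  simp only [Pi.add_apply]; ring

lemma rot_kernel {A N : M4} (hN : N.IsSymm) (h : Ker2 A) : ∃ k l : V4, k ⬝ᵥ k = 1 ∧ l ⬝ᵥ l = 1 ∧ k ⬝ᵥ l = 0 ∧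
    A *ᵥ k = 0 ∧ A *ᵥ l = 0 ∧ k ⬝ᵥ (N *ᵥ l) = 0 := by
  obtain ⟨k, l, hk, hl, hkl, h1, h2⟩ := h
  set z : ℂ := ⟨k ⬝ᵥ (N *ᵥ k) - l ⬝ᵥ (N *ᵥ l), 2 * (k ⬝ᵥ (N *ᵥ l))⟩ with hz
  set φ := Complex.arg z / 2 with hφ
  have hre : k ⬝ᵥ (N *ᵥ k) - l ⬝ᵥ (N *ᵥ l) = ‖z‖ * Real.cos (2 * φ) := by
    rw [hφ, mul_div_cancel₀ _ (two_ne_zero), Complex.norm_mul_cos_arg]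
  have him : 2 * (k ⬝ᵥ (N *ᵥ l)) = ‖z‖ * Real.sin (2 * φ) := by
    rw [hφ, mul_div_cancel₀ _ (two_ne_zero), Complex.norm_mul_sin_arg]
  have hlk : l ⬝ᵥ k = 0 := by rw [dotProduct_comm]; exact hkl
  have hsc := Real.sin_sq_add_cos_sq φ
  have hsw := symm_swap hN l k
  refine ⟨Real.cos φ • k + Real.sin φ • l, (-Real.sin φ) • k + Real.cos φ • l, ?_, ?_, ?_, ?_, ?_, ?_⟩
  · simp only [dotProduct_add, add_dotProduct, dotProduct_smul, smul_dotProduct, smul_eq_mul, hk, hl, hkl, hlk]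
    linear_combination hsc
  · simp only [dotProduct_add, add_dotProduct, dotProduct_smul, smul_dotProduct, smul_eq_mul, hk, hl, hkl, hlk]
    linear_combination hsc
  · simp only [dotProduct_add, add_dotProduct, dotProduct_smul, smul_dotProduct, smul_eq_mul, hk, hl, hkl, hlk]
    ring
  · simp [mulVec_add, mulVec_smul, h1, h2]
  · simp [mulVec_add, mulVec_smul, mulVec_neg, h1, h2]
  · simp only [mulVec_add, mulVec_smul, dotProduct_add, add_dotProduct, dotProduct_smul, smul_dotProduct, smul_eq_mul, hsw]
    rw [Real.cos_two_mul'] at hre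
    rw [Real.sin_two_mul] at him
    linear_combination (-Real.sin φ * Real.cos φ) * hre + ((Real.cos φ ^ 2 - Real.sin φ ^ 2) / 2) * him

lemma adj_entries (C : M4) :
    C.adjugate 0 0 = C 1 1 * (C 2 2 * C 3 3 - C 2 3 * C 3 2) - C 1 2 * (C 2 1 * C 3 3 - C 2 3 * C 3 1)
      + C 1 3 * (C 2 1 * C 3 2 - C 2 2 * C 3 1) ∧
    C.adjugate 1 1 = C 0 0 * (C 2 2 * C 3 3 - C 2 3 * C 3 2) - C 0 2 * (C 2 0 * C 3 3 - C 2 3 * C 3 0)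
      + C 0 3 * (C 2 0 * C 3 2 - C 2 2 * C 3 0) ∧
    C.adjugate 0 1 = -(C 0 1 * (C 2 2 * C 3 3 - C 2 3 * C 3 2) - C 0 2 * (C 2 1 * C 3 3 - C 2 3 * C 3 1)
      + C 0 3 * (C 2 1 * C 3 2 - C 2 2 * C 3 1)) := by
  refine ⟨?_, ?_, ?_⟩ <;>
  · rw [adjugate_fin_succ_eq_det_submatrix, det_fin_three]
    simp [Fin.succAbove, Fin.lt_def]
    ring

lemma adj_conj {U : M4} (hU : Uᵀ * U = 1) (X : M4) : (Uᵀ * X * U).adjugate = Uᵀ * X.adjugate * U := by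
  have hU' : U * Uᵀ = 1 := mul_eq_one_comm.1 hU
  have hd : U.det * U.det = 1 := by
    have := congrArg det hU
    rwa [det_mul, det_transpose, det_one] at this
  have h1 : U.adjugate = U.det • Uᵀ := by
    calc U.adjugate = (Uᵀ * U) * U.adjugate := by rw [hU, one_mul]
      _ = Uᵀ * (U * U.adjugate) := by rw [Matrix.mul_assoc]
      _ = _ := by rw [mul_adjugate]; simp
  have h2 : Uᵀ.adjugate = U.det • U := by rw [← adjugate_transpose, h1]; simp
  rw [adjugate_mul_distrib, adjugate_mul_distrib, h1, h2]
  simp only [smul_mul_assoc, mul_smul_comm, smul_smul, hd, one_smul, Matrix.mul_assoc]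

def entL (M : V4 →ₗ[ℝ] M4) (U : M4) (i j : Fin 4) : V4 →L[ℝ] ℝ :=
  LinearMap.toContinuousLinearMap
    { toFun := fun x => (Uᵀ * M x * U) i j
      map_add' := fun x y => by simp [mul_add, add_mul]
      map_smul' := fun c x => by simp }

lemma entL_apply (M : V4 →ₗ[ℝ] M4) (U : M4) (i j : Fin 4) (x : V4) : entL M U i j x = (Uᵀ * M x * U) i j := rfl

lemma flip_at {M : V4 →ₗ[ℝ] M4} {e : V4} (hN : Net M e) {y : ℝ × ℝ → V4} {y' : ℝ × ℝ →L[ℝ] V4} {θ0 t0 : ℝ}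
    (hy : HasFDerivAt y y' (θ0, t0)) (hyc : Continuous y)
    (hK : Ker2 (M (y (θ0, t0)) - lam (M (y (θ0, t0))) • (1 : M4)))
    (hind : ∀ a b c d : ℝ, a • e + b • y (θ0, t0) + c • y' (1, 0) + d • y' (0, 1) = 0 →
      a = 0 ∧ b = 0 ∧ c = 0 ∧ d = 0) :
    FlipAt (fun θ t => GG (M (y (θ, t)))) θ0 t0 := by
  set lm := lam (M (y (θ0, t0))) with hlm
  obtain ⟨k, l, hk, hl, hkl, hk0, hl0, hkl0⟩ := rot_kernel (hN.symm (y' (0, 1))) hK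
  obtain ⟨U, hU, hUk, hUl⟩ := ortho_ext hk hl hkl
  set X : V4 := y (θ0, t0) - lm • e with hX
  have hX0 : X ≠ 0 := by
    intro h0
    have := (hind (-lm) 1 0 0 (by rw [← h0, hX]; module)).2.1
    exact one_ne_zero this
  have hMX : M X = M (y (θ0, t0)) - lm • (1 : M4) := by rw [hX, map_sub, map_smul, hN.one]
  have hsX : (Uᵀ * M X * U).IsSymm := conj_symm (hN.symm X) U
  have r0 : ∀ j, (Uᵀ * M X * U) 0 j = 0 := by
    intro j; rw [conj_entry, symm_swap (hN.symm X), hUk, hMX, hk0, dotProduct_zero]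
  have r1 : ∀ j, (Uᵀ * M X * U) 1 j = 0 := by
    intro j; rw [conj_entry, symm_swap (hN.symm X), hUl, hMX, hl0, dotProduct_zero]
  have c0' : ∀ j, (Uᵀ * M X * U) j 0 = 0 := fun j => by rw [hsX.apply]; exact r0 j
  have c1' : ∀ j, (Uᵀ * M X * U) j 1 = 0 := fun j => by rw [hsX.apply]; exact r1 j
  obtain ⟨hc0, htr⟩ := hN.trans X hX0 U hU r0 r1
  set c0 := (Uᵀ * M X * U) 2 2 * (Uᵀ * M X * U) 3 3 - (Uᵀ * M X * U) 2 3 * (Uᵀ * M X * U) 3 2 with hc0d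
  have heU : ∀ i j, entL M U i j e = (1 : M4) i j := by
    intro i j; rw [entL_apply, hN.one, mul_one, hU]
  have htr' : ∀ h : V4, entL M U 0 0 h = 0 → entL M U 0 1 h = 0 → entL M U 1 1 h = 0 → ∃ c : ℝ, h = c • X := htr
  have h01t : entL M U 0 1 (y' (0, 1)) = 0 := by
    rw [entL_apply, conj_entry, hUk, hUl]; exact hkl0
  -- alpha
  have hα : entL M U 1 1 (y' (0, 1)) - entL M U 0 0 (y' (0, 1)) ≠ 0 := by
    intro h0
    obtain ⟨c, hc⟩ := htr' (y' (0, 1) - (entL M U 0 0 (y' (0, 1))) • e) (by simp [heU])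
      (by simp [heU, h01t]) (by simp [heU]; linarith)
    have := (hind (-(entL M U 0 0 (y' (0, 1))) + c * lm) (-c) 0 1 (by
      have h2 := sub_eq_zero.2 hc
      rw [← h2, hX]; module)).2.2.2
    exact one_ne_zero this
  have hβ : entL M U 0 1 (y' (1, 0)) ≠ 0 := by
    intro h0
    set a := (entL M U 1 1 (y' (1, 0)) - entL M U 0 0 (y' (1, 0))) / (entL M U 1 1 (y' (0, 1)) - entL M U 0 0 (y' (0, 1))) with ha
    have ha' : a * (entL M U 1 1 (y' (0, 1)) - entL M U 0 0 (y' (0, 1))) = entL M U 1 1 (y' (1, 0)) - entL M U 0 0 (y' (1, 0)) :=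
      div_mul_cancel₀ _ hα
    set b := entL M U 0 0 (y' (1, 0)) - a * entL M U 0 0 (y' (0, 1)) with hb
    obtain ⟨c, hc⟩ := htr' (y' (1, 0) - a • y' (0, 1) - b • e) (by simp [heU, hb])
      (by simp [heU, h01t, h0]) (by simp [heU]; linear_combination -ha' - hb)
    have := (hind (-b + c * lm) (-c) 1 (-a) (by
      have h2 := sub_eq_zero.2 hc
      rw [← h2, hX]; module)).2.2.1
    exact one_ne_zero this
  -- the functions
  let B : Fin 4 → Fin 4 → ℝ × ℝ → ℝ := fun i j p => entL M U i j (y p)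
  have hB : ∀ i j, HasFDerivAt (B i j) ((entL M U i j).comp y') (θ0, t0) := fun i j =>
    (entL M U i j).hasFDerivAt.comp _ hy
  have hBc : ∀ i j, Continuous (B i j) := fun i j => (entL M U i j).continuous.comp hyc
  have hlc : Continuous (fun p => lam (M (y p))) := by
    have hM : Continuous (fun x => M x) := LinearMap.continuous_of_finiteDimensional _
    exact continuousOn_univ.1 (lam_cont (fun p => hN.symm (y p)) (hM.comp hyc).continuousOn)
  let C : ℝ × ℝ → M4 := fun p => Uᵀ * (M (y p) - lam (M (y p)) • (1 : M4)) * U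
  have hC : ∀ p i j, C p i j = B i j p - lam (M (y p)) * (1 : M4) i j := by
    intro p i j
    simp only [C, B, entL_apply, mul_sub, sub_mul, mul_smul_comm, smul_mul_assoc, mul_one, hU]
    simp
  have hCc : ∀ i j, Continuous (fun p => C p i j) := by
    intro i j; simp only [hC]; exact (hBc i j).sub (hlc.mul continuous_const)
  have hCoff : ∀ i j, i ≠ j → ∀ p, C p i j = B i j p := by
    intro i j hij p; rw [hC, one_apply_ne hij]; ring
  have hCp : C (θ0, t0) = Uᵀ * M X * U := by simp only [C]; rw [hMX]
  have hBp : ∀ i j, i ≠ j → B i j (θ0, t0) = (Uᵀ * M X * U) i j := by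
    intro i j hij; rw [← hCoff i j hij, hCp]
  have hG : ∀ p i j, (U *ᵥ Pi.single i 1) ⬝ᵥ (GG (M (y p)) *ᵥ (U *ᵥ Pi.single j 1)) = (C p).adjugate i j := by
    intro p i j
    rw [← conj_entry, GG, ← adj_conj hU]
  have vanish : ∀ i j, i ≠ j → (Uᵀ * M X * U) i j = 0 → ∀ g : ℝ × ℝ → ℝ, Continuous g → g (θ0, t0) = 0 →
      HasFDerivAt (fun p => C p i j * g p) (0 : ℝ × ℝ →L[ℝ] ℝ) (θ0, t0) := by
    intro i j hij h0 g hg hg0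
    have := deriv_vanish_mul (hB i j) ((hBp i j hij).trans h0) hg.continuousAt
    rw [hg0] at this
    simp only [hCoff i j hij]
    refine this.congr_fderiv ?_
    ext <;> simp
  have hcc : Continuous (fun p => C p 2 2 * C p 3 3 - C p 2 3 * C p 3 2) := by
    have h := hCc
    exact ((h 2 2).mul (h 3 3)).sub ((h 2 3).mul (h 3 2))
  have hccp : C (θ0, t0) 2 2 * C (θ0, t0) 3 3 - C (θ0, t0) 2 3 * C (θ0, t0) 3 2 = c0 := by rw [hCp]
  have v12 := vanish 1 2 (by decide) (r1 2) (fun p => C p 2 1 * C p 3 3 - C p 2 3 * C p 3 1)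
    (((hCc 2 1).mul (hCc 3 3)).sub ((hCc 2 3).mul (hCc 3 1))) (by simp only [hCp, c1']; ring)
  have v13 := vanish 1 3 (by decide) (r1 3) (fun p => C p 2 1 * C p 3 2 - C p 2 2 * C p 3 1)
    (((hCc 2 1).mul (hCc 3 2)).sub ((hCc 2 2).mul (hCc 3 1))) (by simp only [hCp, c1']; ring)
  have v02 := vanish 0 2 (by decide) (r0 2) (fun p => C p 2 0 * C p 3 3 - C p 2 3 * C p 3 0)
    (((hCc 2 0).mul (hCc 3 3)).sub ((hCc 2 3).mul (hCc 3 0))) (by simp only [hCp, c0']; ring)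
  have v03 := vanish 0 3 (by decide) (r0 3) (fun p => C p 2 0 * C p 3 2 - C p 2 2 * C p 3 0)
    (((hCc 2 0).mul (hCc 3 2)).sub ((hCc 2 2).mul (hCc 3 0))) (by simp only [hCp, c0']; ring)
  have w02 := vanish 0 2 (by decide) (r0 2) (fun p => C p 2 1 * C p 3 3 - C p 2 3 * C p 3 1)
    (((hCc 2 1).mul (hCc 3 3)).sub ((hCc 2 3).mul (hCc 3 1))) (by simp only [hCp, c1']; ring)
  have w03 := vanish 0 3 (by decide) (r0 3) (fun p => C p 2 1 * C p 3 2 - C p 2 2 * C p 3 1)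
    (((hCc 2 1).mul (hCc 3 2)).sub ((hCc 2 2).mul (hCc 3 1))) (by simp only [hCp, c1']; ring)
  have d01 := deriv_vanish_mul (hB 0 1) ((hBp 0 1 (by decide)).trans (r0 1)) hcc.continuousAt
  have hdiag0 : B 1 1 (θ0, t0) - B 0 0 (θ0, t0) = 0 := by
    have e1 : C (θ0, t0) 1 1 - C (θ0, t0) 0 0 = 0 := by rw [hCp, r0, r1]; ring
    rw [hC, hC] at e1
    simpa using e1
  have dD := deriv_vanish_mul ((hB 1 1).sub (hB 0 0)) hdiag0 hcc.continuousAt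
  have D1 := ((dD.add v13).sub v12).sub (v03.sub v02)
  have b1 := ((d01.add w03).sub w02).neg
  refine flip_of_deriv (k := k) (l := l) ?_ (D1.congr_of_eventuallyEq (Filter.Eventually.of_forall fun p => ?_))
    (b1.congr_of_eventuallyEq (Filter.Eventually.of_forall fun p => ?_)) ?_ ?_ ?_ ?_ ?_
  · intro θ t
    obtain ⟨w, hw, -⟩ := GG_rank_one (hN.symm (y (θ, t)))
    exact ⟨w, hw⟩
  · rw [← hUk, ← hUl]
    simp only [Prod.mk.eta, hG, (adj_entries (C p)).1, (adj_entries (C p)).2.1, Pi.add_apply, Pi.sub_apply]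
    have e1 : C p 1 1 - C p 0 0 = B 1 1 p - B 0 0 p := by rw [hC, hC]; simp
    linear_combination (C p 2 2 * C p 3 3 - C p 2 3 * C p 3 2) * e1
  · rw [← hUk, ← hUl]
    simp only [Prod.mk.eta, hG, (adj_entries (C p)).2.2, Pi.add_apply, Pi.sub_apply, Pi.neg_apply]
    rw [hCoff 0 1 (by decide)]
    ring
  · rw [← hUk, ← hUl]
    simp only [hG, (adj_entries _).1, (adj_entries _).2.1, hCp, c0', c1']
    ring
  · rw [← hUk, ← hUl]
    simp only [hG, (adj_entries _).2.2, hCp, c0', c1', r0]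
    ring
  · simp only [hccp]
    simp
    exact ⟨hc0, hα⟩
  · simp only [hccp]
    simp
    right; exact h01t
  · simp only [hccp]
    simp
    exact ⟨hc0, hβ⟩

lemma avoid {κ : Type*} [Finite κ] (W : κ → Fin 3 → V4) :
    ∃ u : V4, ∀ i (a b c : ℝ), u ≠ a • W i 0 + b • W i 1 + c • W i 2 := by
  classical
  cases nonempty_fintype κ
  let s : Finset (Subspace ℝ V4) := Finset.univ.image fun i => Submodule.span ℝ (Set.range (W i))
  have hs : ⊤ ∉ s := by
    intro h
    simp only [s, Finset.mem_image, Finset.mem_univ, true_and] at h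
    obtain ⟨i, hi⟩ := h
    have h1 := finrank_range_le_card (R := ℝ) (W i)
    rw [Set.finrank, hi, finrank_top] at h1
    simp at h1
  have h := Subspace.biUnion_ne_univ_of_top_notMem hs
  obtain ⟨u, hu⟩ := (Set.ne_univ_iff_exists_notMem _).1 h
  refine ⟨u, fun i a b c hc => hu ?_⟩
  simp only [Set.mem_iUnion]
  refine ⟨Submodule.span ℝ (Set.range (W i)), Finset.mem_image_of_mem _ (Finset.mem_univ i), ?_⟩
  have hm : ∀ j, W i j ∈ Submodule.span ℝ (Set.range (W i)) := fun j => Submodule.subset_span ⟨j, rfl⟩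
  rw [hc]
  exact Submodule.add_mem _ (Submodule.add_mem _ (Submodule.smul_mem _ _ (hm 0)) (Submodule.smul_mem _ _ (hm 1)))
    (Submodule.smul_mem _ _ (hm 2))

/-- linear independence of four vectors -/
def Ind4 (e u v w : V4) : Prop := ∀ a b c d : ℝ, a • e + b • u + c • v + d • w = 0 →
  a = 0 ∧ b = 0 ∧ c = 0 ∧ d = 0

lemma ind4_of {e u v w : V4} (he : e ≠ 0) (hu : ∀ a : ℝ, u ≠ a • e) (hv : ∀ a b : ℝ, v ≠ a • e + b • u)
    (hw : ∀ a b c : ℝ, w ≠ a • e + b • u + c • v) : Ind4 e u v w := by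
  intro a b c d h
  have hd : d = 0 := by
    by_contra hd
    apply hw (-a / d) (-b / d) (-c / d)
    have : w = d⁻¹ • (d • w) := by rw [smul_smul, inv_mul_cancel₀ hd, one_smul]
    rw [this, show d • w = -(a • e + b • u + c • v) by rw [← sub_eq_zero, ← h]; module]
    module
  subst hd
  have hc : c = 0 := by
    by_contra hc
    apply hv (-a / c) (-b / c)
    have : v = c⁻¹ • (c • v) := by rw [smul_smul, inv_mul_cancel₀ hc, one_smul]
    rw [this, show c • v = -(a • e + b • u) by rw [← sub_eq_zero, ← h]; module]
    module
  subst hc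
  have hb : b = 0 := by
    by_contra hb
    apply hu (-a / b)
    have : u = b⁻¹ • (b • u) := by rw [smul_smul, inv_mul_cancel₀ hb, one_smul]
    rw [this, show b • u = -(a • e) by rw [← sub_eq_zero, ← h]; module]
    module
  subst hb
  have ha : a • e = 0 := by rw [← h]; module
  exact ⟨(smul_eq_zero.1 ha).resolve_right he, rfl, rfl, rfl⟩

lemma Ind4.span {e u v w : V4} (h : Ind4 e u v w) (x : V4) :
    ∃ a b c d : ℝ, x = a • e + b • u + c • v + d • w := by
  let L : V4 →ₗ[ℝ] V4 :=
    { toFun := fun z => z 0 • e + z 1 • u + z 2 • v + z 3 • w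
      map_add' := fun z z' => by simp only [Pi.add_apply]; module
      map_smul' := fun c z => by simp only [Pi.smul_apply, smul_eq_mul, RingHom.id_apply]; module }
  have hL : Function.Injective L := by
    rw [← LinearMap.ker_eq_bot, LinearMap.ker_eq_bot']
    intro z hz
    obtain ⟨h0, h1, h2, h3⟩ := h _ _ _ _ hz
    ext i; fin_cases i <;> assumption
  obtain ⟨z, hz⟩ := (LinearMap.injective_iff_surjective.1 hL) x
  exact ⟨z 0, z 1, z 2, z 3, hz.symm⟩

lemma Ind4.eq {e u v w : V4} (h : Ind4 e u v w) {a b c d a' b' c' d' : ℝ}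
    (he : a • e + b • u + c • v + d • w = a' • e + b' • u + c' • v + d' • w) :
    a = a' ∧ b = b' ∧ c = c' ∧ d = d' := by
  have := h (a - a') (b - b') (c - c') (d - d') (by rw [← sub_eq_zero] at he; rw [← he]; module)
  simpa [sub_eq_zero] using this

lemma polar {b c d : ℝ} (hd : d ≠ 0) : ∃ ρ θ t : ℝ, 0 < ρ ∧ -Real.pi < θ ∧ θ < Real.pi ∧ 0 < t ∧ t < Real.pi ∧
    b = ρ * Real.cos t ∧ c = ρ * (Real.sin t * Real.cos θ) ∧ d = ρ * (Real.sin t * Real.sin θ) := by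
  have aux : ∀ x y : ℝ, y ≠ 0 → ∃ r φ : ℝ, 0 < r ∧ -Real.pi < φ ∧ φ < Real.pi ∧ x = r * Real.cos φ ∧ y = r * Real.sin φ := by
    intro x y hy
    let z : ℂ := ⟨x, y⟩
    have h1 : y = ‖z‖ * Real.sin z.arg := (Complex.norm_mul_sin_arg z).symm
    refine ⟨‖z‖, z.arg, norm_pos_iff.2 ?_, Complex.neg_pi_lt_arg z, lt_of_le_of_ne (Complex.arg_le_pi z) ?_,
      (Complex.norm_mul_cos_arg z).symm, h1⟩
    · intro h; exact hy (congrArg Complex.im h)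
    · intro h; rw [h, Real.sin_pi, mul_zero] at h1; exact hy h1
  obtain ⟨r, θ, hr, h1, h2, h3, h4⟩ := aux c d hd
  obtain ⟨ρ, t, hρ, k1, k2, k3, k4⟩ := aux b r hr.ne'
  refine ⟨ρ, θ, t, hρ, h1, h2, ?_, k2, k3, ?_, ?_⟩
  · by_contra ht
    push Not at ht
    have := Real.sin_nonpos_of_nonpos_of_neg_pi_le ht k1.le
    nlinarith
  · rw [h3, k4]; ring
  · rw [h4, k4]; ring

lemma polar_unique {ρ θ t ρ' θ' t' : ℝ} (hρ : 0 < ρ) (h1 : -Real.pi < θ) (h2 : θ < Real.pi) (ht : 0 < t)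
    (ht2 : t < Real.pi) (hρ' : 0 < ρ') (h1' : -Real.pi ≤ θ') (h2' : θ' ≤ Real.pi) (ht' : 0 ≤ t') (ht2' : t' ≤ Real.pi)
    (e1 : ρ * Real.cos t = ρ' * Real.cos t') (e2 : ρ * (Real.sin t * Real.cos θ) = ρ' * (Real.sin t' * Real.cos θ'))
    (e3 : ρ * (Real.sin t * Real.sin θ) = ρ' * (Real.sin t' * Real.sin θ')) : θ = θ' ∧ t = t' := by
  have hsq : ρ ^ 2 = ρ' ^ 2 := by
    have a1 := Real.sin_sq_add_cos_sq t
    have a2 := Real.sin_sq_add_cos_sq t'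
    have a3 := Real.sin_sq_add_cos_sq θ
    have a4 := Real.sin_sq_add_cos_sq θ'
    have b1 : (ρ * Real.cos t) ^ 2 + (ρ * (Real.sin t * Real.cos θ)) ^ 2 + (ρ * (Real.sin t * Real.sin θ)) ^ 2 = ρ ^ 2 := by
      linear_combination ρ ^ 2 * Real.sin t ^ 2 * a3 + ρ ^ 2 * a1
    have b2 : (ρ' * Real.cos t') ^ 2 + (ρ' * (Real.sin t' * Real.cos θ')) ^ 2 + (ρ' * (Real.sin t' * Real.sin θ')) ^ 2 = ρ' ^ 2 := by
      linear_combination ρ' ^ 2 * Real.sin t' ^ 2 * a4 + ρ' ^ 2 * a2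
    rw [← b1, ← b2, e1, e2, e3]
  have hρe : ρ = ρ' := by nlinarith
  subst hρe
  have htt : t = t' := Real.injOn_cos ⟨ht.le, ht2.le⟩ ⟨ht', ht2'⟩ (mul_left_cancel₀ hρ.ne' e1)
  subst htt
  refine ⟨?_, rfl⟩
  have hs := Real.sin_pos_of_pos_of_lt_pi ht ht2
  have c2 := mul_left_cancel₀ hs.ne' (mul_left_cancel₀ hρ.ne' e2)
  have c3 := mul_left_cancel₀ hs.ne' (mul_left_cancel₀ hρ.ne' e3)
  have : Real.cos (θ - θ') = 1 := by
    rw [Real.cos_sub, c2, c3]; nlinarith [Real.sin_sq_add_cos_sq θ']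
  have := (Real.cos_eq_one_iff_of_lt_of_lt (by linarith) (by linarith)).1 this
  linarith

/-- spherical coordinates -/
def YY (u0 u1 u2 : V4) (p : ℝ × ℝ) : V4 :=
  Real.cos p.2 • u0 + (Real.sin p.2 * Real.cos p.1) • u1 + (Real.sin p.2 * Real.sin p.1) • u2

lemma YY_cont (u0 u1 u2 : V4) : Continuous (YY u0 u1 u2) := by
  unfold YY; fun_prop

def YYd (u0 u1 u2 : V4) (θ t : ℝ) : ℝ × ℝ →L[ℝ] V4 :=
  (ContinuousLinearMap.fst ℝ ℝ ℝ).smulRight ((-(Real.sin t * Real.sin θ)) • u1 + (Real.sin t * Real.cos θ) • u2) +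
  (ContinuousLinearMap.snd ℝ ℝ ℝ).smulRight ((-Real.sin t) • u0 + (Real.cos t * Real.cos θ) • u1 + (Real.cos t * Real.sin θ) • u2)

lemma YY_deriv (u0 u1 u2 : V4) (θ t : ℝ) : HasFDerivAt (YY u0 u1 u2) (YYd u0 u1 u2 θ t) (θ, t) := by
  have ct := (Real.hasDerivAt_cos t).comp_hasFDerivAt (θ, t) (hasFDerivAt_snd (𝕜 := ℝ) (E := ℝ) (F := ℝ))
  have st := (Real.hasDerivAt_sin t).comp_hasFDerivAt (θ, t) (hasFDerivAt_snd (𝕜 := ℝ) (E := ℝ) (F := ℝ))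
  have cθ := (Real.hasDerivAt_cos θ).comp_hasFDerivAt (θ, t) (hasFDerivAt_fst (𝕜 := ℝ) (E := ℝ) (F := ℝ))
  have sθ := (Real.hasDerivAt_sin θ).comp_hasFDerivAt (θ, t) (hasFDerivAt_fst (𝕜 := ℝ) (E := ℝ) (F := ℝ))
  have := ((ct.smul_const u0).add ((st.mul cθ).smul_const u1)).add ((st.mul sθ).smul_const u2)
  refine (this.congr_fderiv ?_)
  apply ContinuousLinearMap.ext
  rintro ⟨a, b⟩
  simp [YYd]
  module

lemma YY_ind {e u0 u1 u2 : V4} (h : Ind4 e u0 u1 u2) {θ t : ℝ} (ht : 0 < t) (ht2 : t < Real.pi) :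
    Ind4 e (YY u0 u1 u2 (θ, t)) (YYd u0 u1 u2 θ t (1, 0)) (YYd u0 u1 u2 θ t (0, 1)) := by
  intro a b c d h0
  have hs := Real.sin_pos_of_pos_of_lt_pi ht ht2
  have a1 := Real.sin_sq_add_cos_sq t
  have a3 := Real.sin_sq_add_cos_sq θ
  obtain ⟨h1, h2, h3, h4⟩ := h a (b * Real.cos t - d * Real.sin t)
    ((b * Real.sin t + d * Real.cos t) * Real.cos θ - c * Real.sin t * Real.sin θ)
    ((b * Real.sin t + d * Real.cos t) * Real.sin θ + c * Real.sin t * Real.cos θ) (by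
      rw [← h0]; simp [YY, YYd]; module)
  have hS : b * Real.sin t + d * Real.cos t = 0 := by
    linear_combination Real.cos θ * h3 + Real.sin θ * h4 - (b * Real.sin t + d * Real.cos t) * a3
  have hc : c * Real.sin t = 0 := by
    linear_combination Real.cos θ * h4 - Real.sin θ * h3 - c * Real.sin t * a3
  refine ⟨h1, ?_, (mul_eq_zero.1 hc).resolve_right hs.ne', ?_⟩
  · linear_combination Real.cos t * h2 + Real.sin t * hS - b * a1
  · linear_combination Real.cos t * hS - Real.sin t * h2 - d * a1

/-- psd node representative -/
def PN (M : V4 →ₗ[ℝ] M4) (x : V4) : Prop := x ≠ 0 ∧ (∀ v : V4, 0 ≤ v ⬝ᵥ (M x *ᵥ v)) ∧ Ker2 (M x)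

lemma quad_e {M : V4 →ₗ[ℝ] M4} {e : V4} (hN : Net M e) (a : ℝ) (v : V4) :
    v ⬝ᵥ (M (a • e) *ᵥ v) = a * (v ⬝ᵥ v) := by
  rw [map_smul, hN.one, smul_mulVec, one_mulVec, dotProduct_smul, smul_eq_mul]

lemma quad_add (M : V4 →ₗ[ℝ] M4) (x y v : V4) :
    v ⬝ᵥ (M (x + y) *ᵥ v) = v ⬝ᵥ (M x *ᵥ v) + v ⬝ᵥ (M y *ᵥ v) := by
  rw [map_add, add_mulVec, dotProduct_add]

lemma quad_smul (M : V4 →ₗ[ℝ] M4) (a : ℝ) (x v : V4) :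
    v ⬝ᵥ (M (a • x) *ᵥ v) = a * (v ⬝ᵥ (M x *ᵥ v)) := by
  rw [map_smul, smul_mulVec, dotProduct_smul, smul_eq_mul]

lemma pn_shift {M : V4 →ₗ[ℝ] M4} {e : V4} (hN : Net M e) {x y : V4} (hx : PN M x) (hy : PN M y) {a b μ : ℝ}
    (ha : 0 < a) (hb : 0 < b) (h : a • x = b • y + μ • e) : μ = 0 := by
  have hq : ∀ v : V4, a * (v ⬝ᵥ (M x *ᵥ v)) = b * (v ⬝ᵥ (M y *ᵥ v)) + μ * (v ⬝ᵥ v) := by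
    intro v
    rw [← quad_smul, h, quad_add, quad_smul, quad_e hN]
  obtain ⟨k, -, hk, -, -, hk0, -⟩ := hx.2.2
  obtain ⟨l, -, hl, -, -, hl0, -⟩ := hy.2.2
  have q1 := hq k
  have q2 := hq l
  rw [hk0, dotProduct_zero, hk] at q1
  rw [hl0, dotProduct_zero, hl] at q2
  have := mul_nonneg hb.le (hy.2.1 k)
  have := mul_nonneg ha.le (hx.2.1 l)
  linarith

lemma pn_not_e {M : V4 →ₗ[ℝ] M4} {e : V4} (hN : Net M e) {x : V4} (hx : PN M x) (a : ℝ) : x ≠ a • e := by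
  intro h
  obtain ⟨k, -, hk, -, -, hk0, -⟩ := hx.2.2
  have := quad_e hN a k
  rw [← h, hk0, dotProduct_zero, hk] at this
  apply hx.1; rw [h, ← mul_one a, ← this, zero_smul]

lemma pn_of_GG {M : V4 →ₗ[ℝ] M4} {e : V4} (hN : Net M e) {y : V4} (hy : ∀ a : ℝ, y ≠ a • e)
    (h : GG (M y) = 0) : PN M (y - lam (M y) • e) := by
  have hM : M (y - lam (M y) • e) = M y - lam (M y) • (1 : M4) := by rw [map_sub, map_smul, hN.one]
  refine ⟨fun h0 => hy _ (sub_eq_zero.1 h0), fun v => ?_, ?_⟩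
  · rw [hM, sub_mulVec, dotProduct_sub, smul_mulVec, one_mulVec, dotProduct_smul, smul_eq_mul]
    linarith [lam_le (hN.symm y) v]
  · rw [hM]
    obtain ⟨w, h1, -, h3⟩ := GG_rank_one (hN.symm y)
    exact h3 (vmv_self_eq_zero.1 (h1.symm.trans h))

lemma ker_of_pn {M : V4 →ₗ[ℝ] M4} {e : V4} (hN : Net M e) {x y : V4} (hx : PN M x) {a ρ : ℝ} (hρ : 0 < ρ)
    (h : x = a • e + ρ • y) : Ker2 (M y - lam (M y) • (1 : M4)) := by
  have hMx : M x = a • (1 : M4) + ρ • M y := by rw [h, map_add, map_smul, map_smul, hN.one]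
  have key : ∀ k : V4, M x *ᵥ k = 0 → M y *ᵥ k = (-a / ρ) • k := by
    intro k hk
    rw [hMx, add_mulVec, smul_mulVec, smul_mulVec, one_mulVec] at hk
    have h2 : M y *ᵥ k = ρ⁻¹ • (ρ • (M y *ᵥ k)) := by rw [smul_smul, inv_mul_cancel₀ hρ.ne', one_smul]
    rw [h2, show ρ • (M y *ᵥ k) = -(a • k) by rw [← sub_eq_zero, ← hk]; module]
    module
  obtain ⟨k, l, hk, hl, hkl, h1, h2⟩ := hx.2.2
  have hlow : Low (M y) (-a / ρ) := by
    refine ⟨fun v => ?_, k, ?_, key k h1⟩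
    · have := hx.2.1 v
      rw [h, quad_add, quad_e hN, quad_smul] at this
      rw [div_mul_eq_mul_div, div_le_iff₀ hρ]
      linarith
    · rintro rfl; simp at hk
  rw [lam_eq (hN.symm y) hlow]
  refine ⟨k, l, hk, hl, hkl, ?_, ?_⟩
  · rw [sub_mulVec, key k h1, smul_mulVec, one_mulVec, sub_self]
  · rw [sub_mulVec, key l h2, smul_mulVec, one_mulVec, sub_self]

lemma even_psd {M : V4 →ₗ[ℝ] M4} {e : V4} (hN : Net M e) {ι : Type} [Fintype ι] (x : ι → V4)
    (hx : ∀ p, PN M (x p)) (hinj : ∀ p q (c : ℝ), x p = c • x q → p = q)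
    (hall : ∀ z, PN M z → ∃ p, ∃ c : ℝ, 0 < c ∧ z = c • x p) : Even (Fintype.card ι) := by
  classical
  rcases isEmpty_or_nonempty ι with hι | ⟨⟨p0⟩⟩
  · simp
  have he : e ≠ 0 := by
    intro h0
    have := hN.one
    rw [h0, map_zero] at this
    exact zero_ne_one this
  obtain ⟨u0, hu0⟩ := avoid (fun pq : ι × ι => ![e, x pq.1, x pq.2])
  replace hu0 : ∀ p q (a b c : ℝ), u0 ≠ a • e + b • x p + c • x q := fun p q a b c => hu0 (p, q) a b c
  obtain ⟨u1, hu1⟩ := avoid (fun p : ι => ![e, u0, x p])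
  replace hu1 : ∀ p (a b c : ℝ), u1 ≠ a • e + b • u0 + c • x p := fun p a b c => hu1 p a b c
  obtain ⟨u2, hu2⟩ := avoid (fun _ : Unit => ![e, u0, u1])
  replace hu2 : ∀ (a b c : ℝ), u2 ≠ a • e + b • u0 + c • u1 := fun a b c => hu2 () a b c
  have hI : Ind4 e u0 u1 u2 := ind4_of he (fun a h => hu0 p0 p0 a 0 0 (by rw [h]; module))
    (fun a b h => hu1 p0 a b 0 (by rw [h]; module)) hu2
  -- polar coordinates of nodes
  have hpol : ∀ p, ∃ lm ρ θ t : ℝ, 0 < ρ ∧ -Real.pi < θ ∧ θ < Real.pi ∧ 0 < t ∧ t < Real.pi ∧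
      x p = lm • e + ρ • YY u0 u1 u2 (θ, t) := by
    intro p
    obtain ⟨a, b, c, d, hxp⟩ := hI.span (x p)
    have hd : d ≠ 0 := by
      rintro rfl
      have hc : c = 0 := by
        by_contra hc
        apply hu1 p (-a / c) (-b / c) (1 / c)
        have : u1 = c⁻¹ • (c • u1) := by rw [smul_smul, inv_mul_cancel₀ hc, one_smul]
        rw [this, show c • u1 = x p - (a • e + b • u0) by rw [hxp]; module]
        module
      subst hc
      have hb : b = 0 := by
        by_contra hb
        apply hu0 p p (-a / b) (1 / b) 0
        have : u0 = b⁻¹ • (b • u0) := by rw [smul_smul, inv_mul_cancel₀ hb, one_smul]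
        rw [this, show b • u0 = x p - (a • e) by rw [hxp]; module]
        module
      subst hb
      exact pn_not_e hN (hx p) a (by rw [hxp]; module)
    obtain ⟨ρ, θ, t, h1, h2, h3, h4, h5, h6, h7, h8⟩ := polar (b := b) (c := c) hd
    refine ⟨a, ρ, θ, t, h1, h2, h3, h4, h5, ?_⟩
    rw [hxp, h6, h7, h8, YY]
    module
  choose lm ρ θ t hρ hθ1 hθ2 ht1 ht2 hxp using hpol
  have hθinj : Function.Injective θ := by
    intro p q hpq
    have hs := Real.sin_pos_of_pos_of_lt_pi (ht1 p) (ht2 p)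
    have hs' := Real.sin_pos_of_pos_of_lt_pi (ht1 q) (ht2 q)
    have htt : t p = t q := by
      by_contra hne
      have hsin : Real.sin (t q - t p) ≠ 0 := by
        intro h0
        have := (Real.sin_eq_zero_iff_of_lt_of_lt (by linarith [ht2 p, ht1 q]) (by linarith [ht2 q, ht1 p])).1 h0
        exact hne (by linarith)
      set D := ρ p * ρ q * Real.sin (t q - t p) with hD
      have hD0 : D ≠ 0 := mul_ne_zero (mul_pos (hρ p) (hρ q)).ne' hsin
      apply hu0 p q (-(ρ q * Real.sin (t q) * lm p - ρ p * Real.sin (t p) * lm q) / D)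
        (ρ q * Real.sin (t q) / D) (-(ρ p * Real.sin (t p)) / D)
      have h1 : u0 = D⁻¹ • (D • u0) := by rw [smul_smul, inv_mul_cancel₀ hD0, one_smul]
      have h2 : D • u0 = (ρ q * Real.sin (t q)) • x p - (ρ p * Real.sin (t p)) • x q -
          (ρ q * Real.sin (t q) * lm p - ρ p * Real.sin (t p) * lm q) • e := by
        rw [hxp p, hxp q, YY, YY, hD, Real.sin_sub, hpq]
        module
      rw [h1, h2]
      module
    have hYY : YY u0 u1 u2 (θ p, t p) = YY u0 u1 u2 (θ q, t q) := by rw [hpq, htt]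
    have h3 : ρ q • x p = ρ p • x q + (ρ q * lm p - ρ p * lm q) • e := by
      rw [hxp p, hxp q, hYY]; module
    have h4 := pn_shift hN (hx p) (hx q) (hρ q) (hρ p) h3
    rw [h4] at h3
    apply hinj p q (ρ p / ρ q)
    have : x p = (ρ q)⁻¹ • (ρ q • x p) := by rw [smul_smul, inv_mul_cancel₀ (hρ q).ne', one_smul]
    rw [this, h3]; module
  -- zeros of G
  have hY : ∀ θ' t', ∀ a : ℝ, YY u0 u1 u2 (θ', t') ≠ a • e := by
    intro θ' t' a h
    obtain ⟨-, h1, h2, h3⟩ := hI (-a) (Real.cos t') (Real.sin t' * Real.cos θ') (Real.sin t' * Real.sin θ') (by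
      rw [← sub_eq_zero] at h; rw [← h, YY]; module)
    have a1 := Real.sin_sq_add_cos_sq t'
    have a3 := Real.sin_sq_add_cos_sq θ'
    have : (0 : ℝ) = 1 := by
      linear_combination (-Real.cos t') * h1 - (Real.sin t' * Real.cos θ') * h2 - (Real.sin t' * Real.sin θ') * h3 + a1 + Real.sin t' ^ 2 * a3
    exact zero_ne_one this
  have hzero : ∀ θ' ∈ Set.Icc (-Real.pi) Real.pi, ∀ t' ∈ Set.Icc 0 Real.pi, GG (M (YY u0 u1 u2 (θ', t'))) = 0 →
      ∃ p, θ p = θ' ∧ t p = t' := by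
    intro θ' hθ' t' ht' h0
    obtain ⟨p, c, hc, hz⟩ := hall _ (pn_of_GG hN (hY θ' t') h0)
    refine ⟨p, ?_⟩
    rw [hxp p] at hz
    set l := lam (M (YY u0 u1 u2 (θ', t')))
    obtain ⟨-, h1, h2, h3⟩ := hI.eq (a := c * lm p) (b := c * ρ p * Real.cos (t p))
      (c := c * ρ p * (Real.sin (t p) * Real.cos (θ p))) (d := c * ρ p * (Real.sin (t p) * Real.sin (θ p)))
      (a' := -l) (b' := 1 * Real.cos t') (c' := 1 * (Real.sin t' * Real.cos θ')) (d' := 1 * (Real.sin t' * Real.sin θ')) (by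
        rw [← sub_eq_zero] at hz ⊢
        rw [← neg_eq_zero, ← hz, YY, YY]; module)
    exact polar_unique (mul_pos hc (hρ p)) (hθ1 p) (hθ2 p) (ht1 p) (ht2 p) one_pos hθ'.1 hθ'.2 ht'.1 ht'.2 h1 h2 h3
  obtain ⟨g0, hg0, -, -⟩ := GG_rank_one (hN.symm u0)
  obtain ⟨g1, hg1, -, -⟩ := GG_rank_one (hN.symm (-u0))
  have hg1n : g1 ≠ 0 := by
    intro h0
    rw [h0, vmv_self_eq_zero.2 rfl] at hg1
    obtain ⟨p, c, hc, hz⟩ := hall _ (pn_of_GG hN (y := -u0)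
      (fun a h => hu0 p0 p0 (-a) 0 0 (by rw [← neg_neg u0, h]; module)) hg1)
    apply hu0 p p (-lam (M (-u0))) (-c) 0
    rw [← sub_eq_zero] at hz ⊢
    rw [← neg_eq_zero, ← hz]; module
  have hMc : Continuous (fun x => M x) := LinearMap.continuous_of_finiteDimensional _
  have hpi := Real.pi_pos
  have := top_parity (G := fun θ t => GG (M (YY u0 u1 u2 (θ, t)))) (g0 := g0) (g1 := g1)
    (continuousOn_univ.1 (GG_cont (fun p => hN.symm (YY u0 u1 u2 p)) (hMc.comp (YY_cont u0 u1 u2)).continuousOn))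
    (fun θ t => by
      obtain ⟨w, hw, -⟩ := GG_rank_one (hN.symm (YY u0 u1 u2 (θ, t)))
      exact ⟨w, hw⟩) hg1n
    (fun θ => by rw [← hg0]; congr 2; simp [YY])
    (fun θ => by rw [← hg1]; congr 2; simp [YY])
    (fun t => by simp [YY]) (Finset.univ.image θ)
    (by
      intro f hf
      obtain ⟨p, -, rfl⟩ := Finset.mem_image.1 hf
      exact ⟨hθ1 p, hθ2 p⟩)
    (by
      intro θ' hθ' t' ht' h0
      obtain ⟨p, h1, -⟩ := hzero θ' hθ' t' ht' h0
      exact Finset.mem_image.2 ⟨p, Finset.mem_univ _, h1⟩)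
    (by
      intro f hf
      obtain ⟨p, -, rfl⟩ := Finset.mem_image.1 hf
      refine ⟨t p, ht1 p, ht2 p, ?_, ?_⟩
      · intro t' ht' h0
        obtain ⟨q, h1, h2⟩ := hzero _ ⟨(hθ1 p).le, (hθ2 p).le⟩ t' ht' h0
        rw [← h2, hθinj h1]
      · exact flip_at hN (YY_deriv u0 u1 u2 (θ p) (t p)) (YY_cont u0 u1 u2)
          (ker_of_pn hN (hx p) (hρ p) (hxp p)) (YY_ind hI (ht1 p) (ht2 p)))
  rwa [Finset.card_image_of_injective _ hθinj, Finset.card_univ] at this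

lemma not_both {M : V4 →ₗ[ℝ] M4} {e : V4} (hN : Net M e) {x : V4} (hx : x ≠ 0) (hK : Ker2 (M x))
    (h : ∀ v : V4, v ⬝ᵥ (M x *ᵥ v) = 0) : False := by
  obtain ⟨U, hU, h0, h1⟩ := ker2_rows (hN.symm x) hK
  have hz : M x = 0 := by
    ext i j
    have a := h (Pi.single i 1 + Pi.single j 1)
    have b := h (Pi.single i 1)
    have c := h (Pi.single j 1)
    have d := symm_swap (hN.symm x) (Pi.single i 1) (Pi.single j 1)
    rw [mulVec_add, dotProduct_add, add_dotProduct, add_dotProduct, b, c, ← d] at a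
    have : (Pi.single i 1 : V4) ⬝ᵥ (M x *ᵥ Pi.single j 1) = M x i j := by simp
    rw [← this, Matrix.zero_apply]; linarith
  have := (hN.trans x hx U hU h0 h1).1
  apply this
  simp [hz]

lemma ker2_neg {A : M4} (h : Ker2 A) : Ker2 (-A) := by
  obtain ⟨k, l, a, b, c, h1, h2⟩ := h
  exact ⟨k, l, a, b, c, by rw [neg_mulVec, h1, neg_zero], by rw [neg_mulVec, h2, neg_zero]⟩

lemma ker2_smul {A : M4} (h : Ker2 A) (r : ℝ) : Ker2 (r • A) := by
  obtain ⟨k, l, a, b, c, h1, h2⟩ := h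
  exact ⟨k, l, a, b, c, by rw [smul_mulVec, h1, smul_zero], by rw [smul_mulVec, h2, smul_zero]⟩

lemma even_m {Q : Fin 4 → M4} (hfin : (realNodes Q).Finite) {M : V4 →ₗ[ℝ] M4} {e : V4} (hN : Net M e)
    (hn : realNodes Q = {p | ∃ x, ∃ hx : x ≠ 0, p = Projectivization.mk ℝ x hx ∧ Ker2 (M x)})
    (hc : ∀ x (hx : x ≠ 0), (Projectivization.mk ℝ x hx ∈ closure (spectra Q) ↔
      (∀ v : V4, 0 ≤ v ⬝ᵥ (M x *ᵥ v)) ∨ (∀ v : V4, v ⬝ᵥ (M x *ᵥ v) ≤ 0))) :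
    Even (realNodes Q ∩ closure (spectra Q)).ncard := by
  classical
  set S := realNodes Q ∩ closure (spectra Q) with hS
  have hfinS : S.Finite := hfin.subset Set.inter_subset_left
  haveI : Fintype S := hfinS.fintype
  have hrep : ∀ p : S, ∃ x, ∃ hx : x ≠ 0, p.1 = Projectivization.mk ℝ x hx ∧ PN M x := by
    rintro ⟨p, hp1, hp2⟩
    rw [hn] at hp1
    obtain ⟨x, hx, rfl, hK⟩ := hp1
    rcases (hc x hx).1 hp2 with h | h
    · exact ⟨x, hx, rfl, hx, h, hK⟩
    · refine ⟨-x, neg_ne_zero.2 hx, ?_, neg_ne_zero.2 hx, ?_, ?_⟩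
      · rw [Projectivization.mk_eq_mk_iff']
        exact ⟨-1, by simp⟩
      · intro v
        rw [map_neg, neg_mulVec, dotProduct_neg]; linarith [h v]
      · rw [map_neg]; exact ker2_neg hK
  choose x hx0 hxp hx using hrep
  have := even_psd hN x hx (fun p q c h => by
      apply Subtype.ext
      rw [hxp p, hxp q, Projectivization.mk_eq_mk_iff']
      exact ⟨c, h.symm⟩)
    (fun z hz => by
      have hzS : Projectivization.mk ℝ z hz.1 ∈ S := by
        refine ⟨?_, (hc z hz.1).2 (Or.inl hz.2.1)⟩
        rw [hn]; exact ⟨z, hz.1, rfl, hz.2.2⟩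
      have h1 := hxp ⟨_, hzS⟩
      rw [Projectivization.mk_eq_mk_iff'] at h1
      obtain ⟨c, hc'⟩ := h1
      refine ⟨⟨_, hzS⟩, c, ?_, hc'.symm⟩
      by_contra hneg
      push Not at hneg
      apply not_both hN hz.1 hz.2.2
      intro v
      apply le_antisymm _ (hz.2.1 v)
      rw [← hc', quad_smul]
      exact mul_nonpos_of_nonpos_of_nonneg hneg ((hx _).2.1 v))
  rwa [← Nat.card_eq_fintype_card, Nat.card_coe_set_eq] at this

section quat
open Quaternion

lemma noncomm_T {A : Type*} [Ring A] {r s i j : A} (hr : r * r = -1) (hs : s * s = -1) (hsr : s * r = -(r * s))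
    (hi : i * i = -1) (hj : j * j = -1) (hij : i * j = -(j * i)) (x : A) :
    -(r * (x - r * x * i - s * x * j + r * s * x * (j * i)) * i) = x - r * x * i - s * x * j + r * s * x * (j * i) ∧
    -(s * (x - r * x * i - s * x * j + r * s * x * (j * i)) * j) = x - r * x * i - s * x * j + r * s * x * (j * i) := by
  have hr' : ∀ y, r * (r * y) = -y := fun y => by rw [← mul_assoc, hr]; simp
  have hs' : ∀ y, s * (s * y) = -y := fun y => by rw [← mul_assoc, hs]; simp
  have hsr' : ∀ y, s * (r * y) = -(r * (s * y)) := fun y => by rw [← mul_assoc, hsr]; simp [mul_assoc]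
  have hj' : ∀ y, j * (j * y) = -y := fun y => by rw [← mul_assoc, hj]; simp
  constructor
  · simp only [mul_add, mul_sub, add_mul, sub_mul, mul_assoc, hr', hi, mul_neg, neg_mul, mul_one, neg_neg]
    abel
  · simp only [mul_add, mul_sub, add_mul, sub_mul, mul_assoc, hs', hsr', hj, hij, hj', mul_neg, neg_mul, mul_one, neg_neg]
    abel

def qi : ℍ[ℝ] := ⟨0, 1, 0, 0⟩
def qj : ℍ[ℝ] := ⟨0, 0, 1, 0⟩

lemma qi_re : qi.re = 0 := rfl
lemma qi_imI : qi.imI = 1 := rfl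
lemma qi_imJ : qi.imJ = 0 := rfl
lemma qi_imK : qi.imK = 0 := rfl
lemma qj_re : qj.re = 0 := rfl
lemma qj_imI : qj.imI = 0 := rfl
lemma qj_imJ : qj.imJ = 1 := rfl
lemma qj_imK : qj.imK = 0 := rfl

lemma qi_sq : qi * qi = -1 := by ext <;> simp [qi_re, qi_imI, qi_imJ, qi_imK, qj_re, qj_imI, qj_imJ, qj_imK]
lemma qj_sq : qj * qj = -1 := by ext <;> simp [qi_re, qi_imI, qi_imJ, qi_imK, qj_re, qj_imI, qj_imJ, qj_imK]
lemma qij : qi * qj = -(qj * qi) := by ext <;> simp [qi_re, qi_imI, qi_imJ, qi_imK, qj_re, qj_imI, qj_imJ, qj_imK]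

lemma quat_sum (r s : ℍ[ℝ])
    (h : ∀ x : ℍ[ℝ], x - r * x * qi - s * x * qj + r * s * x * (qj * qi) = 0) : False := by
  have h0 := h 1
  have h1 := h qi
  have h2 := h qj
  have h3 := h (qi * qj)
  generalize hu : r * s = u at h0 h1 h2 h3
  have a0 := congrArg (fun q : ℍ[ℝ] => q.re) h0
  have a1 := congrArg (fun q : ℍ[ℝ] => q.imI) h1
  have a2 := congrArg (fun q : ℍ[ℝ] => q.imJ) h2
  have a3 := congrArg (fun q : ℍ[ℝ] => q.imK) h3
  simp [qi_re, qi_imI, qi_imJ, qi_imK, qj_re, qj_imI, qj_imJ, qj_imK] at a0 a1 a2 a3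
  linarith

def toH (v : V4) : ℍ[ℝ] := ⟨v 0, v 1, v 2, v 3⟩

lemma toH_cre (v : V4) : (toH v).re = v 0 := rfl
lemma toH_cimI (v : V4) : (toH v).imI = v 1 := rfl
lemma toH_cimJ (v : V4) : (toH v).imJ = v 2 := rfl
lemma toH_cimK (v : V4) : (toH v).imK = v 3 := rfl

lemma toH_cont : Continuous toH := by
  let L : V4 →ₗ[ℝ] ℍ[ℝ] :=
    { toFun := toH
      map_add' := fun v w => by ext <;> simp [toH_cre, toH_cimI, toH_cimJ, toH_cimK]
      map_smul' := fun c w => by ext <;> simp [toH_cre, toH_cimI, toH_cimJ, toH_cimK] }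
  exact L.continuous_of_finiteDimensional

lemma toH_re (v w : V4) : (toH v * star (toH w)).re = v ⬝ᵥ w := by
  simp [toH_cre, toH_cimI, toH_cimJ, toH_cimK, dotProduct, Fin.sum_univ_four]

lemma toH_normSq (v : V4) : normSq (toH v) = v ⬝ᵥ v := by
  rw [Quaternion.normSq_def]; exact toH_re v v

lemma toH_neg (v : V4) : toH (-v) = - toH v := by ext <;> simp [toH_cre, toH_cimI, toH_cimJ, toH_cimK]

/-- imaginary unit attached to two orthogonal vectors -/
def imu (v w : V4) : ℍ[ℝ] := (1 / 2 : ℝ) • (toH v * star (toH w))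

lemma imu_star {v w : V4} (h : v ⬝ᵥ w = 0) : star (imu v w) = - imu v w := by
  rw [Quaternion.star_eq_neg, imu, Quaternion.re_smul, toH_re, h, smul_zero]

lemma imu_sq {v w : V4} (h : v ⬝ᵥ w = 0) (hv : v ⬝ᵥ v = 2) (hw : w ⬝ᵥ w = 2) : imu v w * imu v w = -1 := by
  have h1 : imu v w * star (imu v w) = 1 := by
    rw [Quaternion.self_mul_star, imu, Quaternion.normSq_smul, map_mul, Quaternion.normSq_star, toH_normSq, toH_normSq, hv, hw]
    norm_num
  rw [imu_star h, mul_neg] at h1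
  rw [← neg_eq_iff_eq_neg]; exact h1

lemma imu_anti {v u w : V4} (h : v ⬝ᵥ w = 0) (hu : u ⬝ᵥ w = 0) (hvu : v ⬝ᵥ u = 0) :
    imu u w * imu v w = -(imu v w * imu u w) := by
  have h1 : star (imu v w * imu u w) = imu u w * imu v w := by
    rw [star_mul, imu_star h, imu_star hu]; simp
  have h2 : star (imu v w * imu u w) = -(imu v w * imu u w) := by
    rw [Quaternion.star_eq_neg]
    have : imu v w * imu u w = -(imu v w * star (imu u w)) := by rw [imu_star hu]; simp
    rw [this]
    have h3 : imu v w * star (imu u w) = (1 / 4 * (w ⬝ᵥ w) : ℝ) • (toH v * star (toH u)) := by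
      rw [imu, imu, Quaternion.star_smul, star_mul, star_star, smul_mul_smul_comm]
      have : toH v * star (toH w) * (toH w * star (toH u)) = (w ⬝ᵥ w) • (toH v * star (toH u)) := by
        rw [mul_assoc, ← mul_assoc (star (toH w)), Quaternion.star_mul_self, toH_normSq, Quaternion.coe_mul_eq_smul, mul_smul_comm]
      rw [this, smul_smul]
      norm_num
    rw [h3, Quaternion.re_neg, Quaternion.re_smul, toH_re, hvu]; simp
  rw [← h1, h2]

lemma comm_form {c : ℍ[ℝ]} (h1 : c * qi = qi * c) (h2 : c * qj = -(qj * c)) : c = c.imI • qi := by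
  have a1 := congrArg (fun q : ℍ[ℝ] => q.imJ) h1
  have a2 := congrArg (fun q : ℍ[ℝ] => q.imK) h1
  have a3 := congrArg (fun q : ℍ[ℝ] => q.imJ) h2
  simp [qi_re, qi_imI, qi_imJ, qi_imK, qj_re, qj_imI, qj_imJ, qj_imK] at a1 a2 a3
  ext <;> simp [qi_re, qi_imI, qi_imJ, qi_imK, qj_re, qj_imI, qj_imJ, qj_imK] <;> linarith

lemma quat_contra (p1 p2 q1 : ℂ → V4) (c1 : ContinuousOn p1 (Metric.closedBall 0 1))
    (c2 : ContinuousOn p2 (Metric.closedBall 0 1)) (c3 : ContinuousOn q1 (Metric.closedBall 0 1))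
    (n1 : ∀ z ∈ Metric.closedBall (0 : ℂ) 1, p1 z ⬝ᵥ p1 z = 2) (n2 : ∀ z ∈ Metric.closedBall (0 : ℂ) 1, p2 z ⬝ᵥ p2 z = 2)
    (n3 : ∀ z ∈ Metric.closedBall (0 : ℂ) 1, q1 z ⬝ᵥ q1 z = 2) (o12 : ∀ z ∈ Metric.closedBall (0 : ℂ) 1, p2 z ⬝ᵥ p1 z = 0)
    (o13 : ∀ z ∈ Metric.closedBall (0 : ℂ) 1, q1 z ⬝ᵥ p1 z = 0) (o23 : ∀ z ∈ Metric.closedBall (0 : ℂ) 1, p2 z ⬝ᵥ q1 z = 0)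
    (e1 : ∀ z ∈ Metric.sphere (0 : ℂ) 1, p1 (-z) = p1 z) (e2 : ∀ z ∈ Metric.sphere (0 : ℂ) 1, p2 (-z) = p2 z)
    (e3 : ∀ z ∈ Metric.sphere (0 : ℂ) 1, q1 (-z) = - q1 z) : False := by
  set K := Metric.closedBall (0 : ℂ) 1 with hK
  let r : ℂ → ℍ[ℝ] := fun z => imu (p2 z) (p1 z)
  let s : ℂ → ℍ[ℝ] := fun z => imu (q1 z) (p1 z)
  have ci : ∀ {f g : ℂ → V4}, ContinuousOn f K → ContinuousOn g K → ContinuousOn (fun z => imu (f z) (g z)) K := by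
    intro f g hf hg
    unfold imu
    have h := (toH_cont.comp_continuousOn hf).mul (continuous_star.comp_continuousOn (toH_cont.comp_continuousOn hg))
    exact h.const_smul (1 / 2 : ℝ)
  have hr : ContinuousOn r K := ci c2 c1
  have hs : ContinuousOn s K := ci c3 c1
  let mLR := ContinuousLinearMap.mulLeftRight ℝ ℍ[ℝ]
  let P : ℂ → ℍ[ℝ] →L[ℝ] ℍ[ℝ] := fun z => (1 / 4 : ℝ) • (ContinuousLinearMap.id ℝ ℍ[ℝ] - mLR (r z) qi - mLR (s z) qj
    + mLR (r z * s z) (qj * qi))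
  have hPa : ∀ z x, P z x = (1 / 4 : ℝ) • (x - r z * x * qi - s z * x * qj + r z * s z * x * (qj * qi)) := by
    intro z x; simp [P, mLR]
  have hm : ∀ {f : ℂ → ℍ[ℝ]} (a : ℍ[ℝ]), ContinuousOn f K → ContinuousOn (fun z => mLR (f z) a) K := by
    intro f a hf
    exact (mLR.continuous.comp_continuousOn hf).clm_apply continuousOn_const
  have hrs : ContinuousOn (fun z => r z * s z) K := hr.mul hs
  have hP : ContinuousOn P K := by
    have h := ((continuousOn_const (c := ContinuousLinearMap.id ℝ ℍ[ℝ])).sub (hm qi hr)).sub (hm qj hs) |>.add (hm (qj * qi) hrs)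
    exact h.const_smul (1 / 4 : ℝ)
  have hT : ∀ z ∈ K, ∀ x, -(r z * P z x * qi) = P z x ∧ -(s z * P z x * qj) = P z x := by
    intro z hz x
    have := noncomm_T (imu_sq (o12 z hz) (n2 z hz) (n1 z hz)) (imu_sq (o13 z hz) (n3 z hz) (n1 z hz))
      (imu_anti (o12 z hz) (o13 z hz) (o23 z hz)) qi_sq qj_sq qij x
    rw [hPa]
    constructor
    · rw [mul_smul_comm, smul_mul_assoc, ← smul_neg]
      exact congrArg _ this.1
    · rw [mul_smul_comm, smul_mul_assoc, ← smul_neg]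
      exact congrArg _ this.2
  have hfix : ∀ z x, -(r z * x * qi) = x → -(s z * x * qj) = x → P z x = x := by
    intro z x h1 h2
    have h3 : r z * s z * x * (qj * qi) = x := by
      calc r z * s z * x * (qj * qi) = -(r z * (-(s z * x * qj)) * qi) := by simp [mul_assoc]
        _ = x := by rw [h2, h1]
    rw [hPa, sub_eq_add_neg, sub_eq_add_neg, h1, h2, h3]
    module
  have h0K : (0 : ℂ) ∈ K := by simp [hK]
  obtain ⟨x0, hx0⟩ : ∃ x, P 0 x ≠ 0 := by
    by_contra hcon
    push Not at hcon
    apply quat_sum (r 0) (s 0)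
    intro x
    have := hcon x
    rw [hPa] at this
    exact (smul_eq_zero.1 this).resolve_left (by norm_num)
  have hid : ∀ z ∈ K, ∀ v, P z (P z v) = P z v := fun z hz v => hfix z _ (hT z hz v).1 (hT z hz v).2
  obtain ⟨q, hq, hq'⟩ := exists_section (isCompact_closedBall (0 : ℂ) 1) (convex_closedBall 0 1) P hP hid h0K hx0 (hid 0 h0K x0)
  have hqr : ∀ z ∈ K, r z * q z = q z * qi := by
    intro z hz
    have := (hT z hz (q z)).1
    rw [(hq' z hz).2] at this
    conv_rhs => rw [← this]
    rw [neg_mul, mul_assoc, qi_sq]; simp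
  have hqs : ∀ z ∈ K, s z * q z = q z * qj := by
    intro z hz
    have := (hT z hz (q z)).2
    rw [(hq' z hz).2] at this
    conv_rhs => rw [← this]
    rw [neg_mul, mul_assoc, qj_sq]; simp
  have hsi : star qi = -qi := by ext <;> simp [qi_re, qi_imI, qi_imJ, qi_imK, qj_re, qj_imI, qj_imJ, qj_imK]
  have hsj : star qj = -qj := by ext <;> simp [qi_re, qi_imI, qi_imJ, qi_imK, qj_re, qj_imI, qj_imJ, qj_imK]
  have hqr' : ∀ z ∈ K, star (q z) * r z = qi * star (q z) := by
    intro z hz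
    have := congrArg star (hqr z hz)
    rw [star_mul, star_mul, imu_star (o12 z hz), hsi, mul_neg, neg_mul, neg_inj] at this
    exact this
  have hqs' : ∀ z ∈ K, star (q z) * s z = qj * star (q z) := by
    intro z hz
    have := congrArg star (hqs z hz)
    rw [star_mul, star_mul, imu_star (o13 z hz), hsj, mul_neg, neg_mul, neg_inj] at this
    exact this
  have hSK : Metric.sphere (0 : ℂ) 1 ⊆ K := Metric.sphere_subset_closedBall
  have hnS : ∀ z ∈ Metric.sphere (0 : ℂ) 1, -z ∈ Metric.sphere (0 : ℂ) 1 := by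
    intro z hz; simpa using hz
  let c : ℂ → ℍ[ℝ] := fun z => star (q z) * q (-z)
  have hc1 : ∀ z ∈ Metric.sphere (0 : ℂ) 1, c z * qi = qi * c z := by
    intro z hz
    have h1 : r (-z) = r z := by simp only [r]; rw [e1 z hz, e2 z hz]
    calc star (q z) * q (-z) * qi = star (q z) * (r z * q (-z)) := by
          rw [mul_assoc, ← hqr _ (hSK (hnS z hz)), h1]
      _ = qi * (star (q z) * q (-z)) := by rw [← mul_assoc, hqr' z (hSK hz), mul_assoc]
  have hc2 : ∀ z ∈ Metric.sphere (0 : ℂ) 1, c z * qj = -(qj * c z) := by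
    intro z hz
    have h1 : s (-z) = - s z := by simp only [s]; rw [e1 z hz, e3 z hz, imu, imu, toH_neg, neg_mul, smul_neg]
    calc star (q z) * q (-z) * qj = star (q z) * (- s z * q (-z)) := by
          rw [mul_assoc, ← hqs _ (hSK (hnS z hz)), h1]
      _ = -(qj * (star (q z) * q (-z))) := by rw [neg_mul, mul_neg, ← mul_assoc, hqs' z (hSK hz), mul_assoc]
  have hc0 : ∀ z ∈ Metric.sphere (0 : ℂ) 1, (c z).imI ≠ 0 := by
    intro z hz h0
    have h1 := comm_form (hc1 z hz) (hc2 z hz)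
    rw [h0, zero_smul] at h1
    rcases mul_eq_zero.1 h1 with h | h
    · exact (hq' z (hSK hz)).1 (star_eq_zero.1 h)
    · exact (hq' _ (hSK (hnS z hz))).1 h
  have hcc : ContinuousOn (fun z => (c z).imI) (Metric.sphere (0 : ℂ) 1) := by
    refine Quaternion.continuous_imI.comp_continuousOn ?_
    refine ContinuousOn.mul (continuous_star.comp_continuousOn (hq.mono hSK)) ?_
    exact hq.comp continuous_neg.continuousOn (fun z hz => hSK (hnS z hz))
  have hconn : IsPreconnected (Metric.sphere (0 : ℂ) 1) :=
    isPreconnected_sphere (by rw [Complex.rank_real_complex]; norm_num) 0 1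
  have h1S : (1 : ℂ) ∈ Metric.sphere (0 : ℂ) 1 := by simp
  have hpos := const_sign hconn hcc hc0 h1S (hnS 1 h1S)
  have hneg : c (-1) = star (c 1) := by simp [c]
  rw [hneg] at hpos
  simp at hpos
  nlinarith [mul_self_nonneg (c 1).imI]
end quat

lemma eig_orth {H : M4} (hH : H.IsSymm) {k l : V4} {a b : ℝ} (hk : H *ᵥ k = a • k) (hl : H *ᵥ l = b • l)
    (hab : a ≠ b) : k ⬝ᵥ l = 0 := by
  have h := symm_swap hH l k
  rw [hk, hl, dotProduct_smul, dotProduct_smul, dotProduct_comm l k, smul_eq_mul, smul_eq_mul] at h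
  have : (a - b) * (k ⬝ᵥ l) = 0 := by linear_combination h
  exact (mul_eq_zero.1 this).resolve_left (sub_ne_zero.2 hab)

lemma ker2_of_eig {H : M4} {k l : V4} {a : ℝ} (hk1 : k ⬝ᵥ k = 1) (hl1 : l ⬝ᵥ l = 1) (hkl : k ⬝ᵥ l = 0)
    (hk : H *ᵥ k = a • k) (hl : H *ᵥ l = a • l) : Ker2 (H - a • (1 : M4)) :=
  ⟨k, l, hk1, hl1, hkl, by rw [sub_mulVec, hk, smul_mulVec, one_mulVec, sub_self],
    by rw [sub_mulVec, hl, smul_mulVec, one_mulVec, sub_self]⟩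

lemma eig_of_ker {H : M4} {k : V4} {a : ℝ} (h : (H - a • (1 : M4)) *ᵥ k = 0) : H *ᵥ k = a • k := by
  rw [sub_mulVec, smul_mulVec, one_mulVec, sub_eq_zero] at h; exact h

lemma simple_par {H : M4} {a : ℝ} (hs : ¬ Ker2 (H - a • (1 : M4))) {k l : V4} (hk1 : k ⬝ᵥ k = 1) (hl1 : l ⬝ᵥ l = 1)
    (hk : H *ᵥ k = a • k) (hl : H *ᵥ l = a • l) : l = k ∨ l = -k := by
  set c := k ⬝ᵥ l with hc
  set w := l - c • k with hw
  have hlk : l ⬝ᵥ k = c := by rw [dotProduct_comm]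
  have hw0 : w = 0 := by
    by_contra hne
    have hp := dot_pos hne
    set n := (Real.sqrt (w ⬝ᵥ w))⁻¹ with hn
    have hn2 : n * n * (w ⬝ᵥ w) = 1 := by
      have h1 := Real.mul_self_sqrt hp.le
      have h2 := (Real.sqrt_pos.2 hp).ne'
      rw [hn]
      nth_rewrite 3 [← h1]
      field_simp
    apply hs
    refine ker2_of_eig (k := k) (l := n • w) hk1 ?_ ?_ hk ?_
    · rw [smul_dotProduct, dotProduct_smul, smul_eq_mul, smul_eq_mul, ← mul_assoc, hn2]
    · rw [dotProduct_smul, hw, dotProduct_sub, dotProduct_smul, hk1, ← hc]; simp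
    · rw [mulVec_smul, hw, mulVec_sub, mulVec_smul, hk, hl]; module
  have hlc : l = c • k := by rw [← sub_eq_zero]; exact hw0
  have hcc : c * c = 1 := by
    rw [hlc, smul_dotProduct, dotProduct_smul, hk1] at hl1
    simpa using hl1
  rcases mul_self_eq_one_iff.1 hcc with h | h
  · left; rw [hlc, h, one_smul]
  · right; rw [hlc, h, neg_one_smul]

lemma low_attained {H : M4} (hH : H.IsSymm) {k : V4} (h : k ⬝ᵥ (H *ᵥ k) = lam H * (k ⬝ᵥ k)) : H *ᵥ k = lam H • k := by
  apply eig_of_ker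
  set B := H - lam H • (1 : M4) with hB
  have hBs : B.IsSymm := sub_symm hH _
  have hq : ∀ v : V4, v ⬝ᵥ (B *ᵥ v) = v ⬝ᵥ (H *ᵥ v) - lam H * (v ⬝ᵥ v) := by
    intro v; rw [hB, sub_mulVec, dotProduct_sub, smul_mulVec, one_mulVec, dotProduct_smul, smul_eq_mul]
  have hnn : ∀ v : V4, 0 ≤ v ⬝ᵥ (B *ᵥ v) := fun v => by rw [hq]; linarith [lam_le hH v]
  have h0 : k ⬝ᵥ (B *ᵥ k) = 0 := by rw [hq, h, sub_self]
  set w := B *ᵥ k with hw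
  by_contra hne
  have hp := dot_pos hne
  set C := w ⬝ᵥ (B *ᵥ w) with hC
  have hC0 : 0 ≤ C := hnn w
  have hsw : k ⬝ᵥ (B *ᵥ w) = w ⬝ᵥ w := by rw [symm_swap hBs]
  have key : ∀ t : ℝ, 0 ≤ -2 * t * (w ⬝ᵥ w) + t * t * C := by
    intro t
    have := hnn (k + (-t) • w)
    rw [mulVec_add, mulVec_smul, dotProduct_add, add_dotProduct, add_dotProduct, dotProduct_smul, dotProduct_smul,
      smul_dotProduct, smul_dotProduct, ← hw, h0, hsw, ← hC] at this
    simp only [smul_eq_mul] at this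
    linarith
  have := key ((w ⬝ᵥ w) / (C + 1))
  have hC1 : 0 < C + 1 := by linarith
  have e1 : -2 * ((w ⬝ᵥ w) / (C + 1)) * (w ⬝ᵥ w) + (w ⬝ᵥ w) / (C + 1) * ((w ⬝ᵥ w) / (C + 1)) * C
      = -(((w ⬝ᵥ w) / (C + 1)) ^ 2 * (C + 2)) := by
    field_simp; ring
  rw [e1] at this
  have : 0 < ((w ⬝ᵥ w) / (C + 1)) ^ 2 * (C + 2) := by positivity
  linarith

/-- simple spectrum -/
def Simp (H : M4) : Prop := ∀ a : ℝ, ¬ Ker2 (H - a • (1 : M4))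

lemma Simp.neg {H : M4} (h : Simp H) : Simp (-H) := by
  intro a hK
  apply h (-a)
  have := ker2_neg hK
  rwa [show -(-H - a • (1 : M4)) = H - (-a) • (1 : M4) by rw [neg_sub, neg_smul]; abel] at this

lemma low_lift {K : Set ℂ} (hK : IsCompact K) (hconv : Convex ℝ K) {H : ℂ → M4} (hs : ∀ z, (H z).IsSymm)
    (hc : ContinuousOn H K) (h : ∀ z ∈ K, ¬ Ker2 (H z - lam (H z) • (1 : M4))) :
    ∃ v : ℂ → V4, ContinuousOn v K ∧ ∀ z ∈ K, v z ⬝ᵥ v z = 1 ∧ H z *ᵥ v z = lam (H z) • v z := by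
  have hw : ∀ z, ∃ w : V4, GG (H z) = vecMulVec w w ∧ H z *ᵥ w = lam (H z) • w ∧ (w = 0 → Ker2 (H z - lam (H z) • 1)) :=
    fun z => GG_rank_one (hs z)
  obtain ⟨v, hv, hv'⟩ := exists_lift hK hconv (fun z => GG (H z)) (GG_cont hs hc) (fun z hz => by
    obtain ⟨w, h1, h2, h3⟩ := hw z
    exact ⟨w, fun h0 => h z hz (h3 h0), h1⟩)
  have hE : ∀ z ∈ K, v z ≠ 0 ∧ H z *ᵥ v z = lam (H z) • v z := by
    intro z hz
    obtain ⟨w, h1, h2, h3⟩ := hw z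
    have hw0 : w ≠ 0 := fun h0 => h z hz (h3 h0)
    rcases vmv_eq ((hv' z hz).trans h1) with h4 | h4
    · rw [h4]; exact ⟨hw0, h2⟩
    · rw [h4]; refine ⟨neg_ne_zero.2 hw0, ?_⟩
      rw [mulVec_neg, h2, smul_neg]
  refine ⟨fun z => (Real.sqrt (v z ⬝ᵥ v z))⁻¹ • v z, ?_, ?_⟩
  · refine ContinuousOn.smul (ContinuousOn.inv₀ (Real.continuous_sqrt.comp_continuousOn (cont_dot hv hv)) ?_) hv
    intro z hz
    exact (Real.sqrt_pos.2 (dot_pos (hE z hz).1)).ne'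
  · intro z hz
    have hp := dot_pos (hE z hz).1
    constructor
    · rw [smul_dotProduct, dotProduct_smul, smul_eq_mul, smul_eq_mul]
      have h1 := Real.mul_self_sqrt hp.le
      have h2 := (Real.sqrt_pos.2 hp).ne'
      nth_rewrite 3 [← h1]
      field_simp
    · rw [mulVec_smul, (hE z hz).2, smul_comm]

def DD (s : ℝ) (v w : V4) : M4 := s • (vecMulVec v v + vecMulVec w w)

lemma vmv_symm (v : V4) : (vecMulVec v v).IsSymm := by
  ext i j; simp [vecMulVec_apply, mul_comm]

lemma DD_symm (s : ℝ) (v w : V4) : (DD s v w).IsSymm := ((vmv_symm v).add (vmv_symm w)).smul s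

lemma DD_mulVec (s : ℝ) (v w k : V4) : DD s v w *ᵥ k = (s * (v ⬝ᵥ k)) • v + (s * (w ⬝ᵥ k)) • w := by
  have h : ∀ u : V4, vecMulVec u u *ᵥ k = (u ⬝ᵥ k) • u := by
    intro u; ext i; simp only [mulVec, vecMulVec_apply, dotProduct, Pi.smul_apply, smul_eq_mul, Finset.sum_mul]
    exact Finset.sum_congr rfl fun j _ => by ring
  rw [DD, smul_mulVec, add_mulVec, h, h]; module

/-- double deflation -/
lemma defl {H : M4} (hH : H.IsSymm) {v w : V4} {a b s : ℝ} (hv : v ⬝ᵥ v = 1) (hw : w ⬝ᵥ w = 1)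
    (hvw : v ⬝ᵥ w = 0) (hHv : H *ᵥ v = a • v) (hHw : H *ᵥ w = b • w) (hub : ∀ u : V4, u ⬝ᵥ (H *ᵥ u) ≤ b * (u ⬝ᵥ u))
    (hs : 0 < s) (hsa : b < a + s) :
    ∀ k : V4, (H + DD s v w) *ᵥ k = lam (H + DD s v w) • k →
      v ⬝ᵥ k = 0 ∧ w ⬝ᵥ k = 0 ∧ H *ᵥ k = lam (H + DD s v w) • k := by
  intro k hk
  set l := lam (H + DD s v w) with hl
  have hsy : (H + DD s v w).IsSymm := hH.add (DD_symm s v w)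
  have hwv : w ⬝ᵥ v = 0 := by rw [dotProduct_comm]; exact hvw
  obtain ⟨U, hU, hU0, hU1⟩ := ortho_ext hv hw hvw
  set u := U *ᵥ (Pi.single 2 1 : V4) with hu
  have hUd : ∀ i j : Fin 4, (U *ᵥ (Pi.single i 1 : V4)) ⬝ᵥ (U *ᵥ (Pi.single j 1 : V4)) = (1 : M4) i j := by
    intro i j
    have := conj_entry (1 : M4) U i j
    rw [mul_one, hU, one_mulVec] at this
    exact this.symm
  have hlb : l ≤ b := by
    have h1 := lam_le hsy u
    have huu : u ⬝ᵥ u = 1 := by rw [hu, hUd]; simp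
    have hvu : v ⬝ᵥ u = 0 := by rw [hu, ← hU0, hUd]; simp
    have hwu : w ⬝ᵥ u = 0 := by rw [hu, ← hU1, hUd]; simp
    rw [add_mulVec, DD_mulVec, hvu, hwu, huu] at h1
    have := hub u
    rw [huu] at this
    simp at h1
    linarith
  have e1 : (H + DD s v w) *ᵥ v = (a + s) • v := by
    rw [add_mulVec, DD_mulVec, hHv, hv, hwv]; module
  have e2 : (H + DD s v w) *ᵥ w = (b + s) • w := by
    rw [add_mulVec, DD_mulVec, hHw, hw, hvw]; module
  have o1 := eig_orth hsy e1 hk (by linarith)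
  have o2 := eig_orth hsy e2 hk (by linarith)
  refine ⟨o1, o2, ?_⟩
  rw [add_mulVec, DD_mulVec, o1, o2] at hk
  rw [← hk]; module

lemma defl_simple {H : M4} (hH : H.IsSymm) (hS : Simp H) {v w : V4} {a b s : ℝ} (hv : v ⬝ᵥ v = 1) (hw : w ⬝ᵥ w = 1)
    (hvw : v ⬝ᵥ w = 0) (hHv : H *ᵥ v = a • v) (hHw : H *ᵥ w = b • w) (hub : ∀ u : V4, u ⬝ᵥ (H *ᵥ u) ≤ b * (u ⬝ᵥ u))
    (hs : 0 < s) (hsa : b < a + s) : ¬ Ker2 (H + DD s v w - lam (H + DD s v w) • (1 : M4)) := by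
  rintro ⟨k, l, hk1, hl1, hkl, hk, hl⟩
  have hd := defl hH hv hw hvw hHv hHw hub hs hsa
  exact hS _ (ker2_of_eig hk1 hl1 hkl (hd k (eig_of_ker hk)).2.2 (hd l (eig_of_ker hl)).2.2)

/-- the two middle eigenvectors are orthogonal -/
lemma mid_orth {H : M4} (hH : H.IsSymm) (hS : Simp H) {v w k l : V4} {s : ℝ} (hv : v ⬝ᵥ v = 1) (hw : w ⬝ᵥ w = 1)
    (hvw : v ⬝ᵥ w = 0) (hk : H *ᵥ k = lam (H + DD s v w) • k) (hl : -H *ᵥ l = lam (-H + DD s v w) • l) :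
    k ⬝ᵥ l = 0 := by
  have hl' : H *ᵥ l = (-lam (-H + DD s v w)) • l := by
    rw [neg_smul, ← hl, neg_mulVec, neg_neg]
  by_cases hne : lam (H + DD s v w) = -lam (-H + DD s v w)
  swap
  · exact eig_orth hH hk hl' hne
  exfalso
  obtain ⟨U, hU, hU0, hU1⟩ := ortho_ext hv hw hvw
  have hUd : ∀ i j : Fin 4, (U *ᵥ (Pi.single i 1 : V4)) ⬝ᵥ (U *ᵥ (Pi.single j 1 : V4)) = (1 : M4) i j := by
    intro i j
    have := conj_entry (1 : M4) U i j
    rw [mul_one, hU, one_mulVec] at this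
    exact this.symm
  have hsy : (H + DD s v w).IsSymm := hH.add (DD_symm s v w)
  have hsy' : (-H + DD s v w).IsSymm := hH.neg.add (DD_symm s v w)
  have key : ∀ u : V4, v ⬝ᵥ u = 0 → w ⬝ᵥ u = 0 → H *ᵥ u = lam (H + DD s v w) • u := by
    intro u h1 h2
    have hD : DD s v w *ᵥ u = 0 := by rw [DD_mulVec, h1, h2]; simp
    have a1 := lam_le hsy u
    have a2 := lam_le hsy' u
    have h3 : (H + DD s v w) *ᵥ u = lam (H + DD s v w) • u := by
      apply low_attained hsy
      rw [add_mulVec, hD, add_zero] at a1 a2 ⊢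
      rw [neg_mulVec, dotProduct_neg] at a2
      rw [hne] at a1 ⊢
      linarith
    rwa [add_mulVec, hD, add_zero] at h3
  apply hS (lam (H + DD s v w))
  refine ker2_of_eig (k := U *ᵥ (Pi.single 2 1 : V4)) (l := U *ᵥ (Pi.single 3 1 : V4)) ?_ ?_ ?_ (key _ ?_ ?_) (key _ ?_ ?_)
  · rw [hUd]; simp
  · rw [hUd]; simp
  · rw [hUd]; simp
  · rw [← hU0, hUd]; simp
  · rw [← hU1, hUd]; simp
  · rw [← hU0, hUd]; simp
  · rw [← hU1, hUd]; simp

lemma ends_ne {H : M4} (hH : H.IsSymm) (hS : Simp H) : lam H < -lam (-H) := by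
  have hq : ∀ v : V4, v ⬝ᵥ (H *ᵥ v) ≤ -lam (-H) * (v ⬝ᵥ v) := by
    intro v
    have := lam_le hH.neg v
    rw [neg_mulVec, dotProduct_neg] at this
    linarith
  by_contra hcon
  push Not at hcon
  have key : ∀ v : V4, H *ᵥ v = lam H • v := by
    intro v
    apply low_attained hH
    have h1 := hq v
    have h2 := lam_le hH v
    have h3 := mul_le_mul_of_nonneg_right hcon (dot_nn v)
    linarith
  exact hS _ (ker2_of_eig (k := Pi.single 0 1) (l := Pi.single 1 1) (by simp) (by simp) (by simp) (key _) (key _))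

/-- a sign relation is constant along a connected set -/
lemma sign_const {S : Set ℂ} (hS : IsPreconnected S) {f g : ℂ → V4} (hf : ContinuousOn f S) (hg : ContinuousOn g S)
    (hg1 : ∀ z ∈ S, g z ⬝ᵥ g z = 1) (h : ∀ z ∈ S, f z = g z ∨ f z = - g z) :
    ∃ a : ℝ, a * a = 1 ∧ ∀ z ∈ S, f z = a • g z := by
  by_cases hall : ∀ z ∈ S, f z = g z
  · exact ⟨1, by norm_num, fun z hz => by rw [hall z hz, one_smul]⟩
  · push Not at hall
    obtain ⟨z0, hz0, hne⟩ := hall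
    refine ⟨-1, by norm_num, fun z hz => ?_⟩
    have hg0 : ∀ z ∈ S, g z ≠ 0 := by
      intro z hz h0
      have := hg1 z hz
      rw [h0] at this; simp at this
    have := lift_unique (w := fun z => - g z) hS hf hg.neg (fun z hz h0 => by
      rcases h z hz with h1 | h1
      · exact hg0 z hz (h1 ▸ h0)
      · rw [h1] at h0; exact hg0 z hz (neg_eq_zero.1 h0)) (fun z hz => by
      rcases h z hz with h1 | h1
      · right; rw [h1, neg_neg]
      · left; exact h1) hz0 ((h z0 hz0).resolve_left hne) z hz
    rw [this, neg_one_smul]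

lemma DD_comm (s : ℝ) (v w : V4) : DD s v w = DD s w v := by rw [DD, DD, add_comm]

lemma DD_cont {K : Set ℂ} {s : ℂ → ℝ} {v w : ℂ → V4} (hs : ContinuousOn s K) (hv : ContinuousOn v K)
    (hw : ContinuousOn w K) : ContinuousOn (fun z => DD (s z) (v z) (w z)) K := by
  have h : ∀ {u : ℂ → V4}, ContinuousOn u K → ContinuousOn (fun z => vecMulVec (u z) (u z)) K := by
    intro u hu
    exact (Continuous.matrix_vecMulVec continuous_id continuous_id :
      Continuous fun v : V4 => vecMulVec v v).comp_continuousOn hu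
  exact hs.smul ((h hv).add (h hw))

lemma no_family {A : ℂ → M4} (hs : ∀ z, (A z).IsSymm) (hc : ContinuousOn A (Metric.closedBall 0 1))
    (hS : ∀ z ∈ Metric.closedBall (0 : ℂ) 1, Simp (A z)) (hneg : ∀ z ∈ Metric.sphere (0 : ℂ) 1, A (-z) = - A z) : False := by
  set K := Metric.closedBall (0 : ℂ) 1 with hK
  have hKc : IsCompact K := isCompact_closedBall _ _
  have hKv : Convex ℝ K := convex_closedBall _ _
  have hSK : Metric.sphere (0 : ℂ) 1 ⊆ K := Metric.sphere_subset_closedBall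
  have hnS : ∀ z ∈ Metric.sphere (0 : ℂ) 1, -z ∈ Metric.sphere (0 : ℂ) 1 := by
    intro z hz; simpa using hz
  have hconn : IsPreconnected (Metric.sphere (0 : ℂ) 1) :=
    isPreconnected_sphere (by rw [Complex.rank_real_complex]; norm_num) 0 1
  have hs' : ∀ z, (-A z).IsSymm := fun z => (hs z).neg
  have hc' : ContinuousOn (fun z => -A z) K := hc.neg
  obtain ⟨v1, hv1, hv1'⟩ := low_lift hKc hKv hs hc (fun z hz => hS z hz _)
  obtain ⟨v4, hv4, hv4'⟩ := low_lift hKc hKv hs' hc' (fun z hz => (hS z hz).neg _)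
  have E4 : ∀ z ∈ K, A z *ᵥ v4 z = (-lam (-A z)) • v4 z := by
    intro z hz
    have := (hv4' z hz).2
    rw [neg_smul, ← this, neg_mulVec, neg_neg]
  have E1 : ∀ z ∈ K, (-A z) *ᵥ v1 z = (-lam (A z)) • v1 z := by
    intro z hz
    rw [neg_mulVec, (hv1' z hz).2, neg_smul]
  have o14 : ∀ z ∈ K, v1 z ⬝ᵥ v4 z = 0 := by
    intro z hz
    exact eig_orth (hs z) (hv1' z hz).2 (E4 z hz) (ends_ne (hs z) (hS z hz)).ne
  have o41 : ∀ z ∈ K, v4 z ⬝ᵥ v1 z = 0 := fun z hz => by rw [dotProduct_comm]; exact o14 z hz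
  let s : ℂ → ℝ := fun z => -lam (-A z) - lam (A z) + 1
  have hsc : ContinuousOn s K := ((lam_cont hs' hc').neg.sub (lam_cont hs hc)).add continuousOn_const
  have hs0 : ∀ z ∈ K, 0 < s z := by
    intro z hz; have := ends_ne (hs z) (hS z hz); simp only [s]; linarith
  let D : ℂ → M4 := fun z => DD (s z) (v1 z) (v4 z)
  have hDc : ContinuousOn D K := DD_cont hsc hv1 hv4
  have ub1 : ∀ z, ∀ u : V4, u ⬝ᵥ (A z *ᵥ u) ≤ -lam (-A z) * (u ⬝ᵥ u) := by
    intro z u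
    have := lam_le (hs' z) u
    rw [neg_mulVec, dotProduct_neg] at this
    linarith
  have ub2 : ∀ z, ∀ u : V4, u ⬝ᵥ (-A z *ᵥ u) ≤ -lam (A z) * (u ⬝ᵥ u) := by
    intro z u
    have := lam_le (hs z) u
    rw [neg_mulVec, dotProduct_neg]
    linarith
  have hH2 : ∀ z, (A z + D z).IsSymm := fun z => (hs z).add (DD_symm _ _ _)
  have hH3 : ∀ z, (-A z + D z).IsSymm := fun z => (hs' z).add (DD_symm _ _ _)
  have d2 : ∀ z ∈ K, ∀ k : V4, (A z + D z) *ᵥ k = lam (A z + D z) • k →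
      v1 z ⬝ᵥ k = 0 ∧ v4 z ⬝ᵥ k = 0 ∧ A z *ᵥ k = lam (A z + D z) • k := fun z hz =>
    defl (hs z) (hv1' z hz).1 (hv4' z hz).1 (o14 z hz) (hv1' z hz).2 (E4 z hz) (ub1 z) (hs0 z hz)
      (by simp only [s]; linarith)
  have S2 : ∀ z ∈ K, ¬ Ker2 (A z + D z - lam (A z + D z) • (1 : M4)) := fun z hz =>
    defl_simple (hs z) (hS z hz) (hv1' z hz).1 (hv4' z hz).1 (o14 z hz) (hv1' z hz).2 (E4 z hz) (ub1 z) (hs0 z hz)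
      (by simp only [s]; linarith)
  have d3 : ∀ z ∈ K, ∀ k : V4, (-A z + D z) *ᵥ k = lam (-A z + D z) • k →
      v4 z ⬝ᵥ k = 0 ∧ v1 z ⬝ᵥ k = 0 ∧ -A z *ᵥ k = lam (-A z + D z) • k := by
    intro z hz
    have hD : D z = DD (s z) (v4 z) (v1 z) := DD_comm _ _ _
    rw [hD]
    exact defl (hs' z) (hv4' z hz).1 (hv1' z hz).1 (o41 z hz) (hv4' z hz).2 (E1 z hz) (ub2 z) (hs0 z hz)
      (by simp only [s]; linarith)
  have S3 : ∀ z ∈ K, ¬ Ker2 (-A z + D z - lam (-A z + D z) • (1 : M4)) := by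
    intro z hz
    have hD : D z = DD (s z) (v4 z) (v1 z) := DD_comm _ _ _
    rw [hD]
    exact defl_simple (hs' z) (hS z hz).neg (hv4' z hz).1 (hv1' z hz).1 (o41 z hz) (hv4' z hz).2 (E1 z hz) (ub2 z) (hs0 z hz)
      (by simp only [s]; linarith)
  obtain ⟨v2, hv2, hv2'⟩ := low_lift hKc hKv hH2 (hc.add hDc) S2
  obtain ⟨v3, hv3, hv3'⟩ := low_lift hKc hKv hH3 (hc'.add hDc) S3
  have o12 : ∀ z ∈ K, v1 z ⬝ᵥ v2 z = 0 := fun z hz => (d2 z hz _ (hv2' z hz).2).1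
  have o42 : ∀ z ∈ K, v4 z ⬝ᵥ v2 z = 0 := fun z hz => (d2 z hz _ (hv2' z hz).2).2.1
  have o43 : ∀ z ∈ K, v4 z ⬝ᵥ v3 z = 0 := fun z hz => (d3 z hz _ (hv3' z hz).2).1
  have o13 : ∀ z ∈ K, v1 z ⬝ᵥ v3 z = 0 := fun z hz => (d3 z hz _ (hv3' z hz).2).2.1
  have o23 : ∀ z ∈ K, v2 z ⬝ᵥ v3 z = 0 := fun z hz =>
    mid_orth (s := s z) (hs z) (hS z hz) (hv1' z hz).1 (hv4' z hz).1 (o14 z hz) (d2 z hz _ (hv2' z hz).2).2.2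
      (d3 z hz _ (hv3' z hz).2).2.2
  -- antipodal relations
  have r14 : ∀ z ∈ Metric.sphere (0 : ℂ) 1, v1 (-z) = v4 z ∨ v1 (-z) = - v4 z := by
    intro z hz
    have h1 := hv1' _ (hSK (hnS z hz))
    rw [hneg z hz] at h1
    exact simple_par ((hS z (hSK hz)).neg _) (hv4' z (hSK hz)).1 h1.1 (hv4' z (hSK hz)).2 h1.2
  have vv : ∀ {u w : V4}, (u = w ∨ u = -w) → vecMulVec u u = vecMulVec w w := by
    rintro u w (rfl | rfl)
    · rfl
    · ext i j; simp [vecMulVec_apply]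
  have r14' : ∀ z ∈ Metric.sphere (0 : ℂ) 1, v4 (-z) = v1 z ∨ v4 (-z) = - v1 z := by
    intro z hz
    have := r14 _ (hnS z hz)
    rw [neg_neg] at this
    rcases this with h | h
    · left; exact h.symm
    · right; rw [h, neg_neg]
  have rD : ∀ z ∈ Metric.sphere (0 : ℂ) 1, D (-z) = D z := by
    intro z hz
    have : s (-z) = s z := by simp only [s]; rw [hneg z hz, neg_neg]; ring
    simp only [D, DD]
    rw [this, vv (r14 z hz), vv (r14' z hz), add_comm]
  have r23 : ∀ z ∈ Metric.sphere (0 : ℂ) 1, v2 (-z) = v3 z ∨ v2 (-z) = - v3 z := by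
    intro z hz
    have h1 := hv2' _ (hSK (hnS z hz))
    rw [hneg z hz, rD z hz] at h1
    exact simple_par (S3 z (hSK hz)) (hv3' z (hSK hz)).1 h1.1 (hv3' z (hSK hz)).2 h1.2
  have cn : ∀ {f : ℂ → V4}, ContinuousOn f K → ContinuousOn (fun z => f (-z)) (Metric.sphere (0 : ℂ) 1) := by
    intro f hf
    exact hf.comp continuous_neg.continuousOn (fun z hz => hSK (hnS z hz))
  obtain ⟨a, ha, ha'⟩ := sign_const hconn (cn hv1) (hv4.mono hSK) (fun z hz => (hv4' z (hSK hz)).1) r14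
  obtain ⟨b, hb, hb'⟩ := sign_const hconn (cn hv2) (hv3.mono hSK) (fun z hz => (hv3' z (hSK hz)).1) r23
  have ha'' : ∀ z ∈ Metric.sphere (0 : ℂ) 1, v4 (-z) = a • v1 z := by
    intro z hz
    have := ha' _ (hnS z hz)
    rw [neg_neg] at this
    rw [this, smul_smul, ha, one_smul]
  have hb'' : ∀ z ∈ Metric.sphere (0 : ℂ) 1, v3 (-z) = b • v2 z := by
    intro z hz
    have := hb' _ (hnS z hz)
    rw [neg_neg] at this
    rw [this, smul_smul, hb, one_smul]
  have o21 : ∀ z ∈ K, v2 z ⬝ᵥ v1 z = 0 := fun z hz => by rw [dotProduct_comm]; exact o12 z hz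
  have o31 : ∀ z ∈ K, v3 z ⬝ᵥ v1 z = 0 := fun z hz => by rw [dotProduct_comm]; exact o13 z hz
  have o32 : ∀ z ∈ K, v3 z ⬝ᵥ v2 z = 0 := fun z hz => by rw [dotProduct_comm]; exact o23 z hz
  have o24 : ∀ z ∈ K, v2 z ⬝ᵥ v4 z = 0 := fun z hz => by rw [dotProduct_comm]; exact o42 z hz
  have o34 : ∀ z ∈ K, v3 z ⬝ᵥ v4 z = 0 := fun z hz => by rw [dotProduct_comm]; exact o43 z hz
  refine quat_contra (fun z => v1 z + a • v4 z) (fun z => v2 z + b • v3 z) (fun z => v1 z - a • v4 z)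
    (hv1.add (hv4.const_smul a)) (hv2.add (hv3.const_smul b)) (hv1.sub (hv4.const_smul a)) ?_ ?_ ?_ ?_ ?_ ?_ ?_ ?_ ?_
  · intro z hz
    simp only [dotProduct_add, add_dotProduct, dotProduct_smul, smul_dotProduct, smul_eq_mul, (hv1' z hz).1, (hv4' z hz).1, o14 z hz, o41 z hz]
    linear_combination ha
  · intro z hz
    simp only [dotProduct_add, add_dotProduct, dotProduct_smul, smul_dotProduct, smul_eq_mul, (hv2' z hz).1, (hv3' z hz).1, o23 z hz, o32 z hz]
    linear_combination hb
  · intro z hz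
    simp only [dotProduct_sub, sub_dotProduct, dotProduct_smul, smul_dotProduct, smul_eq_mul, (hv1' z hz).1, (hv4' z hz).1, o14 z hz, o41 z hz]
    linear_combination ha
  · intro z hz
    simp only [dotProduct_add, add_dotProduct, dotProduct_smul, smul_dotProduct, smul_eq_mul, o21 z hz, o24 z hz, o31 z hz, o34 z hz]
    ring
  · intro z hz
    simp only [dotProduct_add, sub_dotProduct, dotProduct_smul, smul_dotProduct, smul_eq_mul, (hv1' z hz).1, (hv4' z hz).1, o14 z hz, o41 z hz]
    linear_combination -ha
  · intro z hz
    simp only [dotProduct_sub, add_dotProduct, dotProduct_smul, smul_dotProduct, smul_eq_mul, o21 z hz, o24 z hz, o31 z hz, o34 z hz]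
    ring
  · intro z hz
    simp only [ha' z hz, ha'' z hz, smul_smul, ha, one_smul]
    abel
  · intro z hz
    simp only [hb' z hz, hb'' z hz, smul_smul, hb, one_smul]
    abel
  · intro z hz
    simp only [ha' z hz, ha'' z hz, smul_smul, ha, one_smul]
    abel

lemma exists_node {M : V4 →ₗ[ℝ] M4} {e : V4} (hN : Net M e) : ∃ x, x ≠ 0 ∧ Ker2 (M x) := by
  by_contra hcon
  push Not at hcon
  have he : e ≠ 0 := by
    intro h0
    have := hN.one
    rw [h0, map_zero] at this
    exact zero_ne_one this
  obtain ⟨u0, hu0⟩ := avoid (fun _ : Unit => ![e, 0, 0])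
  replace hu0 : ∀ (a : ℝ), u0 ≠ a • e := fun a h => hu0 () a 0 0 (by rw [h]; simp)
  obtain ⟨u1, hu1⟩ := avoid (fun _ : Unit => ![e, u0, 0])
  replace hu1 : ∀ (a b : ℝ), u1 ≠ a • e + b • u0 := fun a b h => hu1 () a b 0 (by rw [h]; simp)
  obtain ⟨u2, hu2⟩ := avoid (fun _ : Unit => ![e, u0, u1])
  replace hu2 : ∀ (a b c : ℝ), u2 ≠ a • e + b • u0 + c • u1 := fun a b c => hu2 () a b c
  have hI : Ind4 e u0 u1 u2 := ind4_of he hu0 hu1 hu2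
  have hMc : Continuous (fun x => M x) := LinearMap.continuous_of_finiteDimensional _
  refine no_family (A := fun z => M ((1 - ‖z‖) • u0 + z.re • u1 + z.im • u2)) (fun z => hN.symm _) ?_ ?_ ?_
  · refine (hMc.comp ?_).continuousOn
    have h1 := Complex.continuous_re
    have h2 := Complex.continuous_im
    fun_prop
  · intro z hz a hK
    refine hcon (((1 - ‖z‖) • u0 + z.re • u1 + z.im • u2) - a • e) ?_ (by rw [map_sub M _ (a • e), map_smul M a e, hN.one]; exact hK)
    intro h0
    obtain ⟨-, h1, h2, h3⟩ := hI (-a) (1 - ‖z‖) z.re z.im (by rw [← h0]; module)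
    have : z = 0 := Complex.ext h2 h3
    rw [this] at h1; simp at h1
  · intro z hz
    have hz1 : ‖z‖ = 1 := by simpa using hz
    rw [← map_neg]
    congr 1
    simp [hz1]
    abel

/-- If a transversal real determinantal quartic has nonempty spectrahedral region `R`, then
the number `m` of its real nodes lying in the closure of `R` and the number `n` of its real
nodes not lying in the closure of `R` are both even, and `m + n ≥ 2`. -/
theorem even_nodes_of_spectrahedron_nonempty
    (Q : Fin 4 → Matrix (Fin 4) (Fin 4) ℝ) (hsym : ∀ i, (Q i).IsSymm)
    (htr : Transversal Q) (hR : (spectra Q).Nonempty) (m n : ℕ)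
    (hm : m = (realNodes Q ∩ closure (spectra Q)).ncard)
    (hn : n = (realNodes Q \ closure (spectra Q)).ncard) :
    Even m ∧ Even n ∧ 2 ≤ m + n := by
  obtain ⟨M, e, hN, hnodes, hcl⟩ := setup hsym htr hR
  have hfin := realNodes_finite htr
  have hev := realNodes_even htr
  have hmE : Even m := hm ▸ even_m hfin hN hnodes hcl
  have hsum : m + n = (realNodes Q).ncard := by
    rw [hm, hn]; exact Set.ncard_inter_add_ncard_diff_eq_ncard _ _ hfin
  rw [← hsum] at hev
  have hnE : Even n := (Nat.even_add.1 hev).1 hmE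
  have hpos : m + n ≠ 0 := by
    rw [hsum]
    obtain ⟨x, hx, hK⟩ := exists_node hN
    have : Projectivization.mk ℝ x hx ∈ realNodes Q := by rw [hnodes]; exact ⟨x, hx, rfl, hK⟩
    exact Set.ncard_ne_zero_of_mem this hfin
  refine ⟨hmE, hnE, ?_⟩
  obtain ⟨k, hk⟩ := hev
  omega

end DetQuartic
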